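/- Fix a prime p. Let K be a p-adic differential field whose field of constants k is p-adically closed, with k ≠ K, let A ∈ Mat_n(K), and let L₁, L₂ be two p-adic Picard–Vessiot fields for y′ = Ay over K. Suppose L₁ and L₂ have p-adic closures L₁⁺ and L₂⁺ such that the p-adic valuations of L₁⁺ and L₂⁺ induce the same p-adic valuation on K and such that K ∩ (L₁⁺)ⁿ = K ∩ (L₂⁺)ⁿ for every integer n ≥ 2 (where Fⁿ := {fⁿ : f ∈ F}). Then there exists a K-linear isomorphism φ : L₁ → L₂ of differential fields. -/

import Mathlib

/-- A derivation on a field `F`. -/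
structure FieldDeriv (F : Type) [Field F] : Type where
  d : F → F
  map_add : ∀ a b : F, d (a + b) = d a + d b
  leibniz : ∀ a b : F, d (a * b) = a * d b + d a * b

/-- A valuation subring `O` of `F` witnesses that `F` is a p-adic field if `pO` is the
maximal ideal of `O` and `O/pO ≅ 𝔽_p`. -/
def PAdicWitness (p : ℕ) {F : Type} [Field F] (O : ValuationSubring F) : Prop :=
  (Ideal.span {(p : O)}).IsMaximal ∧
    Nonempty ((O ⧸ (Ideal.span {(p : O)} : Ideal O)) ≃+* ZMod p)

/-- A field is p-adic if it admits a valuation subring witnessing this. -/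
def IsPAdicField (p : ℕ) (F : Type) [Field F] : Prop :=
  ∃ O : ValuationSubring F, PAdicWitness p O

/-- A field is p-adically closed if it is p-adic and no proper algebraic extension of it
is p-adic. -/
def IsPAdicallyClosed (p : ℕ) (F : Type) [Field F] : Prop :=
  IsPAdicField p F ∧
    ∀ (E : Type) [Field E] [Algebra F E], Algebra.IsAlgebraic F E →
      IsPAdicField p E → Function.Surjective (algebraMap F E)

/-- `L/K`, with derivations `dL` extending `dK`, is a Picard--Vessiot field for `y' = A y`. -/
def IsPicardVessiot {K L : Type} [Field K] [Field L] [Algebra K L]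
    (dK : FieldDeriv K) (dL : FieldDeriv L) {n : ℕ}
    (A : Matrix (Fin n) (Fin n) K) : Prop :=
  (∀ a : K, dL.d (algebraMap K L a) = algebraMap K L (dK.d a)) ∧
  ∃ F : Matrix (Fin n) (Fin n) L, IsUnit F.det ∧
    (∀ i j, dL.d (F i j) = (A.map (algebraMap K L) * F) i j) ∧
    IntermediateField.adjoin K (Set.range fun q : Fin n × Fin n => F q.1 q.2) = ⊤ ∧
    ∀ x : L, dL.d x = 0 → ∃ a : K, dK.d a = 0 ∧ algebraMap K L a = x

namespace PadicPV

open Polynomial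

variable {F : Type*} [Field F] {Γ : Type*} [LinearOrderedCommGroupWithZero Γ]

/-- A valuation with `v p < 1`, uniformizer `p` and residue field `𝔽_p`. -/
structure IsPadicVal (p : ℕ) (v : Valuation F Γ) : Prop where
  lt_one : v p < 1
  residue : ∀ x, v x ≤ 1 → ∃ n : ℤ, v (x - n) ≤ v p

/-- Hensel's lemma for monic polynomials. -/
def IsHenselianVal (v : Valuation F Γ) : Prop :=
  ∀ f : F[X], f.Monic → (∀ i, v (f.coeff i) ≤ 1) → ∀ a, v a ≤ 1 → v (f.eval a) < 1 →
    v (f.derivative.eval a) = 1 → ∃ b, f.eval b = 0 ∧ v (b - a) < 1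

/-- Every nonzero element is a rational multiple of an `N`-th power. -/
def RatPow (F : Type*) [Field F] : Prop :=
  ∀ N : ℕ, 1 ≤ N → ∀ x : F, x ≠ 0 → ∃ (q : ℚ) (z : F), x = q * z ^ N

theorem val_intCast_le_one (v : Valuation F Γ) (n : ℤ) : v n ≤ 1 := by
  have h : ((n : ℤ) : F) ∈ v.integer := intCast_mem v.integer n
  exact h

theorem val_natCast_le_one (v : Valuation F Γ) (n : ℕ) : v n ≤ 1 := by
  simpa using val_intCast_le_one v n

theorem val_mul_lt_one {v : Valuation F Γ} {x y : F} (hx : v x ≤ 1) (hy : v y < 1) :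
    v (x * y) < 1 := by
  rw [map_mul]
  exact (mul_le_of_le_one_left' hx).trans_lt hy

theorem val_eq_one_of_sub_lt {v : Valuation F Γ} {x y : F} (hx : v x = 1) (h : v (y - x) < 1) :
    v y = 1 := by
  rw [← hx] at h ⊢
  exact Valuation.map_eq_of_sub_lt v h

section
variable {p : ℕ} (hp : p.Prime) {v : Valuation F Γ} (hv : IsPadicVal p v)
include hp hv

theorem IsPadicVal.val_intCast_eq_one {n : ℤ} (hn : ¬ (p : ℤ) ∣ n) : v n = 1 := by
  refine le_antisymm (val_intCast_le_one v n) ?_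
  by_contra! hlt
  have hc : IsCoprime (p : ℤ) n := (Nat.prime_iff_prime_int.1 hp).coprime_iff_not_dvd.2 hn
  obtain ⟨a, b, hab⟩ := hc
  have h1 : ((a : F) * (p : F) + b * n) = 1 := by exact_mod_cast congrArg (Int.cast (R := F)) hab
  have h2 : v ((a : F) * (p : F) + b * n) < 1 := by
    refine Valuation.map_add_lt v ?_ ?_
    · exact val_mul_lt_one (val_intCast_le_one v a) hv.lt_one
    · exact val_mul_lt_one (val_intCast_le_one v b) hlt
  rw [h1, map_one] at h2
  exact lt_irrefl _ h2

theorem IsPadicVal.le_of_lt_one {x : F} (hx : v x < 1) : v x ≤ v p := by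
  obtain ⟨n, hn⟩ := hv.residue x hx.le
  have hn1 : v n < 1 := by
    have : v (x - (x - n)) < 1 := Valuation.map_sub_lt v hx (hn.trans_lt hv.lt_one)
    rwa [sub_sub_cancel] at this
  have hpn : (p : ℤ) ∣ n := by
    by_contra h
    exact hn1.ne (hv.val_intCast_eq_one hp h)
  obtain ⟨m, rfl⟩ := hpn
  have : v (((p : ℤ) * m : ℤ) : F) ≤ v p := by
    push_cast
    rw [map_mul]
    exact mul_le_of_le_one_right' (val_intCast_le_one v m)
  have h3 := Valuation.map_add_le v hn this
  rwa [sub_add_cancel] at h3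

variable [CharZero F]

omit hv in
theorem val_p_ne_zero : v p ≠ 0 := by
  rw [Valuation.ne_zero_iff]
  exact_mod_cast hp.ne_zero

theorem IsPadicVal.residue_pow (T : ℕ) {x : F} (hx : v x ≤ 1) :
    ∃ n : ℤ, v (x - n) ≤ v p ^ T := by
  induction T with
  | zero => exact ⟨0, by simpa using hx⟩
  | succ T ih =>
    obtain ⟨n, hn⟩ := ih
    have hp0 : v (p : F) ≠ 0 := val_p_ne_zero hp
    have hp0' : (p : F) ≠ 0 := by exact_mod_cast hp.ne_zero
    have h1 : v ((x - n) / (p : F) ^ T) ≤ 1 := by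
      rw [map_div₀, map_pow]
      exact div_le_one_of_le₀ hn zero_le
    obtain ⟨m, hm⟩ := hv.residue _ h1
    refine ⟨n + p ^ T * m, ?_⟩
    have : x - ((n + p ^ T * m : ℤ) : F) = p ^ T * ((x - n) / (p : F) ^ T - m) := by
      push_cast
      field_simp
      ring
    rw [this, map_mul, map_pow, pow_succ]
    gcongr

omit [CharZero F] in
theorem IsPadicVal.val_natCast {N : ℕ} (hN : N ≠ 0) : ∃ T : ℕ, v (N : F) = v p ^ T := by
  obtain ⟨T, m, hm, rfl⟩ := Nat.exists_eq_pow_mul_and_not_dvd hN p hp.ne_one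
  refine ⟨T, ?_⟩
  have : v ((m : ℤ) : F) = 1 := hv.val_intCast_eq_one hp (by exact_mod_cast hm)
  push_cast at this ⊢
  rw [map_mul, map_pow, this, mul_one]

theorem IsPadicVal.residue_natCast {N : ℕ} (hN : N ≠ 0) {x : F} (hx : v x ≤ 1) :
    ∃ n : ℤ, v (x - n) ≤ v (N : F) := by
  obtain ⟨T, hT⟩ := hv.val_natCast hp hN
  rw [hT]
  exact hv.residue_pow hp T hx

theorem IsPadicVal.val_ratCast {q : ℚ} (hq : q ≠ 0) : ∃ s : ℤ, v (q : F) = v p ^ s := by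
  obtain ⟨T, hT⟩ := hv.val_natCast hp (N := q.num.natAbs) (by simpa using hq)
  obtain ⟨S, hS⟩ := hv.val_natCast hp (N := q.den) q.den_nz
  have h1 : v (q.num : F) = v (q.num.natAbs : F) := by
    rcases Int.natAbs_eq q.num with h | h
    · conv_lhs => rw [h]
      simp
    · conv_lhs => rw [h]
      rw [Int.cast_neg, Valuation.map_neg]
      simp
  refine ⟨T - S, ?_⟩
  rw [Rat.cast_def, map_div₀, h1, hT, hS, zpow_sub₀ (val_p_ne_zero hp)]
  simp

theorem IsPadicVal.val_eq_pow (T : ℕ) {y : F} (h1 : v y ≤ 1) (h2 : v p ^ T ≤ v y) :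
    ∃ s : ℕ, v y = v p ^ s := by
  induction T generalizing y with
  | zero => exact ⟨0, le_antisymm (by simpa using h1) (by simpa using h2)⟩
  | succ T ih =>
    rcases h1.eq_or_lt with h | h
    · exact ⟨0, by simpa using h⟩
    · have hp0 : v (p : F) ≠ 0 := val_p_ne_zero hp
      have h3 := hv.le_of_lt_one hp h
      obtain ⟨s, hs⟩ := ih (y := y / p) (by rw [map_div₀]; exact div_le_one_of_le₀ h3 zero_le)
        (by rw [map_div₀, le_div_iff₀ (zero_lt_iff.2 hp0), ← pow_succ]; exact h2)
      refine ⟨s + 1, ?_⟩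
      rw [map_div₀, div_eq_iff hp0] at hs
      rw [hs, pow_succ]

theorem IsPadicVal.val_eq_zpow_of_pow {w : F} {r : ℕ} (hr : 1 ≤ r) {s : ℤ}
    (h : v w ^ r = v p ^ s) : ∃ s' : ℤ, v w = v p ^ s' := by
  have hp0 : v (p : F) ≠ 0 := val_p_ne_zero hp
  have key : ∀ (w : F) (s : ℕ), v w ^ r = v p ^ s → ∃ s' : ℤ, v w = v p ^ s' := by
    intro w s h
    have h1 : v w ≤ 1 := by
      by_contra! h1
      have := one_lt_pow₀ h1 (by omega : r ≠ 0)
      rw [h] at this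
      exact absurd this (not_lt.2 (pow_le_one₀ zero_le hv.lt_one.le))
    obtain ⟨t, ht⟩ := hv.val_eq_pow hp s h1 (by
      rw [← h]; exact pow_le_of_le_one zero_le h1 (by omega))
    exact ⟨t, by simpa using ht⟩
  obtain ⟨t, rfl | rfl⟩ := s.eq_nat_or_neg
  · exact key w t (by simpa using h)
  · obtain ⟨s', hs'⟩ := key w⁻¹ t (by rw [map_inv₀, inv_pow, h]; simp)
    refine ⟨-s', ?_⟩
    rw [zpow_neg, ← hs', map_inv₀, inv_inv]

section
variable (hH : IsHenselianVal v)
include hH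

theorem IsPadicVal.exists_pow_eq {N : ℕ} (hN : 1 ≤ N) {u : F}
    (hu : v (u - 1) ≤ v ((N ^ 2 * p : ℕ) : F)) : ∃ z, z ^ N = u := by
  have hN0 : (N : F) ≠ 0 := by exact_mod_cast (by omega : N ≠ 0)
  have hp0 : (p : F) ≠ 0 := by exact_mod_cast hp.ne_zero
  rcases eq_or_lt_of_le hN with rfl | hN2
  · exact ⟨u, pow_one u⟩
  set x : F := (u - 1) / ((N ^ 2 * p : ℕ) : F) with hxdef
  have hx : v x ≤ 1 := by
    rw [hxdef, map_div₀]
    exact div_le_one_of_le₀ hu zero_le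
  have hux : u = 1 + N ^ 2 * p * x := by
    rw [hxdef]; push_cast; field_simp; ring
  by_cases hx0 : x = 0
  · exact ⟨1, by rw [hux, hx0]; simp⟩
  let x' : v.integer := ⟨x, hx⟩
  let b : v.integer := N * p * x'
  obtain ⟨k, hk⟩ := Polynomial.powAddExpansion (X : v.integer[X]) (C b) N
  have hb : algebraMap v.integer F b = N * p * x := by
    change ((N * p * x' : v.integer) : F) = _
    push_cast
    rfl
  have hb0 : b ≠ 0 := by
    intro h
    rw [h, map_zero] at hb
    exact mul_ne_zero (mul_ne_zero hN0 hp0) hx0 hb.symm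
  have hkdeg : k.degree < N := by
    have h1 : k.degree = (k * (C b) ^ 2).degree := by
      rw [← C_pow, degree_mul_C (pow_ne_zero 2 hb0)]
    have h2 : k * (C b) ^ 2 = ((X + C b) ^ N - X ^ N) - C (N * b) * X ^ (N - 1) := by
      rw [hk]; simp only [map_mul, map_natCast]; ring
    rw [h1, h2]
    refine (degree_sub_le _ _).trans_lt (max_lt ?_ ?_)
    · have : ((X + C b) ^ N).degree = (N : WithBot ℕ) := by simp [degree_pow, degree_X_add_C]
      rw [← this]
      refine degree_sub_lt_left ?_ ?_ ?_
      · simp [degree_pow, degree_X_add_C]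
      · exact ((monic_X_add_C b).pow N).ne_zero
      · rw [((monic_X_add_C b).pow N).leadingCoeff, (monic_X_pow N).leadingCoeff]
    · refine (degree_C_mul_X_pow_le _ _).trans_lt ?_
      exact_mod_cast (by omega : N - 1 < N)
  let g : v.integer[X] := X ^ N + (-(X ^ (N - 1)) - C (p * x') * k)
  have hg : g.Monic := by
    refine monic_X_pow_add ((degree_sub_le _ _).trans_lt (max_lt ?_ ?_))
    · rw [degree_neg]
      refine (degree_X_pow_le _).trans_lt ?_
      exact_mod_cast (by omega : N - 1 < N)
    · rw [← smul_eq_C_mul]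
      exact (degree_smul_le _ _).trans_lt hkdeg
  let φ := algebraMap v.integer F
  have hφ : ∀ y, v (φ y) ≤ 1 := fun y => y.2
  have hev : ∀ (h : v.integer[X]), (h.map φ).eval 1 = φ (h.eval 1) := fun h => by
    rw [← map_one φ, eval_map_apply]
  have hpx : ∀ y, v (φ (p * x' * y)) < 1 := fun y => by
    have : φ (p * x' * y) = φ (x' * y) * p := by simp [φ]; ring
    rw [this]
    exact val_mul_lt_one (hφ _) hv.lt_one
  obtain ⟨w, hw0, hw1⟩ := hH (g.map φ) (hg.map φ) (fun i => by rw [coeff_map]; exact hφ _) 1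
    (by simp) (by
      rw [hev]
      have : g.eval 1 = -(p * x' * k.eval 1) := by simp [g]; ring
      rw [this, map_neg, Valuation.map_neg]
      exact hpx _) (by
      rw [derivative_map, hev]
      have : g.derivative.eval 1 = 1 - (p * x' * k.derivative.eval 1) := by
        obtain ⟨M, rfl⟩ : ∃ M, N = M + 1 := ⟨N - 1, by omega⟩
        simp [g, derivative_X_pow]; ring
      rw [this, map_sub, map_one]
      exact Valuation.map_one_sub_of_lt v (hpx _))
  have hwv : v w = 1 := val_eq_one_of_sub_lt (map_one v) hw1
  have hw : w ≠ 0 := by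
    rw [← Valuation.ne_zero_iff v, hwv]; exact one_ne_zero
  refine ⟨(w + N * p * x) / w, ?_⟩
  have hkw := congrArg (fun h => (h.map φ).eval w) hk
  simp only [Polynomial.map_add, Polynomial.map_mul, Polynomial.map_pow, map_X, map_C,
    Polynomial.map_natCast, eval_add, eval_mul, eval_pow, eval_X, eval_C, eval_natCast] at hkw
  have hgw : w ^ N + (-(w ^ (N - 1)) - p * x * (k.map φ).eval w) = 0 := by
    have h3 : φ x' = x := rfl
    simpa [g, h3] using hw0
  change (w + (algebraMap v.integer F b)) ^ N = w ^ N + N * w ^ (N - 1) * (algebraMap v.integer F b)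
    + _ * (algebraMap v.integer F b) ^ 2 at hkw
  rw [hb] at hkw
  rw [div_pow, hkw, div_eq_iff (pow_ne_zero _ hw), hux]
  linear_combination (-(N : F) ^ 2 * p * x) * hgw

theorem IsPadicVal.exists_pow_eq_one_add_mul {N : ℕ} (hN : 1 ≤ N) {w : F} (hw : v w ≤ 1) :
    ∃ z, z ^ N = 1 + ((N ^ 2 * p : ℕ) : F) * w := by
  refine hv.exists_pow_eq hp hH hN ?_
  rw [add_sub_cancel_left, map_mul]
  exact mul_le_of_le_one_right' hw

theorem IsPadicVal.exists_int_mul_pow {N : ℕ} (hN : 1 ≤ N) {u : F} (hu : v u = 1) :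
    ∃ (n : ℤ) (z : F), n ≠ 0 ∧ u = n * z ^ N := by
  obtain ⟨n, hn⟩ := hv.residue_natCast hp (N := N ^ 2 * p)
    (mul_ne_zero (pow_ne_zero _ (by omega)) hp.ne_zero) hu.le
  have hlt : v ((N ^ 2 * p : ℕ) : F) < 1 := by
    rw [Nat.cast_mul]
    exact val_mul_lt_one (val_natCast_le_one v (N ^ 2)) hv.lt_one
  have hn1 : v (n : F) = 1 := val_eq_one_of_sub_lt hu (by
    rw [Valuation.map_sub_swap]; exact hn.trans_lt hlt)
  have hn0 : (n : F) ≠ 0 := by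
    rw [← Valuation.ne_zero_iff v, hn1]; exact one_ne_zero
  obtain ⟨z, hz⟩ := hv.exists_pow_eq hp hH hN (u := u / n) (by
    rw [div_sub_one hn0, map_div₀, hn1, div_one]; exact hn)
  exact ⟨n, z, by exact_mod_cast hn0, by rw [hz]; field_simp⟩

theorem IsPadicVal.le_one_iff_exists_pow (x : F) :
    v x ≤ 1 ↔ ∃ z, z ^ (p + 1) = 1 + p * x ^ (p + 1) := by
  have hp0 : v (p : F) ≠ 0 := val_p_ne_zero hp
  have hp0' : 0 < v (p : F) := zero_lt_iff.2 hp0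
  constructor
  · intro hx
    refine hv.exists_pow_eq hp hH (by omega) ?_
    have h1 : v ((p + 1 : ℕ) : F) = 1 := by
      have := hv.val_intCast_eq_one hp (n := (p + 1 : ℕ)) (by
        rw [Int.natCast_dvd_natCast, ← Nat.dvd_add_iff_right dvd_rfl]
        exact hp.not_dvd_one)
      simpa using this
    rw [Nat.cast_mul, Nat.cast_pow, map_mul v, map_pow v, h1, one_pow, one_mul,
      add_sub_cancel_left, map_mul, map_pow]
    exact mul_le_of_le_one_right' (pow_le_one₀ zero_le hx)
  · rintro ⟨z, hz⟩
    by_contra! hx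
    have hx0 : x ≠ 0 := by rintro rfl; simp at hx
    have hxi : v x⁻¹ ≤ v p := hv.le_of_lt_one hp ((Valuation.one_lt_val_iff v hx0).1 hx)
    have hpx : 1 ≤ v (p * x) := by
      rw [map_inv₀, inv_le_iff_one_le_mul₀ (zero_lt_one.trans hx)] at hxi
      rwa [map_mul]
    have hbig : v 1 < v (p * x ^ (p + 1)) := by
      have : (p : F) * x ^ (p + 1) = p * x * x ^ p := by ring
      rw [this, map_mul, map_one, map_pow]
      exact one_lt_mul_of_le_of_lt hpx (one_lt_pow₀ hx hp.ne_zero)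
    have heq := Valuation.map_add_eq_of_lt_right v hbig
    rw [← hz, map_pow, map_mul, map_pow] at heq
    have hw : v (z / x) ^ (p + 1) = v p := by
      rw [map_div₀, div_pow, heq, mul_div_assoc, div_self, mul_one]
      exact pow_ne_zero _ (zero_lt_one.trans hx).ne'
    rcases lt_or_ge (v (z / x)) 1 with h | h
    · have h2 := hv.le_of_lt_one hp h
      have h3 : v (p : F) ^ (p + 1) < v p := by
        conv_rhs => rw [← pow_one (v (p : F))]
        exact pow_lt_pow_right_of_lt_one₀ hp0' hv.lt_one (by have := hp.pos; omega)
      exact absurd hw ((pow_le_pow_left₀ zero_le h2 _).trans_lt h3).ne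
    · exact absurd hw (hv.lt_one.trans_le (one_le_pow₀ h)).ne'

end
end
end PadicPV

namespace PadicPV

open Polynomial

section Extension

variable {E L : Type*} [Field E] [Field L] [Algebra E L]
  {Γ Δ : Type*} [LinearOrderedCommGroupWithZero Γ] [LinearOrderedCommGroupWithZero Δ]

/-- The valuation ring of `w` lies over the valuation ring of `v`. -/
def LiesOverVal (v : Valuation E Γ) (w : Valuation L Δ) : Prop :=
  ∀ x, w (algebraMap E L x) ≤ 1 ↔ v x ≤ 1

variable {v : Valuation E Γ} {w : Valuation L Δ}

theorem LiesOverVal.isEquiv (h : LiesOverVal v w) : (w.comap (algebraMap E L)).IsEquiv v := by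
  rw [Valuation.isEquiv_iff_val_le_one]
  intro x
  exact h x

theorem LiesOverVal.le_iff (h : LiesOverVal v w) {x y : E} :
    w (algebraMap E L x) ≤ w (algebraMap E L y) ↔ v x ≤ v y := h.isEquiv x y

theorem LiesOverVal.lt_one_iff (h : LiesOverVal v w) {x : E} :
    w (algebraMap E L x) < 1 ↔ v x < 1 := by
  have := h.le_iff (x := 1) (y := x)
  rw [map_one, map_one, map_one] at this
  rw [← not_le, this, not_le]

theorem LiesOverVal.eq_one_iff (h : LiesOverVal v w) {x : E} :
    w (algebraMap E L x) = 1 ↔ v x = 1 := by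
  rw [le_antisymm_iff, le_antisymm_iff, h x, ← not_lt (b := (1 : Δ)), ← not_lt (b := (1 : Γ)),
    h.lt_one_iff]

theorem isIntegral_val_le_one (h : LiesOverVal v w) {z : L} (hz : IsIntegral v.integer z) :
    w z ≤ 1 := by
  obtain ⟨f, hf, hfz⟩ := hz
  by_contra! hlt
  have hz0 : z ≠ 0 := by rintro rfl; simp at hlt
  rw [eval₂_eq_sum_range, Finset.sum_range_succ, hf.coeff_natDegree, map_one, one_mul,
    add_comm] at hfz
  have h1 : w (∑ i ∈ Finset.range f.natDegree, algebraMap v.integer L (f.coeff i) * z ^ i)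
      < w (z ^ f.natDegree) := by
    refine Valuation.map_sum_lt _ ((Valuation.ne_zero_iff w).2 (pow_ne_zero _ hz0)) fun i hi => ?_
    have hc : w (algebraMap v.integer L (f.coeff i)) ≤ 1 := (h _).2 (f.coeff i).2
    rw [map_mul, map_pow, map_pow]
    exact (mul_le_of_le_one_left' hc).trans_lt (pow_lt_pow_right₀ hlt (Finset.mem_range.1 hi))
  have h2 := Valuation.map_add_eq_of_lt_left w h1
  rw [hfz, map_zero] at h2
  exact ((Valuation.ne_zero_iff w).2 (pow_ne_zero _ hz0)) h2.symm

/-- An element of a valuation ring of an algebraic extension is a quotient of integral elements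
whose denominator is a unit. -/
theorem exists_integral_fraction [Algebra.IsAlgebraic E L] (h : LiesOverVal v w) {z : L}
    (hz : w z ≤ 1) :
    ∃ b c : L, IsIntegral v.integer b ∧ IsIntegral v.integer c ∧ w b = 1 ∧ z * b = c := by
  classical
  by_cases hz0 : z = 0
  · exact ⟨1, 0, isIntegral_one, isIntegral_zero, map_one w, by simp [hz0]⟩
  obtain ⟨g, hg0, hg⟩ := Algebra.IsAlgebraic.isAlgebraic (R := E) z
  obtain ⟨i₀, hi₀, hmax⟩ := Finset.exists_max_image g.support (fun i => v (g.coeff i))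
    (by simpa using hg0)
  obtain ⟨j, hj, hjmax⟩ := Finset.exists_max_image
    (g.support.filter fun i => v (g.coeff i) = v (g.coeff i₀)) id ⟨i₀, by simp [hi₀] at *⟩
  rw [Finset.mem_filter] at hj
  have hj0 : g.coeff j ≠ 0 := by simpa using hj.1
  have hvj : v (g.coeff j) ≠ 0 := (Valuation.ne_zero_iff v).2 hj0
  let a : ℕ → E := fun i => g.coeff i / g.coeff j
  have ha1 : ∀ i, v (a i) ≤ 1 := by
    intro i
    simp only [a, map_div₀]
    refine div_le_one_of_le₀ ?_ zero_le
    by_cases hi : i ∈ g.support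
    · rw [hj.2]; exact hmax i hi
    · simp only [mem_support_iff, not_not] at hi
      simp [hi]
  have haj : a j = 1 := div_self hj0
  have ha2 : ∀ i, j < i → v (a i) < 1 := by
    intro i hij
    simp only [a, map_div₀]
    rw [div_lt_one₀ (zero_lt_iff.2 hvj)]
    by_cases hi : i ∈ g.support
    · refine lt_of_le_of_ne (by rw [hj.2]; exact hmax i hi) fun heq => ?_
      have := hjmax i (by simp only [Finset.mem_filter]; exact ⟨hi, heq.trans hj.2⟩)
      simp at this
      omega
    · simp only [mem_support_iff, not_not] at hi
      simp [hi, zero_lt_iff, hvj]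
  let A : ℕ → L := fun i => algebraMap E L (a i)
  let s := Finset.range (g.natDegree + 1)
  have hsum : ∑ i ∈ s, A i * z ^ i = 0 := by
    have h1 : aeval z g = ∑ i ∈ s, algebraMap E L (g.coeff i) * z ^ i := by
      rw [aeval_eq_sum_range]
      simp [s, Algebra.smul_def]
    have h2 : ∑ i ∈ s, A i * z ^ i
        = (algebraMap E L (g.coeff j))⁻¹ * ∑ i ∈ s, algebraMap E L (g.coeff i) * z ^ i := by
      rw [Finset.mul_sum]
      refine Finset.sum_congr rfl fun i _ => ?_
      simp only [A, a, map_div₀]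
      ring
    rw [h2, ← h1, hg, mul_zero]
  let s₁ := s.filter (fun i => j ≤ i)
  let s₂ := s.filter (fun i => ¬ j ≤ i)
  let b := ∑ i ∈ s₁, A i * z ^ (i - j)
  let c := ∑ i ∈ s₂, A i * z⁻¹ ^ (j - i)
  have hbc : b = -c := by
    have h3 : z ^ j * (b + c) = ∑ i ∈ s, A i * z ^ i := by
      rw [← Finset.sum_filter_add_sum_filter_not s (fun i => j ≤ i), mul_add, Finset.mul_sum,
        Finset.mul_sum]
      congr 1
      · refine Finset.sum_congr rfl fun i hi => ?_
        have hi' : j ≤ i := (Finset.mem_filter.1 hi).2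
        obtain ⟨m, rfl⟩ := Nat.exists_eq_add_of_le hi'
        rw [Nat.add_sub_cancel_left]; ring
      · refine Finset.sum_congr rfl fun i hi => ?_
        have hi' : ¬ j ≤ i := (Finset.mem_filter.1 hi).2
        obtain ⟨m, rfl⟩ := Nat.exists_eq_add_of_le (by omega : i ≤ j)
        rw [Nat.add_sub_cancel_left, pow_add, inv_pow]
        field_simp
    rw [hsum] at h3
    have := (mul_eq_zero.1 h3).resolve_left (pow_ne_zero _ hz0)
    exact eq_neg_of_add_eq_zero_left this
  have hzc : z * b = -∑ i ∈ s₂, A i * z⁻¹ ^ (j - i - 1) := by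
    rw [hbc, mul_neg, Finset.mul_sum]
    congr 1
    refine Finset.sum_congr rfl fun i hi => ?_
    have hi' : ¬ j ≤ i := (Finset.mem_filter.1 hi).2
    obtain ⟨m, hm⟩ := Nat.exists_eq_add_of_le (by omega : 1 ≤ j - i)
    rw [hm, Nat.add_sub_cancel_left, pow_add]
    field_simp
  have hintg : ∀ y : L, (∀ V : ValuationSubring L, (∀ i, A i ∈ V) → y ∈ V) →
      IsIntegral v.integer y := by
    intro y hy
    have h1 : y ∈ (⨅ V : {V : ValuationSubring L //
        ((algebraMap E L) '' (v.integer : Set E)) ⊆ V.toSubring}, V.1.toSubring) := by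
      rw [Subring.mem_iInf]
      rintro ⟨V, hV⟩
      exact hy V fun i => hV ⟨a i, ha1 i, rfl⟩
    rw [iInf_valuationSubring_superset] at h1
    have h2 : IsIntegral (Subring.closure ((algebraMap E L) '' (v.integer : Set E))) y := h1
    have h3 : Subring.closure ((algebraMap E L) '' (v.integer : Set E))
        = v.integer.map (algebraMap E L) := by
      rw [← Subring.coe_map, Subring.closure_eq]
    rw [h3] at h2
    obtain ⟨f, hf, hfy⟩ := h2
    let ψ : v.integer →+* v.integer.map (algebraMap E L) :=
      ((algebraMap E L).comp v.integer.subtype).codRestrict _ fun x => ⟨x, x.2, rfl⟩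
    have hψ : Function.Surjective ψ := by
      rintro ⟨_, x, hx, rfl⟩
      exact ⟨⟨x, hx⟩, rfl⟩
    obtain ⟨f', hf', -, hf'm⟩ := lifts_and_degree_eq_and_monic
      (f := ψ) (p := f) (by rw [mem_lifts]; exact map_surjective ψ hψ f) hf
    refine ⟨f', hf'm, ?_⟩
    rw [← hfy, ← hf', eval₂_map]
    rfl
  have hVz : ∀ V : ValuationSubring L, (∀ i, A i ∈ V) → b ∈ V ∧ z * b ∈ V := by
    intro V hV
    rcases V.mem_or_inv_mem z with hzV | hzV
    · have hb : b ∈ V := sum_mem fun i _ => mul_mem (hV i) (pow_mem hzV _)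
      exact ⟨hb, mul_mem hzV hb⟩
    · refine ⟨?_, ?_⟩
      · rw [hbc]
        exact neg_mem (sum_mem fun i _ => mul_mem (hV i) (pow_mem hzV _))
      · rw [hzc]
        exact neg_mem (sum_mem fun i _ => mul_mem (hV i) (pow_mem hzV _))
  refine ⟨b, z * b, hintg b fun V hV => (hVz V hV).1, hintg _ fun V hV => (hVz V hV).2, ?_, rfl⟩
  have hjs : j ∈ s₁ := by
    simp only [s₁, s, Finset.mem_filter, Finset.mem_range, le_refl, and_true]
    exact Nat.lt_succ_of_le (le_natDegree_of_ne_zero hj0)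
  have hb : b = 1 + ∑ i ∈ s₁.erase j, A i * z ^ (i - j) := by
    simp only [b]
    rw [← Finset.add_sum_erase _ _ hjs]
    simp [A, haj]
  rw [hb]
  refine Valuation.map_one_add_of_lt w (Valuation.map_sum_lt _ one_ne_zero fun i hi => ?_)
  rw [Finset.mem_erase] at hi
  have hi' : j ≤ i := (Finset.mem_filter.1 hi.2).2
  rw [mul_comm]
  exact val_mul_lt_one (by rw [map_pow]; exact pow_le_one₀ zero_le hz)
    (h.lt_one_iff.2 (ha2 i (by omega)))

end Extension
end PadicPV

namespace PadicPV

open Polynomial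

section Galois

variable {E L : Type*} [Field E] [Field L] [Algebra E L]
  {Γ Δ : Type*} [LinearOrderedCommGroupWithZero Γ] [LinearOrderedCommGroupWithZero Δ]
  {v : Valuation E Γ} {w : Valuation L Δ}

theorem isIntegral_algHom_apply {L' : Type*} [Field L'] [Algebra E L'] (σ : L →ₐ[E] L') {z : L}
    (hz : IsIntegral v.integer z) : IsIntegral v.integer (σ z) := by
  obtain ⟨f, hf, hfz⟩ := hz
  refine ⟨f, hf, ?_⟩
  have h1 : algebraMap v.integer L' = (σ : L →+* L').comp (algebraMap v.integer L) := by
    ext x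
    exact (σ.commutes (x : E)).symm
  have h2 := hom_eval₂ f (algebraMap v.integer L) (σ : L →+* L') z
  rw [hfz, map_zero] at h2
  rw [h1]
  exact h2.symm

theorem val_minpoly_coeff_le_one {z : L} (hz : IsIntegral v.integer z) (i : ℕ) :
    v ((minpoly E z).coeff i) ≤ 1 := by
  have h1 := minpoly.isIntegrallyClosed_eq_field_fractions' E hz
  rw [h1, coeff_map]
  exact ((minpoly v.integer z).coeff i).2

/-- Uniqueness of the extension of a henselian valuation, for finite Galois extensions. -/
theorem IsHenselianVal.val_algEquiv_le_one_of_finite [FiniteDimensional E L] [IsGalois E L]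
    (hH : IsHenselianVal v) (h : LiesOverVal v w) (σ : L ≃ₐ[E] L) {x : L} (hx : w x ≤ 1) :
    w (σ x) ≤ 1 := by
  classical
  let D : Set (L ≃ₐ[E] L) := {τ | ∀ c, IsIntegral v.integer c → w c < 1 → w (τ c) < 1}
  have hintg : ∀ (τ : L ≃ₐ[E] L) {c : L}, IsIntegral v.integer c → IsIntegral v.integer (τ c) :=
    fun τ c hc => isIntegral_algHom_apply (τ : L →ₐ[E] L) hc
  have hle : ∀ {c : L}, IsIntegral v.integer c → w c ≤ 1 := fun hc => isIntegral_val_le_one h hc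
  have hmul : ∀ τ ∈ D, ∀ ρ ∈ D, τ * ρ ∈ D := fun τ hτ ρ hρ c hc hcw =>
    hτ _ (hintg ρ hc) (hρ c hc hcw)
  have hone : (1 : L ≃ₐ[E] L) ∈ D := fun c _ hcw => hcw
  have hinv : ∀ τ ∈ D, τ⁻¹ ∈ D := by
    intro τ hτ
    have hpow : ∀ n : ℕ, τ ^ n ∈ D := fun n => by
      induction n with
      | zero => exact hone
      | succ n ih => rw [pow_succ]; exact hmul _ ih _ hτ
    have hfin : IsOfFinOrder τ := isOfFinOrder_of_finite τ
    have : τ⁻¹ = τ ^ (orderOf τ - 1) := by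
      rw [inv_eq_iff_mul_eq_one, ← pow_succ', Nat.sub_add_cancel hfin.orderOf_pos, pow_orderOf_eq_one]
    rw [this]
    exact hpow _
  have hD1 : ∀ τ ∈ D, ∀ c, IsIntegral v.integer c → w c = 1 → w (τ c) = 1 := by
    intro τ hτ c hc hcw
    refine le_antisymm (hle (hintg τ hc)) ?_
    by_contra! hlt
    have := hinv τ hτ _ (hintg τ hc) hlt
    rw [← AlgEquiv.mul_apply, inv_mul_cancel, AlgEquiv.one_apply, hcw] at this
    exact lt_irrefl _ this
  have hDtop : ∀ τ, τ ∈ D := by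
    by_contra! hne
    obtain ⟨σ₀, hσ₀⟩ := hne
    have ht : ∀ τ : L ≃ₐ[E] L, ∃ t, IsIntegral v.integer t ∧ w t = 1 ∧ (τ ∉ D → w (τ t) < 1) := by
      intro τ
      by_cases hτ : τ ∈ D
      · exact ⟨1, isIntegral_one, map_one w, fun h => absurd hτ h⟩
      · have hτ' : τ⁻¹ ∉ D := fun h => hτ (by simpa using hinv _ h)
        simp only [D, Set.mem_ofPred_eq, not_forall, not_lt] at hτ'
        obtain ⟨c, hc, hcw, hc1⟩ := hτ'
        refine ⟨τ⁻¹ c, hintg _ hc, le_antisymm (hle (hintg _ hc)) hc1, fun _ => ?_⟩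
        rwa [← AlgEquiv.mul_apply, mul_inv_cancel, AlgEquiv.one_apply]
    choose t ht1 ht2 ht3 using ht
    let y₀ := ∏ τ, t τ
    have hy₀i : IsIntegral v.integer y₀ := IsIntegral.prod _ fun τ _ => ht1 τ
    have hy₀1 : w y₀ = 1 := by simp [y₀, map_prod, ht2]
    have hy₀D : ∀ τ, τ ∉ D → w (τ y₀) < 1 := by
      intro τ hτ
      simp only [y₀, map_prod]
      rw [← Finset.mul_prod_erase _ _ (Finset.mem_univ τ)]
      refine (mul_le_of_le_one_right' ?_).trans_lt (ht3 τ hτ)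
      exact Finset.prod_le_one' fun ρ _ => hle (hintg τ (ht1 ρ))
    let y := ∏ τ : D, (τ : L ≃ₐ[E] L) y₀
    have hyi : IsIntegral v.integer y := IsIntegral.prod _ fun τ _ => hintg _ hy₀i
    have hy1 : w y = 1 := by
      simp only [y, map_prod]
      exact Finset.prod_eq_one fun τ _ => hD1 _ τ.2 _ hy₀i hy₀1
    have hyD : ∀ τ ∈ D, τ y = y := by
      intro τ hτ
      simp only [y, map_prod]
      let e : D ≃ D :=
        { toFun := fun ρ => ⟨τ * ρ, hmul _ hτ _ ρ.2⟩
          invFun := fun ρ => ⟨τ⁻¹ * ρ, hmul _ (hinv _ hτ) _ ρ.2⟩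
          left_inv := fun ρ => by simp
          right_inv := fun ρ => by simp }
      exact Fintype.prod_equiv e _ _ fun ρ => rfl
    have hynD : ∀ τ, τ ∉ D → w (τ y) < 1 := by
      intro τ hτ
      simp only [y, map_prod]
      rw [← Finset.mul_prod_erase _ _ (Finset.mem_univ (⟨1, hone⟩ : D))]
      refine (mul_le_of_le_one_right' ?_).trans_lt (hy₀D τ hτ)
      exact Finset.prod_le_one' fun ρ _ => hle (hintg τ (hintg _ hy₀i))
    have hyE : IsIntegral E y := Algebra.IsIntegral.isIntegral y
    let f := minpoly E y
    have hconj : ∀ r : L, aeval r f = 0 → r ≠ y → w r < 1 := by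
      intro r hr hry
      obtain ⟨τ, hτ⟩ := minpoly.exists_algEquiv_of_root' (Algebra.IsAlgebraic.isAlgebraic y) hr
      rw [← hτ]
      exact hynD τ fun hτD => hry (by rw [← hτ, hyD τ hτD])
    let fL := f.map (algebraMap E L)
    have hfL : fL.Monic := (minpoly.monic hyE).map _
    have hsplit : fL.Splits := Normal.splits inferInstance y
    have hroot : fL.IsRoot y := by
      rw [IsRoot.def, eval_map_algebraMap, minpoly.aeval]
    obtain ⟨q, hq⟩ := dvd_iff_isRoot.2 hroot
    have hsep : fL.Separable :=
      Separable.map (Algebra.IsSeparable.isSeparable E y : (minpoly E y).Separable)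
    have hqm : q.Monic := (monic_X_sub_C y).of_mul_monic_left (hq ▸ hfL)
    have hqs : q.Splits := hsplit.of_dvd hfL.ne_zero ⟨X - C y, by rw [hq, mul_comm]⟩
    have hqr : ∀ r ∈ q.roots, w r < 1 := by
      intro r hr
      have hr' : q.eval r = 0 := (mem_roots'.1 hr).2
      refine hconj r ?_ ?_
      · rw [← eval_map_algebraMap]
        change fL.eval r = 0
        rw [hq, eval_mul, hr', mul_zero]
      · intro hry
        have := hsep.eval₂_derivative_ne_zero (RingHom.id L) (x := y) (by
          rw [← eval_map, Polynomial.map_id]; exact hroot)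
        rw [← eval_map, Polynomial.map_id, hq] at this
        rw [hry] at hr'
        simp [hr'] at this
    have hqe : ∀ u, w u = 1 → w (q.eval u) = 1 := by
      intro u hu
      rw [hqs.eval_eq_prod_roots_of_monic hqm, map_multiset_prod]
      refine Multiset.prod_eq_one fun z hz => ?_
      simp only [Multiset.map_map, Multiset.mem_map, Function.comp] at hz
      obtain ⟨r, hr, rfl⟩ := hz
      rw [Valuation.map_sub_eq_of_lt_left]
      · exact hu
      · rw [hu]; exact hqr r hr
    have hqd : ∀ u, w u ≤ 1 → w (q.derivative.eval u) ≤ 1 := by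
      intro u hu
      have hmem : q ∈ lifts (algebraMap w.integer L) := by
        rw [hqs.eq_prod_roots_of_monic hqm]
        refine multiset_prod_mem _ fun z hz => ?_
        obtain ⟨r, hr, rfl⟩ := Multiset.mem_map.1 hz
        rw [mem_lifts]
        exact ⟨X - C ⟨r, (hqr r hr).le⟩, by simp; rfl⟩
      obtain ⟨q', hq'⟩ := (mem_lifts _).1 hmem
      rw [← hq', derivative_map]
      have : (map (algebraMap w.integer L) (derivative q')).eval u
        = algebraMap w.integer L ((derivative q').eval (⟨u, hu⟩ : w.integer)) := by
          rw [← eval_map_apply]; rfl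
      rw [this]
      exact ((derivative q').eval (⟨u, hu⟩ : w.integer)).2
    let u : E := - f.nextCoeff
    have hu : w (algebraMap E L u - y) < 1 := by
      have h1 : algebraMap E L u = (X - C y : L[X]).roots.sum + q.roots.sum := by
        have h2 : algebraMap E L f.nextCoeff = fL.nextCoeff :=
          (nextCoeff_map (algebraMap E L).injective f).symm
        simp only [u, map_neg, h2]
        rw [hsplit.nextCoeff_eq_neg_sum_roots_of_monic hfL, hq,
          roots_mul (hq ▸ hfL.ne_zero), Multiset.sum_add]
        ring
      rw [h1, roots_X_sub_C, Multiset.sum_singleton, add_sub_cancel_left]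
      have : ∀ s : Multiset L, (∀ r ∈ s, w r < 1) → w s.sum < 1 := by
        intro s
        induction s using Multiset.induction_on with
        | empty => simp
        | cons a s ih =>
          intro hs
          rw [Multiset.sum_cons]
          exact Valuation.map_add_lt w (hs a (by simp)) (ih fun r hr => hs r (by simp [hr]))
      exact this _ hqr
    have hu1 : w (algebraMap E L u) = 1 := val_eq_one_of_sub_lt hy1 hu
    have hev : ∀ (g : E[X]) (z : E), w ((g.map (algebraMap E L)).eval (algebraMap E L z)) =
        w (algebraMap E L (g.eval z)) := fun g z => by rw [eval_map_apply]
    obtain ⟨b, hb0, hb1⟩ := hH f (minpoly.monic hyE) (val_minpoly_coeff_le_one hyi) u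
      (h.eq_one_iff.1 hu1).le
      (by
        rw [← h.lt_one_iff, ← hev]
        change w (fL.eval _) < 1
        rw [hq, eval_mul, mul_comm]
        exact val_mul_lt_one (hqe _ hu1).le (by simpa using hu))
      (by
        rw [← h.eq_one_iff, ← hev, ← derivative_map]
        change w (fL.derivative.eval _) = 1
        rw [hq, derivative_mul]
        simp only [derivative_sub, derivative_X, derivative_C, sub_zero, one_mul, eval_add,
          eval_mul, eval_sub, eval_X, eval_C]
        rw [Valuation.map_add_eq_of_lt_left, hqe _ hu1]
        rw [hqe _ hu1, mul_comm]
        exact val_mul_lt_one (hqd _ hu1.le) hu)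
    have hby : algebraMap E L b = y := by
      by_contra hne
      have h1 : w (algebraMap E L b) < 1 := hconj _ (by
        rw [aeval_algebraMap_apply, coe_aeval_eq_eval, hb0, map_zero]) hne
      have h2 := h.lt_one_iff.1 h1
      have h3 : v u < 1 := by
        have := Valuation.map_sub_lt v h2 hb1
        rwa [sub_sub_cancel] at this
      rw [← h.lt_one_iff, hu1] at h3
      exact lt_irrefl _ h3
    have := hynD σ₀ hσ₀
    rw [← hby, AlgEquiv.commutes, hby, hy1] at this
    exact lt_irrefl _ this
  obtain ⟨b, c, hb, hc, hb1, hbc⟩ := exists_integral_fraction h hx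
  have h1 : w (σ b) = 1 := hD1 σ (hDtop σ) b hb hb1
  have h2 : w (σ c) ≤ 1 := hle (hintg σ hc)
  rwa [← hbc, map_mul, map_mul, h1, mul_one] at h2

end Galois
end PadicPV

namespace PadicPV

open Polynomial

section Galois

variable {E L : Type*} [Field E] [Field L] [Algebra E L]
  {Γ Δ Δ' : Type*} [LinearOrderedCommGroupWithZero Γ] [LinearOrderedCommGroupWithZero Δ]
  [LinearOrderedCommGroupWithZero Δ']
  {v : Valuation E Γ} {w : Valuation L Δ} {w' : Valuation L Δ'}

theorem exists_liesOverVal (v : Valuation E Γ) (L : Type*) [Field L] [Algebra E L] :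
    ∃ V : ValuationSubring L, LiesOverVal v V.valuation := by
  obtain ⟨V, hV, hloc⟩ := IsLocalRing.exists_factor_valuationRing
    ((algebraMap E L).comp v.valuationSubring.subtype)
  refine ⟨V, fun x => ?_⟩
  rw [ValuationSubring.valuation_le_one_iff]
  refine ⟨fun hx => ?_, fun hx => hV ⟨x, hx⟩⟩
  by_contra! hlt
  have hx0 : x ≠ 0 := by rintro rfl; simp at hlt
  have hxi : v x⁻¹ < 1 := (Valuation.one_lt_val_iff v hx0).1 hlt
  have hu : IsUnit (⟨x⁻¹, hxi.le⟩ : v.valuationSubring) := by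
    refine hloc.map_nonunit _ ?_
    refine IsUnit.of_mul_eq_one ⟨algebraMap E L x, hx⟩ ?_
    ext
    change algebraMap E L x⁻¹ * algebraMap E L x = 1
    rw [← map_mul, inv_mul_cancel₀ hx0, map_one]
  obtain ⟨⟨y, hy⟩, hxy⟩ := hu.exists_right_inv
  have h1 : x⁻¹ * y = 1 := congrArg Subtype.val hxy
  have h2 : v (x⁻¹ * y) < 1 := by
    rw [mul_comm]; exact val_mul_lt_one hy hxi
  rw [h1, map_one] at h2
  exact lt_irrefl _ h2

theorem exists_iterate_eq [Algebra.IsAlgebraic E L] (σ : L ≃ₐ[E] L) (x : L) :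
    ∃ n : ℕ, 1 ≤ n ∧ (σ ^ n) x = x := by
  have hfin : ((minpoly E x).rootSet L).Finite := rootSet_finite _ _
  have hmem : ∀ n : ℕ, (σ ^ n) x ∈ (minpoly E x).rootSet L := by
    intro n
    rw [mem_rootSet]
    refine ⟨minpoly.ne_zero (Algebra.IsIntegral.isIntegral x), ?_⟩
    rw [aeval_algHom_apply (σ ^ n) x, minpoly.aeval, map_zero]
  obtain ⟨i, j, hij, he⟩ := hfin.exists_lt_map_eq_of_forall_mem hmem
  refine ⟨j - i, by omega, ?_⟩
  refine (σ ^ i).injective ?_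
  rw [← AlgEquiv.mul_apply, ← pow_add, Nat.add_sub_cancel' hij.le, ← he]

/-- An algebraic automorphism preserving the valuation ring preserves the valuation. -/
theorem val_algEquiv_eq [Algebra.IsAlgebraic E L] {σ : L ≃ₐ[E] L}
    (hσ : ∀ x, w (σ x) ≤ 1 ↔ w x ≤ 1) (x : L) : w (σ x) = w x := by
  have hle : ∀ x y, w (σ x) ≤ w (σ y) ↔ w x ≤ w y :=
    ((Valuation.isEquiv_iff_val_le_one (v := w.comap (σ : L →+* L)) (v' := w)).2 (hσ _))
  have hlt : ∀ x y, w (σ x) < w (σ y) ↔ w x < w y := fun x y => by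
    rw [← not_le, hle, not_le]
  obtain ⟨n, hn, hnx⟩ := exists_iterate_eq σ x
  obtain ⟨m, rfl⟩ := Nat.exists_eq_add_of_le' hn
  rcases lt_trichotomy (w (σ x)) (w x) with h | h | h
  · exfalso
    have : ∀ k : ℕ, w ((σ ^ (k + 1)) x) < w x := fun k => by
      induction k with
      | zero => simpa using h
      | succ k ih =>
        rw [pow_succ', AlgEquiv.mul_apply]
        exact ((hlt _ _).2 ih).trans h
    exact absurd (this m) (by rw [hnx]; exact lt_irrefl _)
  · exact h
  · exfalso
    have : ∀ k : ℕ, w x < w ((σ ^ (k + 1)) x) := fun k => by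
      induction k with
      | zero => simpa using h
      | succ k ih =>
        rw [pow_succ', AlgEquiv.mul_apply]
        exact h.trans ((hlt _ _).2 ih)
    exact absurd (this m) (by rw [hnx]; exact lt_irrefl _)

theorem IsHenselianVal.val_algEquiv_le_one [IsGalois E L] (hH : IsHenselianVal v)
    (h : LiesOverVal v w) (σ : L ≃ₐ[E] L) {x : L} (hx : w x ≤ 1) : w (σ x) ≤ 1 := by
  have hxi : IsIntegral E x := Algebra.IsIntegral.isIntegral x
  have : FiniteDimensional E (IntermediateField.adjoin E {x}) :=
    IntermediateField.adjoin.finiteDimensional hxi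
  let N := IntermediateField.normalClosure E (IntermediateField.adjoin E {x}) L
  have hxN : x ∈ N := IntermediateField.le_normalClosure _
    (IntermediateField.mem_adjoin_simple_self E x)
  have : IsGalois E N := ⟨⟩
  have hN : LiesOverVal v (w.comap (algebraMap N L)) := fun z => by
    rw [← h z]
    rfl
  have := hH.val_algEquiv_le_one_of_finite hN (σ.restrictNormal N) (x := ⟨x, hxN⟩) hx
  rw [Valuation.comap_apply, AlgEquiv.restrictNormal_commutes] at this
  exact this

/-- The valuation of a Galois extension of a henselian field is Galois invariant. -/
theorem IsHenselianVal.val_algEquiv_eq [IsGalois E L] (hH : IsHenselianVal v)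
    (h : LiesOverVal v w) (σ : L ≃ₐ[E] L) (x : L) : w (σ x) = w x := by
  refine PadicPV.val_algEquiv_eq (fun y => ⟨fun hy => ?_, hH.val_algEquiv_le_one h σ⟩) x
  have := hH.val_algEquiv_le_one h σ⁻¹ hy
  rwa [← AlgEquiv.mul_apply, inv_mul_cancel, AlgEquiv.one_apply] at this

/-- Averaging over the orbit of a group of automorphisms preserving the valuation. -/
theorem exists_fixed_approx [CharZero L] [Algebra.IsAlgebraic E L] (D : Subgroup (L ≃ₐ[E] L))
    (hD : ∀ σ ∈ D, ∀ x, w (σ x) = w x) (α : L) :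
    ∃ (c₀ : L) (n : ℕ), 1 ≤ n ∧ (∀ σ ∈ D, σ c₀ = c₀) ∧
      ∀ c, (∀ σ ∈ D, σ c = c) → w (n * (c₀ - c)) ≤ w (α - c) := by
  classical
  have hfin : {r | ∃ σ ∈ D, σ α = r}.Finite := by
    refine (rootSet_finite (minpoly E α) L).subset ?_
    rintro _ ⟨σ, -, rfl⟩
    rw [mem_rootSet]
    refine ⟨minpoly.ne_zero (Algebra.IsIntegral.isIntegral α), ?_⟩
    rw [aeval_algHom_apply σ α, minpoly.aeval, map_zero]
  let S := hfin.toFinset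
  have hS : ∀ r, r ∈ S ↔ ∃ σ ∈ D, σ α = r := fun r => by simp [S]
  have hS0 : S.card ≠ 0 := by
    rw [Finset.card_ne_zero]
    exact ⟨α, (hS α).2 ⟨1, one_mem D, rfl⟩⟩
  have hn : (S.card : L) ≠ 0 := by exact_mod_cast hS0
  refine ⟨(S.card : L)⁻¹ * ∑ r ∈ S, r, S.card, Nat.one_le_iff_ne_zero.2 hS0, ?_, ?_⟩
  · intro σ hσ
    rw [map_mul, map_inv₀, map_natCast, map_sum]
    congr 1
    refine Finset.sum_nbij σ ?_ σ.injective.injOn ?_ fun _ _ => rfl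
    · intro r hr
      obtain ⟨τ, hτ, rfl⟩ := (hS r).1 hr
      exact (hS _).2 ⟨σ * τ, mul_mem hσ hτ, rfl⟩
    · intro r hr
      obtain ⟨τ, hτ, rfl⟩ := (hS r).1 hr
      refine ⟨σ⁻¹ (τ α), (hS _).2 ⟨σ⁻¹ * τ, mul_mem (inv_mem hσ) hτ, rfl⟩, ?_⟩
      rw [← AlgEquiv.mul_apply, mul_inv_cancel, AlgEquiv.one_apply]
  · intro c hc
    have h1 : (S.card : L) * ((S.card : L)⁻¹ * ∑ r ∈ S, r - c) = ∑ r ∈ S, (r - c) := by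
      rw [mul_sub, mul_inv_cancel_left₀ hn, Finset.sum_sub_distrib, Finset.sum_const, nsmul_eq_mul]
    rw [h1]
    refine Valuation.map_sum_le w fun r hr => ?_
    obtain ⟨τ, hτ, rfl⟩ := (hS r).1 hr
    conv_lhs => rw [← hc τ hτ, ← map_sub, hD τ hτ]

theorem mem_integer_of_algebraMap_isIntegral (h : LiesOverVal v w) {x : E}
    (hx : IsIntegral v.integer (algebraMap E L x)) : v x ≤ 1 :=
  (h x).1 (isIntegral_val_le_one h hx)

/-- Galois conjugacy of the extensions of a valuation to a Galois extension. -/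
theorem exists_algEquiv_of_liesOverVal [IsGalois E L] (h : LiesOverVal v w)
    (h' : LiesOverVal v w') : ∃ σ : L ≃ₐ[E] L, ∀ x, w' x ≤ 1 ↔ w (σ x) ≤ 1 := by
  classical
  let A := v.integer
  let B := integralClosure A L
  let act : MulSemiringAction (L ≃ₐ[E] L) B :=
    { smul := fun σ b => ⟨σ b, isIntegral_algHom_apply (σ : L →ₐ[E] L) b.2⟩
      one_smul := fun b => rfl
      mul_smul := fun σ τ b => rfl
      smul_zero := fun σ => Subtype.ext (map_zero σ)
      smul_add := fun σ x y => Subtype.ext (map_add σ _ _)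
      smul_one := fun σ => Subtype.ext (map_one σ)
      smul_mul := fun σ x y => Subtype.ext (map_mul σ _ _) }
  have hact : ∀ (σ : L ≃ₐ[E] L) (b : B), ((σ • b : B) : L) = σ b := fun _ _ => rfl
  have : SMulCommClass (L ≃ₐ[E] L) A B := ⟨fun σ a b => Subtype.ext (by
    change σ ((a : E) • (b : L)) = (a : E) • σ b
    rw [map_smul])⟩
  let _ : TopologicalSpace B := ⊥
  have : DiscreteTopology B := ⟨rfl⟩
  have : ContinuousSMul (L ≃ₐ[E] L) B := by
    rw [continuousSMul_iff_stabilizer_isOpen]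
    intro b
    have h1 := stabilizer_isOpen_of_isIntegral (K := E) (b : L)
    have h2 : MulAction.stabilizer (L ≃ₐ[E] L) b = MulAction.stabilizer (L ≃ₐ[E] L) (b : L) := by
      ext σ
      rw [MulAction.mem_stabilizer_iff, MulAction.mem_stabilizer_iff, Subtype.ext_iff]
      rfl
    rwa [h2]
  have : Algebra.IsInvariant A B (L ≃ₐ[E] L) := ⟨fun b hb => by
    have h1 : (b : L) ∈ (⊥ : IntermediateField E L) := by
      rw [InfiniteGalois.mem_bot_iff_fixed]
      exact fun σ => congrArg Subtype.val (hb σ)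
    obtain ⟨a, ha⟩ := IntermediateField.mem_bot.1 h1
    exact ⟨⟨a, mem_integer_of_algebraMap_isIntegral h (ha ▸ b.2)⟩, Subtype.ext ha⟩⟩
  have hle : ∀ b : B, w b ≤ 1 := fun b => isIntegral_val_le_one h b.2
  have hle' : ∀ b : B, w' b ≤ 1 := fun b => isIntegral_val_le_one h' b.2
  let Q : Ideal B :=
    { carrier := {b | w b < 1}
      zero_mem' := by simp
      add_mem' := fun ha hb => Valuation.map_add_lt w ha hb
      smul_mem' := fun c x hx => val_mul_lt_one (hle c) hx }
  let Q' : Ideal B :=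
    { carrier := {b | w' b < 1}
      zero_mem' := by simp
      add_mem' := fun ha hb => Valuation.map_add_lt w' ha hb
      smul_mem' := fun c x hx => val_mul_lt_one (hle' c) hx }
  have hQ : ∀ b, b ∈ Q ↔ w b < 1 := fun _ => Iff.rfl
  have hQ' : ∀ b, b ∈ Q' ↔ w' b < 1 := fun _ => Iff.rfl
  have : Q.IsPrime := by
    refine ⟨fun h1 => ?_, fun {x y} hxy => ?_⟩
    · have := (Ideal.eq_top_iff_one _).1 h1
      rw [hQ, OneMemClass.coe_one, map_one] at this
      exact lt_irrefl _ this
    · rw [hQ, hQ]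
      by_contra! hc
      rw [hQ, MulMemClass.coe_mul, map_mul] at hxy
      exact absurd hxy (not_lt.2 (one_le_mul hc.1 hc.2))
  have : Q'.IsPrime := by
    refine ⟨fun h1 => ?_, fun {x y} hxy => ?_⟩
    · have := (Ideal.eq_top_iff_one _).1 h1
      rw [hQ', OneMemClass.coe_one, map_one] at this
      exact lt_irrefl _ this
    · rw [hQ', hQ']
      by_contra! hc
      rw [hQ', MulMemClass.coe_mul, map_mul] at hxy
      exact absurd hxy (not_lt.2 (one_le_mul hc.1 hc.2))
  obtain ⟨σ, hσ⟩ := Algebra.IsInvariant.exists_smul_of_under_eq_of_profinite (A := A)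
    (G := L ≃ₐ[E] L) Q Q' (by
      ext x
      rw [Ideal.mem_comap, Ideal.mem_comap]
      exact h.lt_one_iff.trans h'.lt_one_iff.symm)
  have hlt : ∀ b : B, w' b < 1 ↔ w (σ⁻¹ (b : L)) < 1 := fun b => by
    rw [← hQ', hσ, Ideal.mem_pointwise_smul_iff_inv_smul_mem]
    rfl
  have heq : ∀ b : B, w' b = 1 ↔ w (σ⁻¹ (b : L)) = 1 := fun b => by
    rw [le_antisymm_iff, le_antisymm_iff, ← not_lt (b := (1 : Δ)), ← not_lt (b := (1 : Δ')), hlt]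
    simp only [hle' b, true_and]
    exact ⟨fun h1 => ⟨hle (σ⁻¹ • b), h1⟩, fun h1 => h1.2⟩
  refine ⟨σ⁻¹, fun x => ⟨fun hx => ?_, fun hx => ?_⟩⟩
  · obtain ⟨b, c, hb, hc, hb1, hbc⟩ := exists_integral_fraction h' hx
    have h1 := (heq ⟨b, hb⟩).1 hb1
    have h2 := hle (σ⁻¹ • (⟨c, hc⟩ : B))
    rw [hact] at h2
    simp only [← hbc, map_mul] at h2 h1
    rwa [h1, mul_one] at h2
  · obtain ⟨b, c, hb, hc, hb1, hbc⟩ := exists_integral_fraction h hx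
    have h1 := (heq (σ • ⟨b, hb⟩)).2 (by
      rw [hact, ← AlgEquiv.mul_apply, inv_mul_cancel]; exact hb1)
    have h2 := hle' (σ • ⟨c, hc⟩)
    rw [hact] at h1 h2
    have h3 : σ c = x * σ b := by
      rw [← hbc, map_mul, ← AlgEquiv.mul_apply, mul_inv_cancel, AlgEquiv.one_apply]
    simp only [h3, map_mul] at h2 h1
    rwa [h1, mul_one] at h2

end Galois
end PadicPV

namespace PadicPV

open Polynomial

section Witness

variable {F : Type} [Field F]

theorem mem_span_natCast_iff (O : ValuationSubring F) (p : ℕ) (x : O) :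
    x ∈ (Ideal.span {(p : O)} : Ideal O) ↔ O.valuation x ≤ O.valuation (p : F) := by
  rw [Ideal.mem_span_singleton]
  constructor
  · rintro ⟨y, rfl⟩
    have h1 : O.valuation (y : F) ≤ 1 := O.valuation_le_one y
    push_cast
    rw [map_mul]
    exact mul_le_of_le_one_right' h1
  · intro h
    by_cases hp : (p : F) = 0
    · rw [hp, map_zero] at h
      have hx : (x : F) = 0 := by
        by_contra hne
        exact absurd h (not_le.2 (zero_lt_iff.2 ((Valuation.ne_zero_iff _).2 hne)))
      exact ⟨0, by ext; simp [hx]⟩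
    · have h1 : (x : F) / p ∈ O := by
        rw [← O.valuation_le_one_iff, map_div₀]
        exact div_le_one_of_le₀ h zero_le
      exact ⟨⟨_, h1⟩, by ext; push_cast; field_simp⟩

theorem isPadicVal_of_pAdicWitness {p : ℕ} {O : ValuationSubring F} (h : PAdicWitness p O) :
    IsPadicVal p O.valuation := by
  obtain ⟨hmax, ⟨e⟩⟩ := h
  refine ⟨?_, fun x hx => ?_⟩
  · have h1 : (p : O) ∈ IsLocalRing.maximalIdeal O := by
      rw [← IsLocalRing.eq_maximalIdeal hmax]
      exact Ideal.mem_span_singleton_self _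
    have := (O.valuation_lt_one_iff (p : O)).1 h1
    simpa using this
  · rw [O.valuation_le_one_iff] at hx
    obtain ⟨n, hn⟩ := ZMod.intCast_surjective (e (Ideal.Quotient.mk _ ⟨x, hx⟩))
    refine ⟨n, ?_⟩
    have h1 : Ideal.Quotient.mk (Ideal.span {(p : O)}) ⟨x, hx⟩
        = Ideal.Quotient.mk (Ideal.span {(p : O)}) (n : O) := by
      apply e.injective
      rw [← hn, map_intCast, map_intCast]
    rw [Ideal.Quotient.eq, mem_span_natCast_iff] at h1
    simpa using h1

theorem IsPadicVal.pAdicWitness {p : ℕ} (hp : p.Prime) {O : ValuationSubring F}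
    (hv : IsPadicVal p O.valuation) : PAdicWitness p O := by
  have hmem : ∀ x : O, x ∈ (Ideal.span {(p : O)} : Ideal O) ↔ O.valuation (x : F) < 1 := by
    intro x
    rw [mem_span_natCast_iff]
    exact ⟨fun h => h.trans_lt hv.lt_one, fun h => hv.le_of_lt_one hp h⟩
  constructor
  · have : (Ideal.span {(p : O)} : Ideal O) = IsLocalRing.maximalIdeal O := by
      ext x
      rw [hmem, O.valuation_lt_one_iff]
    rw [this]
    infer_instance
  · let f : ℤ →+* (O ⧸ (Ideal.span {(p : O)} : Ideal O)) := Int.castRingHom _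
    have hf : Function.Surjective f := by
      intro x
      obtain ⟨x, rfl⟩ := Ideal.Quotient.mk_surjective x
      obtain ⟨n, hn⟩ := hv.residue x (O.valuation_le_one x)
      refine ⟨n, ?_⟩
      simp only [f, eq_intCast]
      rw [← map_intCast (Ideal.Quotient.mk (Ideal.span {(p : O)})), eq_comm, Ideal.Quotient.eq,
        mem_span_natCast_iff]
      simpa using hn
    have hker : RingHom.ker f = Ideal.span {(p : ℤ)} := by
      ext n
      rw [RingHom.mem_ker, Ideal.mem_span_singleton]
      simp only [f, eq_intCast]
      rw [← map_intCast (Ideal.Quotient.mk (Ideal.span {(p : O)})), Ideal.Quotient.eq_zero_iff_mem,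
        hmem]
      constructor
      · intro h
        by_contra hn
        have := hv.val_intCast_eq_one hp hn
        simp [this] at h
      · rintro ⟨m, rfl⟩
        push_cast
        rw [mul_comm]
        exact val_mul_lt_one (val_intCast_le_one _ m) hv.lt_one
    exact ⟨(RingHom.quotientKerEquivOfSurjective hf).symm.trans
      ((Ideal.quotEquivOfEq hker).trans (Int.quotientSpanNatEquivZMod p))⟩

/-- A p-adic valuation on a proper algebraic extension contradicts p-adic closedness. -/
theorem surjective_of_isPadicVal {p : ℕ} (hp : p.Prime)
    (hF : IsPAdicallyClosed p F) {E : Type} [Field E] [Algebra F E] [Algebra.IsAlgebraic F E]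
    {Γ : Type*} [LinearOrderedCommGroupWithZero Γ] {w : Valuation E Γ} (hw : IsPadicVal p w) :
    Function.Surjective (algebraMap F E) := by
  refine hF.2 E inferInstance ⟨w.valuationSubring, IsPadicVal.pAdicWitness hp ?_⟩
  have he := (Valuation.isEquiv_valuation_valuationSubring w)
  refine ⟨?_, fun x hx => ?_⟩
  · have := (he.lt_iff_lt (x := p) (y := 1)).1 (by rw [map_one]; exact hw.lt_one)
    rwa [map_one] at this
  · obtain ⟨n, hn⟩ := hw.residue x ((he.le_one_iff_le_one).2 hx)
    exact ⟨n, (he _ _).1 hn⟩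

end Witness
end PadicPV

namespace PadicPV

open Polynomial

section Etale

variable {E L : Type*} [Field E] [Field L] [Algebra E L]
  {Γ Δ : Type*} [LinearOrderedCommGroupWithZero Γ] [LinearOrderedCommGroupWithZero Δ]
  {v : Valuation E Γ} {w : Valuation L Δ}

/-- The map of valuation rings induced by an extension of valued fields. -/
def LiesOverVal.integerMap (h : LiesOverVal v w) : v.integer →+* w.integer :=
  ((algebraMap E L).comp v.integer.subtype).codRestrict _ fun x => (h x).2 x.2

theorem LiesOverVal.aeval_eq (h : LiesOverVal v w) (P : v.integer[X]) (x : w.integer) :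
    aeval (x : L) P = (((P.map h.integerMap).eval x : w.integer) : L) := by
  rw [eval_map, aeval_def]
  have : algebraMap v.integer L = (w.integer.subtype).comp h.integerMap := rfl
  rw [this]
  exact (hom_eval₂ P h.integerMap w.integer.subtype x).symm

theorem LiesOverVal.val_aeval_le_one (h : LiesOverVal v w) (P : v.integer[X]) {x : L}
    (hx : w x ≤ 1) : w (aeval x P) ≤ 1 := by
  have := h.aeval_eq P ⟨x, hx⟩
  rw [show aeval x P = _ from this]
  exact ((P.map h.integerMap).eval (⟨x, hx⟩ : w.integer)).2

theorem LiesOverVal.val_aeval_sub_le (h : LiesOverVal v w) (P : v.integer[X]) {x y : L}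
    (hx : w x ≤ 1) (hy : w y ≤ 1) : w (aeval x P - aeval y P) ≤ w (x - y) := by
  obtain ⟨c, hc⟩ := sub_dvd_eval_sub (⟨x, hx⟩ : w.integer) ⟨y, hy⟩ (P.map h.integerMap)
  have h1 := congrArg (Subtype.val) hc
  rw [AddSubgroupClass.coe_sub, ← h.aeval_eq, ← h.aeval_eq, MulMemClass.coe_mul,
    AddSubgroupClass.coe_sub] at h1
  simp only at h1
  rw [h1, map_mul]
  exact mul_le_of_le_one_right' c.2

theorem LiesOverVal.val_aeval_sub_eq (h : LiesOverVal v w) (P : v.integer[X]) {x y : L}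
    (hx : w x ≤ 1) (hxy : w (y - x) < 1) (hP : w (aeval x (derivative P)) = 1) :
    w (aeval y P - aeval x P) = w (y - x) := by
  by_cases h0 : y = x
  · simp [h0]
  obtain ⟨k, hk⟩ := binomExpansion (P.map h.integerMap) ⟨x, hx⟩ ⟨y - x, hxy.le⟩
  have h1 := congrArg (Subtype.val) hk
  rw [derivative_map] at h1
  push_cast at h1
  rw [← h.aeval_eq, ← h.aeval_eq, ← h.aeval_eq] at h1
  simp only [AddMemClass.coe_add, add_sub_cancel] at h1
  have h2 : aeval y P - aeval x P = aeval x (derivative P) * (y - x) + k * (y - x) ^ 2 := by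
    rw [h1]; ring
  have h3 : w (y - x) ≠ 0 := (Valuation.ne_zero_iff w).2 (sub_ne_zero.2 h0)
  have h4 : w (aeval x (derivative P) * (y - x)) = w (y - x) := by rw [map_mul, hP, one_mul]
  rw [h2, Valuation.map_add_eq_of_lt_left, h4]
  rw [h4, map_mul, map_pow]
  refine (mul_le_of_le_one_left' k.2).trans_lt ?_
  rw [pow_two]
  exact mul_lt_of_lt_one_left (zero_lt_iff.2 h3) hxy

theorem IsPadicVal.of_liesOver_etale [CharZero E] [FiniteDimensional E L] {p : ℕ} (hp : p.Prime)
    (hv : IsPadicVal p v) (h : LiesOverVal v w) {y : L} (hadj : Algebra.adjoin E {y} = ⊤)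
    (hyi : IsIntegral v.integer y) {a : E} (ha : v a ≤ 1) (hya : w (y - algebraMap E L a) < 1)
    (hd : w (aeval y (derivative (minpoly E y))) = 1) : IsPadicVal p w := by
  have hwp : w (p : L) = w (algebraMap E L (p : E)) := by rw [map_natCast (algebraMap E L)]
  have hp1 : w p < 1 := by rw [hwp, h.lt_one_iff]; exact hv.lt_one
  have hfrac := minpoly.isIntegrallyClosed_eq_field_fractions' E hyi
  have hy1 : w y ≤ 1 := isIntegral_val_le_one h hyi
  have ha1 : w (algebraMap E L a) ≤ 1 := (h a).2 ha
  have hEp : ∀ x : E, w (algebraMap E L x) < 1 → w (algebraMap E L x) ≤ w p := fun x hx => by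
    rw [hwp, h.le_iff]
    exact hv.le_of_lt_one hp (h.lt_one_iff.1 hx)
  have hd' : aeval y (derivative (minpoly v.integer y)) = aeval y (derivative (minpoly E y)) := by
    rw [hfrac, derivative_map, aeval_map_algebraMap]
  have haP : ∀ P : v.integer[X], aeval (algebraMap E L a) P
      = algebraMap E L (aeval a P) := fun P => by
    rw [aeval_algebraMap_apply]
  have hya' : w (y - algebraMap E L a) ≤ w p := by
    have h1 := h.val_aeval_sub_eq (minpoly v.integer y) hy1
      (y := algebraMap E L a) (by rwa [Valuation.map_sub_swap]) (by rw [hd', hd])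
    rw [minpoly.aeval, sub_zero] at h1
    rw [Valuation.map_sub_swap, ← h1, haP]
    refine hEp _ ?_
    rw [← haP, h1, Valuation.map_sub_swap]
    exact hya
  have hres : ∀ z : L, IsIntegral v.integer z →
      ∃ n : ℤ, w (aeval y (derivative (minpoly E y)) * z - n) ≤ w p := by
    intro z hz
    have h1 := traceForm_dualSubmodule_adjoin v.integer E hadj hyi
    have h2 : z ∈ (Algebra.traceForm E L).dualSubmodule
        (Subalgebra.toSubmodule (Algebra.adjoin v.integer {y})) := by
      rw [LinearMap.BilinForm.mem_dualSubmodule]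
      intro u hu
      have hui : IsIntegral v.integer u :=
        Algebra.adjoin_le (S := integralClosure v.integer L) (Set.singleton_subset_iff.2 hyi) hu
      have h3 : IsIntegral v.integer (Algebra.trace E L (z * u)) :=
        Algebra.isIntegral_trace (hz.mul hui)
      obtain ⟨r, hr⟩ := (IsIntegrallyClosed.isIntegral_iff).1 h3
      rw [Submodule.mem_one]
      exact ⟨r, hr⟩
    rw [h1] at h2
    obtain ⟨s, hs, hsz⟩ := h2
    have hd0 : aeval y (derivative (minpoly E y)) ≠ 0 := by
      intro h0; rw [h0, map_zero] at hd; exact zero_ne_one hd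
    have hs' : s = aeval y (derivative (minpoly E y)) * z := by
      rw [← hsz]
      change s = _ * (_ * s)
      rw [mul_inv_cancel_left₀ hd0]
    have hs2 : s ∈ Algebra.adjoin v.integer {y} := hs
    rw [Algebra.adjoin_singleton_eq_range_aeval] at hs2
    obtain ⟨P, hP⟩ := hs2
    rw [← hs', ← hP]
    have hPa : v (aeval a P) ≤ 1 := by
      rw [← h, ← haP]
      exact h.val_aeval_le_one P ha1
    obtain ⟨n, hn⟩ := hv.residue _ hPa
    refine ⟨n, ?_⟩
    have : aeval y P - (n : L) = (aeval y P - aeval (algebraMap E L a) P)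
        + algebraMap E L (aeval a P - n) := by
      rw [haP, map_sub, map_intCast]; ring
    change w (aeval y P - (n : L)) ≤ _
    rw [this]
    refine (Valuation.map_add_le w ((h.val_aeval_sub_le P hy1 ha1).trans hya') ?_)
    rw [hwp, h.le_iff]
    exact hn
  refine ⟨hp1, fun z hz => ?_⟩
  obtain ⟨b, c, hb, hc, hb1, hbc⟩ := exists_integral_fraction h hz
  set δ := aeval y (derivative (minpoly E y))
  obtain ⟨nb, hnb⟩ := hres b hb
  obtain ⟨nc, hnc⟩ := hres c hc
  have hδb : w (δ * b) = 1 := by rw [map_mul, hd, hb1, one_mul]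
  have hnb1 : ¬ (p : ℤ) ∣ nb := by
    rintro ⟨m, rfl⟩
    have h1 : w ((p : L) * m) < 1 := by
      rw [mul_comm]
      exact val_mul_lt_one (val_intCast_le_one w m) hp1
    have h2 := Valuation.map_add_lt w (hnb.trans_lt hp1) h1
    rw [Int.cast_mul, Int.cast_natCast, sub_add_cancel, hδb] at h2
    exact lt_irrefl _ h2
  obtain ⟨r, s, hrs⟩ := (Nat.prime_iff_prime_int.1 hp).coprime_iff_not_dvd.2 hnb1
  refine ⟨s * nc, ?_⟩
  have h3 : (z - ((s * nc : ℤ) : L)) * (δ * b)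
      = (δ * c - nc) - ((s * nc : ℤ) : L) * (δ * b - nb) + ((r * nc : ℤ) : L) * p := by
    have h4 : (r : L) * p + s * nb = 1 := by exact_mod_cast congrArg (Int.cast (R := L)) hrs
    rw [← hbc]
    push_cast
    linear_combination (-(nc : L)) * h4
  have h5 : w (z - ((s * nc : ℤ) : L)) = w ((z - ((s * nc : ℤ) : L)) * (δ * b)) := by
    rw [map_mul, hδb, mul_one]
  rw [h5, h3]
  refine Valuation.map_add_le w (Valuation.map_sub_le (v := w) hnc ?_) ?_
  · rw [map_mul]
    exact (mul_le_of_le_one_left' (val_intCast_le_one w _)).trans hnb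
  · rw [map_mul]
    exact mul_le_of_le_one_left' (val_intCast_le_one w _)

end Etale
end PadicPV

namespace PadicPV

open Polynomial

section Closed

variable {F : Type} [Field F] [CharZero F] {p : ℕ} {Γ : Type*} [LinearOrderedCommGroupWithZero Γ]
  {v : Valuation F Γ}

open IntermediateField in
theorem mem_range_algebraMap_of_etale (hp : p.Prime) (hF : IsPAdicallyClosed p F)
    (hv : IsPadicVal p v) {Ω : Type} [Field Ω] [Algebra F Ω] {Δ : Type*}
    [LinearOrderedCommGroupWithZero Δ] {w : Valuation Ω Δ} (h : LiesOverVal v w)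
    {y : Ω} (hyi : IsIntegral v.integer y) {a : F} (ha : v a ≤ 1)
    (hya : w (y - algebraMap F Ω a) < 1) (hd : w (aeval y (derivative (minpoly F y))) = 1) :
    y ∈ Set.range (algebraMap F Ω) := by
  have hyF : IsIntegral F y := hyi.tower_top
  have : FiniteDimensional F F⟮y⟯ := adjoin.finiteDimensional hyF
  have h' : LiesOverVal v (w.comap (algebraMap F⟮y⟯ Ω)) := fun x => by
    rw [← h x]; rfl
  have hw := hv.of_liesOver_etale hp h' (y := AdjoinSimple.gen F y)
    (adjoin.powerBasis hyF).adjoin_gen_eq_top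
    (by
      refine (isIntegral_algebraMap_iff (algebraMap F⟮y⟯ Ω).injective).1 ?_
      rwa [AdjoinSimple.algebraMap_gen]) ha
    (by
      rw [Valuation.comap_apply, map_sub, AdjoinSimple.algebraMap_gen]
      exact hya)
    (by
      rw [Valuation.comap_apply, minpoly_gen, ← aeval_algebraMap_apply, AdjoinSimple.algebraMap_gen]
      exact hd)
  obtain ⟨x, hx⟩ := surjective_of_isPadicVal hp hF hw (AdjoinSimple.gen F y)
  exact ⟨x, by rw [← AdjoinSimple.algebraMap_gen F y, ← hx]; rfl⟩

theorem isHenselianVal_of_isPAdicallyClosed (hp : p.Prime) (hF : IsPAdicallyClosed p F)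
    (hv : IsPadicVal p v) : IsHenselianVal v := by
  intro f hf hcoeff a ha hfa hfda
  obtain ⟨Ω, _, _, _⟩ : ∃ (Ω : Type) (_ : Field Ω) (_ : Algebra F Ω), IsAlgClosed Ω :=
    ⟨AlgebraicClosure F, inferInstance, inferInstance, inferInstance⟩
  obtain ⟨V, h⟩ := exists_liesOverVal v Ω
  set w := V.valuation
  obtain ⟨f₀, hf₀⟩ : ∃ f₀ : v.integer[X], f₀.map (algebraMap v.integer F) = f := by
    rw [← mem_lifts, lifts_iff_coeff_lifts]
    exact fun i => ⟨⟨_, hcoeff i⟩, rfl⟩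
  have hf₀m : f₀.Monic := by
    refine monic_of_injective (f := algebraMap v.integer F) Subtype.val_injective ?_
    rwa [hf₀]
  let fL := f.map (algebraMap F Ω)
  have hfL : fL.Monic := hf.map _
  have hs : fL.Splits := IsAlgClosed.splits _
  have hev : ∀ g : F[X], algebraMap F Ω (g.eval a)
      = (g.map (algebraMap F Ω)).eval (algebraMap F Ω a) := fun g => by rw [eval_map_apply]
  obtain ⟨y, hy, hya⟩ : ∃ y ∈ fL.roots, w (algebraMap F Ω a - y) < 1 := by
    by_contra! hc
    rw [← h.lt_one_iff, hev, hs.eval_eq_prod_roots_of_monic hfL, map_multiset_prod,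
      Multiset.map_map] at hfa
    refine absurd hfa (not_lt.2 ?_)
    refine Multiset.one_le_prod fun z hz => ?_
    obtain ⟨r, hr, rfl⟩ := Multiset.mem_map.1 hz
    exact hc r hr
  have hy0 : aeval y f = 0 := by
    rw [← eval_map_algebraMap]; exact (mem_roots'.1 hy).2
  have hy0' : aeval y f₀ = 0 := by rw [← hy0, ← hf₀, aeval_map_algebraMap]
  have hyi : IsIntegral v.integer y := ⟨f₀, hf₀m, hy0'⟩
  have hy1 : w y ≤ 1 := isIntegral_val_le_one h hyi
  have ha1 : w (algebraMap F Ω a) ≤ 1 := (h a).2 ha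
  rw [Valuation.map_sub_swap] at hya
  obtain ⟨h₀, hh₀⟩ := minpoly.isIntegrallyClosed_dvd hyi hy0'
  have hfdy : w (aeval y (derivative f₀)) = 1 := by
    refine val_eq_one_of_sub_lt (x := aeval (algebraMap F Ω a) (derivative f₀)) ?_
      ((h.val_aeval_sub_le _ hy1 ha1).trans_lt hya)
    rw [aeval_algebraMap_apply, h.eq_one_iff, ← hfda, ← hf₀, derivative_map, eval_map_algebraMap]
  have hgd : w (aeval y (derivative (minpoly F y))) = 1 := by
    rw [minpoly.isIntegrallyClosed_eq_field_fractions' F hyi, derivative_map,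
      aeval_map_algebraMap]
    rw [hh₀, derivative_mul, map_add, map_mul, map_mul, minpoly.aeval, zero_mul, add_zero,
      map_mul] at hfdy
    refine le_antisymm (h.val_aeval_le_one _ hy1) ?_
    rw [← hfdy]
    exact mul_le_of_le_one_right' (h.val_aeval_le_one _ hy1)
  obtain ⟨b, rfl⟩ := mem_range_algebraMap_of_etale hp hF hv h hyi ha hya hgd
  refine ⟨b, ?_, ?_⟩
  · rw [aeval_algebraMap_apply, map_eq_zero] at hy0
    rwa [coe_aeval_eq_eval] at hy0
  · rw [← map_sub] at hya
    exact h.lt_one_iff.1 hya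

end Closed
end PadicPV

namespace PadicPV

open Polynomial

section Dominant

variable {F L : Type*} [Field F] [Field L] [Algebra F L] {Δ : Type*}
  [LinearOrderedCommGroupWithZero Δ] {w : Valuation L Δ}

theorem val_mul_pow_ne {α : L} {ℓ : ℕ}
    (hα : ∀ i, 0 < i → i < ℓ → ∀ c : F, w (algebraMap F L c * α ^ i) ≠ 1) (hα0 : α ≠ 0)
    {i j : ℕ} (hi : i < ℓ) (hj : j < ℓ) (hij : i ≠ j) {a b : F} (ha : a ≠ 0) :
    w (algebraMap F L a * α ^ i) ≠ w (algebraMap F L b * α ^ j) := by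
  have key : ∀ {i j : ℕ}, i < ℓ → j < i → ∀ {a b : F}, b ≠ 0 →
      w (algebraMap F L a * α ^ i) ≠ w (algebraMap F L b * α ^ j) := by
    intro i j hi hji a b hb heq
    have hb' : algebraMap F L b ≠ 0 := by simpa using hb
    obtain ⟨k, rfl⟩ := Nat.exists_eq_add_of_lt hji
    refine hα (k + 1) (by omega) (by omega) (a / b) ?_
    have : algebraMap F L (a / b) * α ^ (k + 1)
        = (algebraMap F L a * α ^ (j + k + 1)) / (algebraMap F L b * α ^ j) := by
      rw [map_div₀, add_assoc, pow_add]
      field_simp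
      ring
    rw [this, map_div₀, heq, div_self]
    exact (Valuation.ne_zero_iff w).2 (mul_ne_zero hb' (pow_ne_zero _ hα0))
  by_cases hb : b = 0
  · rw [hb, map_zero, zero_mul, map_zero]
    exact (Valuation.ne_zero_iff w).2 (mul_ne_zero (by simpa using ha) (pow_ne_zero _ hα0))
  rcases lt_or_gt_of_ne hij with h | h
  · exact (key hj h ha).symm
  · exact key hi h hb

theorem exists_dominant_term {α : L} {ℓ : ℕ}
    (hα : ∀ i, 0 < i → i < ℓ → ∀ c : F, w (algebraMap F L c * α ^ i) ≠ 1) (hα0 : α ≠ 0)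
    {P : F[X]} (hP : P ≠ 0) (hdeg : P.natDegree < ℓ) :
    ∃ j ∈ P.support, ∀ i ∈ P.support, i ≠ j →
      w (algebraMap F L (P.coeff i) * α ^ i) < w (algebraMap F L (P.coeff j) * α ^ j) := by
  obtain ⟨j, hj, hmax⟩ := Finset.exists_max_image P.support
    (fun i => w (algebraMap F L (P.coeff i) * α ^ i)) (by simpa using hP)
  refine ⟨j, hj, fun i hi hij => lt_of_le_of_ne (hmax i hi) ?_⟩
  exact val_mul_pow_ne hα hα0 ((le_natDegree_of_mem_supp _ hi).trans_lt hdeg)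
    ((le_natDegree_of_mem_supp _ hj).trans_lt hdeg) hij (mem_support_iff.1 hi)

theorem val_aeval_eq_of_dominant {α : L} {P : F[X]} {j : ℕ} (hj : j ∈ P.support)
    (hdom : ∀ i ∈ P.support, i ≠ j →
      w (algebraMap F L (P.coeff i) * α ^ i) < w (algebraMap F L (P.coeff j) * α ^ j)) :
    w (aeval α P) = w (algebraMap F L (P.coeff j) * α ^ j) := by
  classical
  rw [aeval_def, eval₂_eq_sum, sum_def]
  refine Valuation.map_sum_eq_of_lt (f := fun i => algebraMap F L (P.coeff i) * α ^ i) w hj ?_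
  intro i hi
  rw [Finset.mem_sdiff, Finset.mem_singleton] at hi
  exact hdom i hi.1 hi.2

theorem exists_aeval_eq_of_adjoin_eq_top {α : L} (hadj : Algebra.adjoin F {α} = ⊤) {ℓ : ℕ}
    (hℓ : 1 ≤ ℓ) {x : F} (hx : α ^ ℓ = algebraMap F L x) (z : L) :
    ∃ P : F[X], P.natDegree < ℓ ∧ aeval α P = z := by
  have hz : z ∈ Algebra.adjoin F {α} := hadj ▸ Algebra.mem_top
  rw [Algebra.adjoin_singleton_eq_range_aeval] at hz
  obtain ⟨P, rfl⟩ := hz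
  have hm : (X ^ ℓ - C x : F[X]).Monic := monic_X_pow_sub_C x (by omega)
  refine ⟨P %ₘ (X ^ ℓ - C x), ?_, ?_⟩
  · have := natDegree_modByMonic_lt P hm (by
      intro h
      have := congrArg natDegree h
      rw [natDegree_X_pow_sub_C, natDegree_one] at this
      omega)
    rwa [natDegree_X_pow_sub_C] at this
  · exact aeval_modByMonic_eq_self_of_root
      (by rw [map_sub, map_pow, aeval_X, aeval_C, hx, sub_self])

end Dominant

section Closed

variable {F : Type} [Field F] [CharZero F] {p : ℕ} {Γ : Type*} [LinearOrderedCommGroupWithZero Γ]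
  {v : Valuation F Γ}

theorem IsPadicVal.of_liesOver_pow {L : Type*} [Field L] [Algebra F L] {Δ : Type*}
    [LinearOrderedCommGroupWithZero Δ] {w : Valuation L Δ} (hp : p.Prime) (hv : IsPadicVal p v)
    (h : LiesOverVal v w) {ℓ : ℕ} (hℓ : ℓ.Prime) {x : F} (hx0 : x ≠ 0) {α : L}
    (hα : α ^ ℓ = algebraMap F L x) (hadj : Algebra.adjoin F {α} = ⊤)
    (hx : ∀ (s : ℤ) (b : F), v x ≠ v p ^ s * v b ^ ℓ) : IsPadicVal p w := by
  have hwp : w (p : L) = w (algebraMap F L (p : F)) := by rw [map_natCast (algebraMap F L)]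
  have hp1 : w p < 1 := by rw [hwp, h.lt_one_iff]; exact hv.lt_one
  have hp0 : v p ≠ 0 := val_p_ne_zero hp
  have hvx : v x ≠ 0 := (Valuation.ne_zero_iff v).2 hx0
  have hα0 : α ≠ 0 := by
    rintro rfl
    rw [zero_pow hℓ.ne_zero, eq_comm, map_eq_zero] at hα
    exact hx0 hα
  have hne : ∀ i, 0 < i → i < ℓ → ∀ (c : F) (s : ℤ), v (c ^ ℓ * x ^ i) ≠ v p ^ s := by
    intro i hi hiℓ c s hc
    have hcop : IsCoprime (i : ℤ) (ℓ : ℤ) := by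
      rw [Nat.isCoprime_iff_coprime]
      exact (Nat.coprime_of_lt_prime hi.ne' hiℓ hℓ).symm
    obtain ⟨a, b, hab⟩ := hcop
    have hc0 : v c ≠ 0 := by
      intro h0
      rw [map_mul, map_pow, h0, zero_pow hℓ.ne_zero, zero_mul] at hc
      exact zpow_ne_zero _ hp0 hc.symm
    refine hx (s * a) (c ^ (-a) * x ^ b) ?_
    rw [zpow_mul, ← hc, map_mul, map_pow, map_pow, map_mul, map_zpow₀, map_zpow₀]
    rw [← zpow_natCast, ← zpow_natCast, ← zpow_natCast, mul_zpow, mul_zpow, ← zpow_mul, ← zpow_mul,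
      ← zpow_mul, ← zpow_mul, mul_mul_mul_comm, ← zpow_add₀ hc0, ← zpow_add₀ hvx,
      show (ℓ : ℤ) * a + -a * ℓ = 0 by ring, show (i : ℤ) * a + b * ℓ = 1 by linarith]
    simp
  have hcα : ∀ (c : F) (i : ℕ), (algebraMap F L c * α ^ i) ^ ℓ = algebraMap F L (c ^ ℓ * x ^ i) := by
    intro c i
    rw [mul_pow, ← pow_mul, mul_comm i, pow_mul, hα, map_mul, map_pow, map_pow]
  have hne1 : ∀ i, 0 < i → i < ℓ → ∀ c : F, w (algebraMap F L c * α ^ i) ≠ 1 := by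
    intro i hi hiℓ c hc
    have h1 : w ((algebraMap F L c * α ^ i) ^ ℓ) = 1 := by rw [map_pow, hc, one_pow]
    rw [hcα, h.eq_one_iff] at h1
    exact hne i hi hiℓ c 0 (by rw [h1, zpow_zero])
  have hlep : ∀ i, 0 < i → i < ℓ → ∀ c : F, w (algebraMap F L c * α ^ i) ≤ 1 →
      w (algebraMap F L c * α ^ i) ≤ w p := by
    intro i hi hiℓ c hc
    by_contra! hlt
    have h1 : w ((algebraMap F L c * α ^ i) ^ ℓ) ≤ 1 := by
      rw [map_pow]; exact pow_le_one₀ zero_le hc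
    have h2 : w (p : L) ^ ℓ ≤ w ((algebraMap F L c * α ^ i) ^ ℓ) := by
      rw [map_pow]; exact pow_le_pow_left₀ zero_le hlt.le _
    rw [hcα, hwp, ← map_pow, ← map_pow, h.le_iff, map_pow] at h2
    rw [hcα, h] at h1
    obtain ⟨s, hs⟩ := hv.val_eq_pow hp ℓ h1 h2
    exact hne i hi hiℓ c s (by rw [hs, zpow_natCast])
  refine ⟨hp1, fun z hz => ?_⟩
  obtain ⟨P, hdeg, rfl⟩ := exists_aeval_eq_of_adjoin_eq_top hadj hℓ.one_lt.le hα z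
  by_cases hP : P = 0
  · exact ⟨0, by simp [hP]⟩
  obtain ⟨j, hj, hdom⟩ := exists_dominant_term hne1 hα0 hP hdeg
  rw [val_aeval_eq_of_dominant hj hdom] at hz
  have hle : ∀ i, w (algebraMap F L (P.coeff i) * α ^ i) ≤ 1 := by
    intro i
    by_cases hi : i ∈ P.support
    · by_cases hij : i = j
      · rwa [hij]
      · exact (hdom i hi hij).le.trans hz
    · rw [notMem_support_iff.1 hi]; simp
  have h0 := hle 0
  rw [pow_zero, mul_one, h] at h0
  obtain ⟨n, hn⟩ := hv.residue _ h0
  refine ⟨n, ?_⟩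
  have hsum : aeval α P - (n : L) = (∑ i ∈ Finset.range P.natDegree,
      algebraMap F L (P.coeff (i + 1)) * α ^ (i + 1)) + algebraMap F L (P.coeff 0 - n) := by
    rw [aeval_eq_sum_range, Finset.sum_range_succ']
    simp only [Algebra.smul_def, pow_zero, mul_one, map_sub, map_intCast]
    ring
  rw [hsum]
  refine Valuation.map_add_le w (Valuation.map_sum_le w fun i hi => ?_) ?_
  · rw [Finset.mem_range] at hi
    exact hlep (i + 1) (by omega) (by omega) _ (hle _)
  · rw [hwp, h.le_iff]
    exact hn

open IntermediateField in
theorem ratPow_of_isPAdicallyClosed (hp : p.Prime) (hF : IsPAdicallyClosed p F)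
    (hv : IsPadicVal p v) : RatPow F := by
  have hH := isHenselianVal_of_isPAdicallyClosed hp hF hv
  have hp0 : v (p : F) ≠ 0 := val_p_ne_zero hp
  have hp0' : (p : F) ≠ 0 := by exact_mod_cast hp.ne_zero
  intro N
  induction N using Nat.recOnMul with
  | zero => intro h; omega
  | one => exact fun _ x _ => ⟨1, x, by simp⟩
  | prime ℓ hℓ =>
    intro _ x hx0
    have hvx : v x ≠ 0 := (Valuation.ne_zero_iff v).2 hx0
    by_cases hx : ∃ (s : ℤ) (b : F), v x = v p ^ s * v b ^ ℓ
    · obtain ⟨s, b, hsb⟩ := hx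
      have hb0 : b ≠ 0 := by
        rintro rfl
        rw [map_zero, zero_pow hℓ.ne_zero, mul_zero] at hsb
        exact hvx hsb
      obtain ⟨n, z, hn, hz⟩ := hv.exists_int_mul_pow hp hH hℓ.one_lt.le
        (u := x / ((p : F) ^ s * b ^ ℓ)) (by
          rw [map_div₀, map_mul, map_zpow₀, map_pow, ← hsb, div_self hvx])
      refine ⟨(p : ℚ) ^ s * n, b * z, ?_⟩
      rw [div_eq_iff (mul_ne_zero (zpow_ne_zero _ hp0') (pow_ne_zero _ hb0))] at hz
      rw [hz]
      push_cast
      ring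
    · push Not at hx
      exfalso
      obtain ⟨Ω, _, _, _⟩ : ∃ (Ω : Type) (_ : Field Ω) (_ : Algebra F Ω), IsAlgClosed Ω :=
        ⟨AlgebraicClosure F, inferInstance, inferInstance, inferInstance⟩
      obtain ⟨V, h⟩ := exists_liesOverVal v Ω
      set w := V.valuation
      obtain ⟨α, hα⟩ := IsAlgClosed.exists_pow_nat_eq (algebraMap F Ω x) hℓ.pos
      have hαi : IsIntegral F α :=
        IsIntegral.of_pow hℓ.pos (by rw [hα]; exact isIntegral_algebraMap)
      have : FiniteDimensional F F⟮α⟯ := adjoin.finiteDimensional hαi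
      have h' : LiesOverVal v (w.comap (algebraMap F⟮α⟯ Ω)) := fun x => by
        rw [← h x]; rfl
      have hw := hv.of_liesOver_pow hp h' hℓ hx0 (α := AdjoinSimple.gen F α)
        (by
          apply (algebraMap F⟮α⟯ Ω).injective
          rw [map_pow, AdjoinSimple.algebraMap_gen, hα]
          rfl)
        (adjoin.powerBasis hαi).adjoin_gen_eq_top hx
      obtain ⟨a, ha⟩ := surjective_of_isPadicVal hp hF hw (AdjoinSimple.gen F α)
      refine hx 0 a ?_
      have h1 : algebraMap F Ω a = α := by
        rw [← AdjoinSimple.algebraMap_gen F α, ← ha]; rfl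
      rw [← h1, ← map_pow] at hα
      rw [zpow_zero, one_mul, ← map_pow, (algebraMap F Ω).injective hα]
  | mul a b iha ihb =>
    intro hab x hx0
    have ha : 1 ≤ a := Nat.one_le_iff_ne_zero.2 fun h => by simp [h] at hab
    have hb : 1 ≤ b := Nat.one_le_iff_ne_zero.2 fun h => by simp [h] at hab
    obtain ⟨q, z, hz⟩ := iha ha x hx0
    have hz0 : z ≠ 0 := by
      rintro rfl
      rw [zero_pow (by omega), mul_zero] at hz
      exact hx0 hz
    obtain ⟨q', z', hz'⟩ := ihb hb z hz0
    refine ⟨q * q' ^ a, z', ?_⟩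
    rw [hz, hz']
    push_cast
    ring

end Closed
end PadicPV

namespace PadicPV

open Polynomial

section Radical

/-- Elements of `E` have the same `N`-th power status in both extensions. -/
def PowCompat (E M₁ M₂ : Type*) [Field E] [Field M₁] [Field M₂] [Algebra E M₁] [Algebra E M₂] :
    Prop :=
  ∀ N : ℕ, 1 ≤ N → ∀ a : E,
    (∃ z : M₁, z ^ N = algebraMap E M₁ a) ↔ ∃ z : M₂, z ^ N = algebraMap E M₂ a

variable {E M₁ M₂ : Type*} [Field E] [Field M₁] [Field M₂] [Algebra E M₁] [Algebra E M₂]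
  [CharZero M₁] [CharZero M₂]
  {Γ₁ Γ₂ : Type*} [LinearOrderedCommGroupWithZero Γ₁] [LinearOrderedCommGroupWithZero Γ₂]
  {v₁ : Valuation M₁ Γ₁} {v₂ : Valuation M₂ Γ₂} {p : ℕ}

theorem PowCompat.liesOverVal (hc : PowCompat E M₁ M₂) (hp : p.Prime)
    (hv₁ : IsPadicVal p v₁) (hH₁ : IsHenselianVal v₁) (hv₂ : IsPadicVal p v₂)
    (hH₂ : IsHenselianVal v₂) : LiesOverVal (v₁.comap (algebraMap E M₁)) v₂ := by
  intro x
  rw [Valuation.comap_apply, hv₁.le_one_iff_exists_pow hp hH₁, hv₂.le_one_iff_exists_pow hp hH₂]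
  have := hc (p + 1) (by omega) (1 + p * x ^ (p + 1))
  simp only [map_add, map_one, map_mul, map_natCast, map_pow] at this
  exact this.symm

/-- An `ℓ`-th root of `c` in the second field with the same power classes as `y`. -/
theorem PowCompat.exists_root (hc : PowCompat E M₁ M₂) (hR : RatPow M₁) {ℓ : ℕ} (hℓ : 1 ≤ ℓ)
    {y : M₁} {c : E} (hy : y ^ ℓ = algebraMap E M₁ c) (hy0 : y ≠ 0) :
    ∃ y' : M₂, y' ^ ℓ = algebraMap E M₂ c ∧ ∀ N : ℕ, 1 ≤ N →
      ∃ (m : ℚ) (z : M₁) (z' : M₂), m ≠ 0 ∧ y = m * z ^ N ∧ y' = m * z' ^ N := by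
  classical
  have : CharZero E := (algebraMap E M₁).charZero
  have h1 : ∀ N : ℕ, 1 ≤ N → ∃ y' : M₂, y' ^ ℓ = algebraMap E M₂ c ∧
      ∃ (m : ℚ) (z : M₁) (z' : M₂), m ≠ 0 ∧ y = m * z ^ N ∧ y' = m * z' ^ N := by
    intro N hN
    obtain ⟨m, z, hz⟩ := hR N hN y hy0
    have hm : m ≠ 0 := by rintro rfl; simp at hz; exact hy0 hz
    obtain ⟨t, ht⟩ := (hc (N * ℓ) (Nat.mul_pos hN hℓ) (c / (m : E) ^ ℓ)).1 ⟨z, by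
      rw [map_div₀, map_pow, map_ratCast, ← hy, hz, mul_pow, ← pow_mul,
        mul_div_cancel_left₀ _ (pow_ne_zero _ (by exact_mod_cast hm))]⟩
    refine ⟨m * t ^ N, ?_, m, z, t, hm, hz, rfl⟩
    rw [mul_pow, ← pow_mul, ht, map_div₀, map_pow, map_ratCast,
      mul_div_cancel₀ _ (pow_ne_zero _ (by exact_mod_cast hm))]
  have hfin : {y' : M₂ | y' ^ ℓ = algebraMap E M₂ c}.Finite := by
    refine ((X ^ ℓ - C (algebraMap E M₂ c)).rootSet_finite M₂).subset ?_
    intro x hx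
    rw [mem_rootSet]
    refine ⟨X_pow_sub_C_ne_zero hℓ _, ?_⟩
    have hx' : x ^ ℓ = algebraMap E M₂ c := hx
    simp [hx']
  by_contra! hcon
  have hcon' : ∀ y' : M₂, ∃ N : ℕ, 1 ≤ N ∧ (y' ^ ℓ = algebraMap E M₂ c →
      ∀ (m : ℚ) (z : M₁) (z' : M₂), m ≠ 0 → y = m * z ^ N → y' ≠ m * z' ^ N) := by
    intro y'
    by_cases hy' : y' ^ ℓ = algebraMap E M₂ c
    · obtain ⟨N, hN, h⟩ := hcon y' hy'
      exact ⟨N, hN, fun _ => h⟩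
    · exact ⟨1, le_rfl, fun h => absurd h hy'⟩
  choose N hN hNy using hcon'
  obtain ⟨y', hy', m, z, z', hm, hz, hz'⟩ := h1 (∏ r ∈ hfin.toFinset, N r)
    (Nat.succ_le_of_lt (Finset.prod_pos fun r _ => hN r))
  obtain ⟨k, hk⟩ : N y' ∣ ∏ r ∈ hfin.toFinset, N r :=
    Finset.dvd_prod_of_mem _ (by simpa using hy')
  refine hNy y' hy' m (z ^ k) (z' ^ k) hm ?_ ?_
  · rw [← pow_mul, mul_comm k, ← hk, hz]
  · rw [← pow_mul, mul_comm k, ← hk, hz']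

end Radical
end PadicPV

namespace PadicPV

open Polynomial

theorem exists_aeval_eq_mul_one_add {E M Γ : Type*} [Field E] [Field M] [Algebra E M]
    [LinearOrderedCommGroupWithZero Γ] {v : Valuation M Γ} {P : E[X]} {y q : M} {j : ℕ}
    (hj : j ∈ P.support) (hy : y ≠ 0) (hq : q ≠ 0)
    (h : ∀ i ∈ P.support, i ≠ j → v (algebraMap E M (P.coeff i) * y ^ i)
      ≤ v (q * (algebraMap E M (P.coeff j) * y ^ j))) :
    ∃ w : M, v w ≤ 1 ∧ aeval y P = algebraMap E M (P.coeff j) * y ^ j * (1 + q * w) := by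
  classical
  set b := algebraMap E M (P.coeff j) * y ^ j with hb
  have hb0 : b ≠ 0 := by
    refine mul_ne_zero ?_ (pow_ne_zero _ hy)
    simpa using mem_support_iff.1 hj
  have hsum : aeval y P = b + ∑ i ∈ P.support.erase j, algebraMap E M (P.coeff i) * y ^ i := by
    rw [aeval_def, eval₂_eq_sum, sum_def, ← Finset.add_sum_erase _ _ hj]
  set s := ∑ i ∈ P.support.erase j, algebraMap E M (P.coeff i) * y ^ i
  have hs : v s ≤ v (q * b) :=
    v.map_sum_le fun i hi => h i (Finset.mem_of_mem_erase hi) (Finset.ne_of_mem_erase hi)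
  refine ⟨s / (q * b), ?_, ?_⟩
  · rw [map_div₀]
    exact div_le_one_of_le₀ hs zero_le
  · rw [hsum]
    field_simp

theorem IsPadicVal.ne_zero_of_pow_eq_one_add_mul {M Γ : Type*} [Field M]
    [LinearOrderedCommGroupWithZero Γ] {v : Valuation M Γ} {p N : ℕ} (hv : IsPadicVal p v)
    (hN : 1 ≤ N) {t w : M} (hw : v w ≤ 1) (ht : t ^ N = 1 + ((N ^ 2 * p : ℕ) : M) * w) :
    t ≠ 0 := by
  rintro rfl
  rw [zero_pow (by omega)] at ht
  have h1 : v (((N ^ 2 * p : ℕ) : M) * w) = 1 := by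
    rw [show ((N ^ 2 * p : ℕ) : M) * w = -1 by linear_combination -ht, Valuation.map_neg, map_one]
  have h2 : v (((N ^ 2 * p : ℕ) : M) * w) < 1 := by
    rw [mul_comm, Nat.cast_mul, ← mul_assoc]
    refine val_mul_lt_one ?_ hv.lt_one
    rw [map_mul]
    exact mul_le_one' hw (val_natCast_le_one v _)
  exact h2.ne h1

section Radical

variable {E M₁ M₂ : Type*} [Field E] [Field M₁] [Field M₂] [Algebra E M₁] [Algebra E M₂]
  [CharZero M₁] [CharZero M₂]
  {Γ₁ Γ₂ : Type*} [LinearOrderedCommGroupWithZero Γ₁] [LinearOrderedCommGroupWithZero Γ₂]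
  {v₁ : Valuation M₁ Γ₁} {v₂ : Valuation M₂ Γ₂} {p : ℕ}

theorem val_radical_term_le (hp : p.Prime) (hv₁ : IsPadicVal p v₁) {y : M₁} {ℓ : ℕ}
    (hα : ∀ i, 0 < i → i < ℓ → ∀ e : E, v₁ (algebraMap E M₁ e * y ^ i) ≠ 1) (hy0 : y ≠ 0)
    {i j : ℕ} (hi : i < ℓ) (hj : j < ℓ) (hij : i ≠ j) {a b : E} (ha : a ≠ 0)
    (hlt : v₁ (algebraMap E M₁ a * y ^ i) < v₁ (algebraMap E M₁ b * y ^ j))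
    {N : ℕ} (hN : N ≠ 0) :
    v₁ (algebraMap E M₁ a * y ^ i) ≤ v₁ (N * (algebraMap E M₁ b * y ^ j)) := by
  have hb : v₁ (algebraMap E M₁ b * y ^ j) ≠ 0 := (zero_le.trans_lt hlt).ne'
  by_contra hcon
  rw [not_le] at hcon
  obtain ⟨T, hT⟩ := hv₁.val_natCast hp hN
  obtain ⟨s, hs⟩ := hv₁.val_eq_pow hp T
    (y := algebraMap E M₁ a * y ^ i / (algebraMap E M₁ b * y ^ j))
    (by rw [map_div₀]; exact div_le_one_of_le₀ hlt.le zero_le)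
    (by rw [← hT, map_div₀, le_div_iff₀ (zero_lt_iff.2 hb), ← map_mul]; exact hcon.le)
  rw [map_div₀, div_eq_iff hb] at hs
  refine val_mul_pow_ne hα hy0 hi hj hij ha (b := (p : E) ^ s * b) ?_
  rw [hs, ← map_pow, ← map_mul, map_mul (algebraMap E M₁), map_pow, map_natCast (algebraMap E M₁),
    mul_assoc]

omit [CharZero M₁] [CharZero M₂] in
theorem LiesOverVal.val_radical_term_le
    (h : LiesOverVal (v₁.comap (algebraMap E M₁)) v₂) {y : M₁} {y' : M₂} {ℓ : ℕ} (hℓ : ℓ ≠ 0)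
    {c : E} (hy : y ^ ℓ = algebraMap E M₁ c) (hy' : y' ^ ℓ = algebraMap E M₂ c) {a b : E}
    {i j N : ℕ} (hle : v₁ (algebraMap E M₁ a * y ^ i) ≤ v₁ (N * (algebraMap E M₁ b * y ^ j))) :
    v₂ (algebraMap E M₂ a * y' ^ i) ≤ v₂ (N * (algebraMap E M₂ b * y' ^ j)) := by
  have e₁ : ∀ (a : E) (i : ℕ), (algebraMap E M₁ a * y ^ i) ^ ℓ = algebraMap E M₁ (a ^ ℓ * c ^ i) := by
    intro a i
    rw [mul_pow, pow_right_comm, hy, map_mul, map_pow, map_pow]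
  have e₂ : ∀ (a : E) (i : ℕ), (algebraMap E M₂ a * y' ^ i) ^ ℓ = algebraMap E M₂ (a ^ ℓ * c ^ i) := by
    intro a i
    rw [mul_pow, pow_right_comm, hy', map_mul, map_pow, map_pow]
  have c₁ : (N : M₁) * (algebraMap E M₁ b * y ^ j) = algebraMap E M₁ (N * b) * y ^ j := by
    rw [map_mul, map_natCast, mul_assoc]
  have c₂ : (N : M₂) * (algebraMap E M₂ b * y' ^ j) = algebraMap E M₂ (N * b) * y' ^ j := by
    rw [map_mul, map_natCast, mul_assoc]
  rw [c₁, ← pow_le_pow_iff_left₀ zero_le zero_le hℓ, ← map_pow, ← map_pow, e₁, e₁] at hle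
  rw [c₂, ← pow_le_pow_iff_left₀ zero_le zero_le hℓ, ← map_pow, ← map_pow, e₂, e₂, h.le_iff]
  exact hle

/-- A polynomial expression in a radical has, up to `N`-th powers, a coefficient in the base field
that can be read off in both fields simultaneously. -/
theorem exists_common_radical_class (hp : p.Prime) (hv₁ : IsPadicVal p v₁)
    (hH₁ : IsHenselianVal v₁) (hv₂ : IsPadicVal p v₂) (hH₂ : IsHenselianVal v₂)
    (h : LiesOverVal (v₁.comap (algebraMap E M₁)) v₂) {y : M₁} {y' : M₂} {ℓ : ℕ}
    (hα : ∀ i, 0 < i → i < ℓ → ∀ e : E, v₁ (algebraMap E M₁ e * y ^ i) ≠ 1) (hy0 : y ≠ 0)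
    (hℓ : ℓ ≠ 0)
    {c : E} (hy : y ^ ℓ = algebraMap E M₁ c) (hy' : y' ^ ℓ = algebraMap E M₂ c)
    (hyy : ∀ N : ℕ, 1 ≤ N →
      ∃ (m : ℚ) (z : M₁) (z' : M₂), m ≠ 0 ∧ y = m * z ^ N ∧ y' = m * z' ^ N)
    {P : E[X]} (hP : P ≠ 0) (hdeg : P.natDegree < ℓ) {N : ℕ} (hN : 1 ≤ N) :
    ∃ (a : E) (z : M₁) (z' : M₂), a ≠ 0 ∧ z ≠ 0 ∧ z' ≠ 0 ∧
      aeval y P = algebraMap E M₁ a * z ^ N ∧ aeval y' P = algebraMap E M₂ a * z' ^ N := by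
  have : CharZero E := (algebraMap E M₁).charZero
  have hc : c ≠ 0 := by
    rintro rfl
    rw [map_zero] at hy
    exact hy0 (eq_zero_of_pow_eq_zero hy)
  have hy'0 : y' ≠ 0 := by
    rintro rfl
    rw [zero_pow hℓ, eq_comm, map_eq_zero] at hy'
    exact hc hy'
  obtain ⟨j, hj, hdom⟩ := exists_dominant_term hα hy0 hP hdeg
  have hlt : ∀ i ∈ P.support, i < ℓ := fun i hi => (le_natDegree_of_mem_supp i hi).trans_lt hdeg
  have hq : N ^ 2 * p ≠ 0 := mul_ne_zero (pow_ne_zero _ (by omega)) hp.ne_zero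
  have key : ∀ i ∈ P.support, i ≠ j → v₁ (algebraMap E M₁ (P.coeff i) * y ^ i)
      ≤ v₁ ((N ^ 2 * p : ℕ) * (algebraMap E M₁ (P.coeff j) * y ^ j)) := fun i hi hij =>
    PadicPV.val_radical_term_le hp hv₁ hα hy0 (hlt i hi) (hlt j hj) hij (mem_support_iff.1 hi)
      (hdom i hi hij) hq
  obtain ⟨w₁, hw₁, e₁⟩ := exists_aeval_eq_mul_one_add hj hy0 (by exact_mod_cast hq) key
  obtain ⟨w₂, hw₂, e₂⟩ := exists_aeval_eq_mul_one_add hj hy'0 (q := ((N ^ 2 * p : ℕ) : M₂))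
    (by exact_mod_cast hq)
    fun i hi hij => h.val_radical_term_le hℓ hy hy' (key i hi hij)
  obtain ⟨t₁, ht₁⟩ := hv₁.exists_pow_eq_one_add_mul hp hH₁ hN hw₁
  obtain ⟨t₂, ht₂⟩ := hv₂.exists_pow_eq_one_add_mul hp hH₂ hN hw₂
  obtain ⟨m, z, z', hm, hz, hz'⟩ := hyy N hN
  refine ⟨P.coeff j * (m : E) ^ j, z ^ j * t₁, z' ^ j * t₂, ?_, ?_, ?_, ?_, ?_⟩
  · exact mul_ne_zero (mem_support_iff.1 hj) (pow_ne_zero _ (by exact_mod_cast hm))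
  · refine mul_ne_zero (pow_ne_zero _ ?_) (hv₁.ne_zero_of_pow_eq_one_add_mul hN hw₁ ht₁)
    rintro rfl
    rw [zero_pow (by omega), mul_zero] at hz
    exact hy0 hz
  · refine mul_ne_zero (pow_ne_zero _ ?_) (hv₂.ne_zero_of_pow_eq_one_add_mul hN hw₂ ht₂)
    rintro rfl
    rw [zero_pow (by omega), mul_zero] at hz'
    exact hy'0 hz'
  · rw [e₁, ← ht₁, hz, map_mul, map_pow, map_ratCast]
    ring
  · rw [e₂, ← ht₂, hz', map_mul, map_pow, map_ratCast]
    ring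

end Radical
end PadicPV

namespace PadicPV

open Polynomial IntermediateField

section Radical

variable {E M₁ M₂ : Type*} [Field E] [Field M₁] [Field M₂] [Algebra E M₁] [Algebra E M₂]
  [CharZero M₁] [CharZero M₂]
  {Γ₁ Γ₂ : Type*} [LinearOrderedCommGroupWithZero Γ₁] [LinearOrderedCommGroupWithZero Γ₂]
  {v₁ : Valuation M₁ Γ₁} {v₂ : Valuation M₂ Γ₂} {p : ℕ}

theorem exists_pow_eq_mul_pow_iff {M : Type*} [Field M] {a z : M} (hz : z ≠ 0) (N : ℕ) :
    (∃ t : M, t ^ N = a * z ^ N) ↔ ∃ t : M, t ^ N = a := by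
  constructor
  · rintro ⟨t, ht⟩
    exact ⟨t / z, by rw [div_pow, ht, mul_div_cancel_right₀ _ (pow_ne_zero _ hz)]⟩
  · rintro ⟨t, ht⟩
    exact ⟨t * z, by rw [mul_pow, ht]⟩

theorem PowCompat.exists_extension (hc : PowCompat E M₁ M₂) (hR : RatPow M₁) (hp : p.Prime)
    (hv₁ : IsPadicVal p v₁)
    (hH₁ : IsHenselianVal v₁) (hv₂ : IsPadicVal p v₂) (hH₂ : IsHenselianVal v₂)
    {y : M₁} {ℓ : ℕ}
    (hα : ∀ i, 0 < i → i < ℓ → ∀ e : E, v₁ (algebraMap E M₁ e * y ^ i) ≠ 1) (hy0 : y ≠ 0)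
    (hℓ : ℓ ≠ 0) {c : E} (hy : y ^ ℓ = algebraMap E M₁ c) :
    ∃ f : E⟮y⟯ →ₐ[E] M₂, ∀ N : ℕ, 1 ≤ N → ∀ a : E⟮y⟯,
      (∃ z : M₁, z ^ N = a) ↔ ∃ z : M₂, z ^ N = f a := by
  have hlies := hc.liesOverVal hp hv₁ hH₁ hv₂ hH₂
  obtain ⟨y', hy', hyy⟩ := hc.exists_root hR (Nat.one_le_iff_ne_zero.2 hℓ) hy hy0
  have hclass : ∀ {P : E[X]}, P ≠ 0 → P.natDegree < ℓ → ∀ {N : ℕ}, 1 ≤ N → _ :=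
    fun {P} hP hdeg {N} hN => exists_common_radical_class hp hv₁ hH₁ hv₂ hH₂ hlies hα hy0 hℓ hy hy'
      hyy hP hdeg hN
  have hm : (X ^ ℓ - C c : E[X]).Monic := monic_X_pow_sub_C c hℓ
  have hintg : IsIntegral E y := ⟨X ^ ℓ - C c, hm, by simp [hy]⟩
  have hdvd : minpoly E y ∣ X ^ ℓ - C c := minpoly.dvd E y (by simp [hy])
  have hmin : minpoly E y = X ^ ℓ - C c := by
    refine (eq_of_monic_of_dvd_of_natDegree_le (minpoly.monic hintg) hm hdvd ?_).symm
    rw [natDegree_X_pow_sub_C]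
    by_contra hlt
    obtain ⟨a, z, z', ha, hz, -, e, -⟩ :=
      hclass (minpoly.ne_zero hintg) (not_le.1 hlt) (le_refl 1)
    rw [minpoly.aeval, eq_comm] at e
    exact mul_ne_zero (by simpa using ha) (pow_ne_zero _ hz) e
  set pb := adjoin.powerBasis hintg
  have hgen : pb.gen = AdjoinSimple.gen E y := adjoin.powerBasis_gen hintg
  have hroot : aeval y' (minpoly E pb.gen) = 0 := by
    rw [hgen, minpoly_gen, hmin]
    simp [hy']
  have hdim : pb.dim = ℓ := by
    rw [adjoin.powerBasis_dim, hmin, natDegree_X_pow_sub_C]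
  refine ⟨pb.lift y' hroot, fun N hN a => ?_⟩
  obtain ⟨P, hdeg, rfl⟩ := pb.exists_eq_aeval a
  have e₁ : ((aeval pb.gen P : E⟮y⟯) : M₁) = aeval y P := by
    rw [hgen, ← AdjoinSimple.coe_gen E y]
    exact (aeval_algebraMap_apply M₁ (AdjoinSimple.gen E y) P).symm
  rw [pb.lift_aeval, e₁]
  by_cases hP : P = 0
  · simp only [hP, map_zero]
    exact ⟨fun _ => ⟨0, zero_pow (by omega)⟩, fun _ => ⟨0, zero_pow (by omega)⟩⟩
  obtain ⟨a, z, z', ha, hz, hz', e, e'⟩ := hclass hP (hdim ▸ hdeg) hN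
  rw [e, e', exists_pow_eq_mul_pow_iff hz, exists_pow_eq_mul_pow_iff hz']
  exact hc N hN a

end Radical
end PadicPV

namespace PadicPV

open Polynomial IntermediateField

/-- A partial embedding which preserves and reflects being an `N`-th power. -/
def PowLift {K M₁ M₂ : Type*} [Field K] [Field M₁] [Field M₂] [Algebra K M₁] [Algebra K M₂]
    (φ : Lifts K M₁ M₂) : Prop :=
  ∀ N : ℕ, 1 ≤ N → ∀ a : φ.carrier, (∃ z : M₁, z ^ N = a) ↔ ∃ z : M₂, z ^ N = φ.emb a

variable {K M₁ M₂ : Type*} [Field K] [Field M₁] [Field M₂] [Algebra K M₁] [Algebra K M₂]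

theorem PowLift.of_chain {c : Set (Lifts K M₁ M₂)} (hc : IsChain (· ≤ ·) c)
    (hgood : ∀ φ ∈ c, PowLift φ) (hne : c.Nonempty) : PowLift (Lifts.union c hc) := by
  intro N hN a
  have : Nonempty c := hne.to_subtype
  have ha : (a : M₁) ∈ ⨆ i : c, i.1.carrier := by
    rw [← Lifts.carrier_union c hc]
    exact a.2
  have hdir : Directed (· ≤ ·) fun i : c => i.1.carrier :=
    hc.directedOn.directed_val.mono_comp _ fun _ _ h => h.1
  have ha' : (a : M₁) ∈ ((⨆ i : c, i.1.carrier : IntermediateField K M₁) : Set M₁) := ha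
  rw [IntermediateField.coe_iSup_of_directed hdir, Set.mem_iUnion] at ha'
  obtain ⟨⟨φ, hφ⟩, haφ⟩ := ha'
  obtain ⟨hle, hemb⟩ := Lifts.le_union c hc hφ
  have := hgood φ hφ N hN ⟨a, haφ⟩
  rw [← hemb ⟨a, haφ⟩] at this
  exact this

theorem PowCompat.exists_maximal (h : PowCompat K M₁ M₂) :
    ∃ φ : Lifts K M₁ M₂, PowLift φ ∧ ∀ ψ, φ ≤ ψ → PowLift ψ → ψ ≤ φ := by
  have hbot : PowLift (⊥ : Lifts K M₁ M₂) := by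
    intro N hN a
    obtain ⟨x, hx⟩ := IntermediateField.mem_bot.1 a.2
    have : a = algebraMap K (⊥ : Lifts K M₁ M₂).carrier x := Subtype.ext hx.symm
    subst this
    rw [AlgHom.commutes]
    exact h N hN x
  obtain ⟨φ, -, hφ⟩ := zorn_le_nonempty₀ {φ : Lifts K M₁ M₂ | PowLift φ}
    (fun c hgood hc y hy => ⟨Lifts.union c hc, PowLift.of_chain hc hgood ⟨y, hy⟩,
      Lifts.le_union c hc⟩) ⊥ hbot
  exact ⟨φ, hφ.prop, fun ψ hle hψ => hφ.le_of_ge hψ hle⟩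

theorem PowCompat.exists_maximal_intermediateField (h : PowCompat K M₁ M₂) :
    ∃ (E : IntermediateField K M₁) (_ : Algebra E M₂), IsScalarTower K E M₂ ∧
      PowCompat E M₁ M₂ ∧ ∀ (y : M₁) (f : E⟮y⟯ →ₐ[E] M₂), (∀ N : ℕ, 1 ≤ N → ∀ a : E⟮y⟯,
        (∃ z : M₁, z ^ N = a) ↔ ∃ z : M₂, z ^ N = f a) → y ∈ E := by
  obtain ⟨φ, hφ, hmax⟩ := h.exists_maximal
  let _ : Algebra φ.carrier M₂ := φ.emb.toAlgebra
  have hst : IsScalarTower K φ.carrier M₂ := IsScalarTower.of_algebraMap_eq fun x =>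
    (φ.emb.commutes x).symm
  refine ⟨φ.carrier, inferInstance, hst, hφ, fun y f hf => ?_⟩
  let ψ : Lifts K M₁ M₂ := ⟨φ.carrier⟮y⟯.restrictScalars K, f.restrictScalars K⟩
  have hle : φ ≤ ψ := by
    refine ⟨fun x hx => φ.carrier⟮y⟯.algebraMap_mem ⟨x, hx⟩, fun x => ?_⟩
    exact f.commutes x
  exact (hmax ψ hle hf).1 (mem_adjoin_simple_self φ.carrier y)

end PadicPV

namespace PadicPV

open Polynomial IntermediateField

variable {E M Γ : Type*} [Field E] [Field M] [Algebra E M] [LinearOrderedCommGroupWithZero Γ]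
  {v : Valuation M Γ} {p : ℕ}

theorem exists_val_pow_eq [Algebra.IsAlgebraic E M] {x : M} (hx : x ≠ 0) :
    ∃ n, 0 < n ∧ ∃ e : E, v (x ^ n) = v (algebraMap E M e) := by
  by_contra! hcon
  have hα : ∀ i, 0 < i → i < (minpoly E x).natDegree + 1 → ∀ c : E,
      v (algebraMap E M c * x ^ i) ≠ 1 := by
    intro i hi _ c hc
    refine hcon i hi c⁻¹ ?_
    rw [map_inv₀, map_inv₀]
    rw [map_mul, mul_comm] at hc
    exact eq_inv_of_mul_eq_one_left hc
  have h0 := minpoly.ne_zero (Algebra.IsIntegral.isIntegral (R := E) x)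
  obtain ⟨j, hj, hdom⟩ := exists_dominant_term hα hx h0 (Nat.lt_succ_self _)
  have := val_aeval_eq_of_dominant hj hdom
  rw [minpoly.aeval, map_zero, eq_comm, Valuation.zero_iff] at this
  exact mul_ne_zero (by simpa using mem_support_iff.1 hj) (pow_ne_zero _ hx) this

/-- If an algebraic extension of `p`-adically henselian fields has no proper totally ramified
radical subextension, then it does not change the value group. -/
theorem IsPadicVal.exists_val_eq_of_no_radical [Algebra.IsAlgebraic E M] [CharZero M]
    (hp : p.Prime) (hv : IsPadicVal p v) (hH : IsHenselianVal v)
    (hrad : ∀ (y : M) (ℓ : ℕ), ℓ ≠ 0 → y ≠ 0 → (∃ c : E, y ^ ℓ = algebraMap E M c) →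
      (∀ i, 0 < i → i < ℓ → ∀ e : E, v (algebraMap E M e * y ^ i) ≠ 1) →
      ∃ e : E, algebraMap E M e = y) (x : M) :
    ∃ e : E, v x = v (algebraMap E M e) := by
  classical
  by_cases hx : x = 0
  · exact ⟨0, by simp [hx]⟩
  have hp0 : v (p : M) ≠ 0 := val_p_ne_zero hp
  have hex := exists_val_pow_eq (E := E) (v := v) hx
  obtain ⟨hn0, e, he⟩ := Nat.find_spec hex
  have hmin : ∀ m, 0 < m → m < Nat.find hex → ∀ e : E, v (x ^ m) ≠ v (algebraMap E M e) :=
    fun m hm hmn e he => Nat.find_min hex hmn ⟨hm, e, he⟩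
  set n := Nat.find hex
  by_cases hn1 : n = 1
  · exact ⟨e, by rw [hn1, pow_one] at he; exact he⟩
  have hℓ : n.minFac.Prime := Nat.minFac_prime hn1
  obtain ⟨d, hd⟩ := n.minFac_dvd
  set ℓ := n.minFac
  have hd0 : 0 < d := Nat.pos_of_mul_pos_left (hd ▸ hn0)
  have hxn : v (x ^ n) ≠ 0 := (Valuation.ne_zero_iff v).2 (pow_ne_zero _ hx)
  have he0 : algebraMap E M e ≠ 0 := by
    rw [← Valuation.ne_zero_iff v, ← he]
    exact hxn
  obtain ⟨m, t, hm, hu⟩ := hv.exists_int_mul_pow hp hH hℓ.one_lt.le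
    (u := x ^ n / algebraMap E M e) (by rw [map_div₀, he, div_self (he ▸ hxn)])
  have hm' : (m : M) ≠ 0 := by exact_mod_cast hm
  have ht0 : t ≠ 0 := by
    rintro rfl
    rw [zero_pow hℓ.ne_zero, mul_zero, div_eq_zero_iff] at hu
    exact hu.elim (pow_ne_zero _ hx) he0
  obtain ⟨s, hs⟩ := hv.val_ratCast hp (q := ((m : ℚ))⁻¹) (by simpa using hm)
  obtain ⟨s', hs'⟩ := hv.val_eq_zpow_of_pow hp hℓ.one_lt.le (w := t) (s := s) (by
    rw [← hs, ← map_pow, Rat.cast_inv, Rat.cast_intCast, map_inv₀]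
    refine eq_inv_of_mul_eq_one_right ?_
    rw [← map_mul, ← hu, map_div₀, he, div_self (he ▸ hxn)])
  have hxt : ∀ i, (x ^ d / t) ^ i = x ^ (d * i) / t ^ i := fun i => by rw [div_pow, pow_mul]
  have key : ∀ i, 0 < i → i < ℓ → ∀ a : E, v (algebraMap E M a * (x ^ d / t) ^ i) ≠ 1 := by
    intro i hi hiℓ a ha
    refine hmin (d * i) (Nat.mul_pos hd0 hi) ?_ ((p : E) ^ (s' * i) * a⁻¹) ?_
    · rw [hd, mul_comm]
      exact Nat.mul_lt_mul_of_pos_right hiℓ hd0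
    · have ha0 : v (algebraMap E M a) ≠ 0 := by
        intro h0
        rw [map_mul, h0, zero_mul] at ha
        exact zero_ne_one ha
      rw [map_mul, map_inv₀, map_zpow₀, map_natCast (algebraMap E M), map_mul, map_inv₀, map_zpow₀,
        zpow_mul, ← hs', zpow_natCast, ← map_pow, eq_mul_inv_iff_mul_eq₀ ha0, ← map_mul]
      rw [hxt, mul_div_assoc', map_div₀, div_eq_one_iff_eq
        ((Valuation.ne_zero_iff v).2 (pow_ne_zero _ ht0)), mul_comm] at ha
      exact ha
  obtain ⟨e', he'⟩ := hrad (x ^ d / t) ℓ hℓ.ne_zero (div_ne_zero (pow_ne_zero _ hx) ht0)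
    ⟨m * e, by
      rw [hxt, mul_comm d, ← hd, map_mul, map_intCast, div_eq_iff (pow_ne_zero _ ht0)]
      rw [div_eq_iff he0] at hu
      rw [hu]; ring⟩ key
  exfalso
  refine hmin d hd0 ?_ (e' * (p : E) ^ s') ?_
  · rw [hd]
    exact lt_mul_of_one_lt_left hd0 hℓ.one_lt
  · rw [map_mul, he', map_zpow₀, map_natCast (algebraMap E M), map_mul, map_zpow₀, ← hs', ← map_mul,
      div_mul_cancel₀ _ ht0]

end PadicPV

namespace PadicPV

open Polynomial IntermediateField

theorem LiesOverVal.comp {E M Ω Γ Δ : Type*} [Field E] [Field M] [Field Ω] [Algebra E M]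
    [Algebra M Ω] [Algebra E Ω] [IsScalarTower E M Ω] [LinearOrderedCommGroupWithZero Γ]
    [LinearOrderedCommGroupWithZero Δ] {v : Valuation M Γ} {w : Valuation Ω Δ}
    (h : LiesOverVal v w) : LiesOverVal (v.comap (algebraMap E M)) w := fun x => by
  rw [IsScalarTower.algebraMap_apply E M Ω, h]
  rfl

/-- The elements of an immediate `p`-adically henselian subextension are fixed by the whole
decomposition group. -/
theorem IsPadicVal.fixed_of_immediate {E M Ω Γ Δ : Type*} [Field E] [Field M] [Field Ω]
    [CharZero M] [Algebra E M]
    [Algebra M Ω] [Algebra E Ω] [IsScalarTower E M Ω] [Algebra.IsAlgebraic E Ω] [IsGalois M Ω]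
    [LinearOrderedCommGroupWithZero Γ] [LinearOrderedCommGroupWithZero Δ]
    {v : Valuation M Γ} {w : Valuation Ω Δ} {p : ℕ} (hp : p.Prime) (hv : IsPadicVal p v)
    (hH : IsHenselianVal v) (h : LiesOverVal v w)
    (himm : ∀ x : M, ∃ e : E, v x = v (algebraMap E M e))
    (D : Subgroup (Ω ≃ₐ[E] Ω)) (hD : ∀ σ, σ ∈ D ↔ ∀ x, w (σ x) = w x) (α : M)
    {σ : Ω ≃ₐ[E] Ω} (hσ : σ ∈ D) : σ (algebraMap M Ω α) = algebraMap M Ω α := by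
  have : CharZero Ω := charZero_of_injective_algebraMap (algebraMap M Ω).injective
  obtain ⟨c₀, n, hn, hfix, happ⟩ := exists_fixed_approx D (fun σ hσ => (hD σ).1 hσ)
    (algebraMap M Ω α)
  obtain ⟨b, rfl⟩ : c₀ ∈ Set.range (algebraMap M Ω) := by
    rw [InfiniteGalois.mem_range_algebraMap_iff_fixed]
    exact fun τ => hfix (τ.restrictScalars E) ((hD _).2 fun x => hH.val_algEquiv_eq h τ x)
  by_cases hβ : α - b = 0
  · rw [sub_eq_zero.1 hβ]
    exact hfix σ hσ
  exfalso
  obtain ⟨e, he⟩ := himm (α - b)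
  have hβ0 : v (α - b) ≠ 0 := (Valuation.ne_zero_iff v).2 hβ
  have he0 : algebraMap E M e ≠ 0 := by
    rw [← Valuation.ne_zero_iff v, ← he]
    exact hβ0
  have h1 : v ((α - b) / algebraMap E M e) = 1 := by
    rw [map_div₀, he, div_self (he ▸ hβ0)]
  obtain ⟨m, hm⟩ := hv.residue_natCast hp (N := n * p)
    (mul_ne_zero (by omega) hp.ne_zero) h1.le
  have hnv : v (n : M) ≠ 0 := (Valuation.ne_zero_iff v).2 (by
    have : (n : M) ≠ 0 := by exact_mod_cast (show n ≠ 0 by omega)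
    exact this)
  have hlt : v ((n * p : ℕ) : M) < v n := by
    rw [Nat.cast_mul, map_mul]
    exact mul_lt_of_lt_one_right (zero_lt_iff.2 hnv) hv.lt_one
  have hm1 : v (m : M) = 1 := by
    refine val_eq_one_of_sub_lt h1 ?_
    rw [Valuation.map_sub_swap]
    exact (hm.trans_lt hlt).trans_le (val_natCast_le_one v n)
  have hkey := happ (algebraMap M Ω (b + algebraMap E M e * m)) fun τ hτ => by
    rw [map_add, map_add, hfix τ hτ, map_mul, ← IsScalarTower.algebraMap_apply, map_mul,
      AlgEquiv.commutes, map_intCast, map_intCast]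
  rw [← map_natCast (algebraMap M Ω), ← map_sub, ← map_sub, ← map_mul, h.le_iff] at hkey
  have e1 : (n : M) * (b - (b + algebraMap E M e * m)) = -(n * algebraMap E M e * m) := by ring
  have e2 : α - (b + algebraMap E M e * m)
      = algebraMap E M e * ((α - b) / algebraMap E M e - m) := by
    field_simp
    ring
  rw [e1, e2, Valuation.map_neg, map_mul, map_mul, map_mul, hm1, mul_one, mul_comm,
    mul_le_mul_iff_right₀ (zero_lt_iff.2 ((Valuation.ne_zero_iff v).2 he0))] at hkey
  exact (hlt.trans_le (hkey.trans hm)).false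

theorem nonempty_algHom_of_immediate {E M₁ M₂ Γ₁ Γ₂ : Type*} [Field E] [Field M₁] [Field M₂]
    [Algebra E M₁] [Algebra E M₂] [CharZero E] [Algebra.IsAlgebraic E M₁]
    [LinearOrderedCommGroupWithZero Γ₁] [LinearOrderedCommGroupWithZero Γ₂]
    {v₁ : Valuation M₁ Γ₁} {v₂ : Valuation M₂ Γ₂} {p : ℕ} (hp : p.Prime) (hv₁ : IsPadicVal p v₁)
    (hH₁ : IsHenselianVal v₁) (hH₂ : IsHenselianVal v₂)
    (hlies : LiesOverVal (v₁.comap (algebraMap E M₁)) v₂)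
    (himm : ∀ x : M₁, ∃ e : E, v₁ x = v₁ (algebraMap E M₁ e)) : Nonempty (M₁ →ₐ[E] M₂) := by
  have : CharZero M₁ := charZero_of_injective_algebraMap (algebraMap E M₁).injective
  have : CharZero M₂ := charZero_of_injective_algebraMap (algebraMap E M₂).injective
  obtain ⟨Ω₁, _, _, _, _, _, _⟩ : ∃ (Ω : Type _) (_ : Field Ω) (_ : Algebra M₁ Ω)
      (_ : Algebra E Ω), IsScalarTower E M₁ Ω ∧ IsAlgClosed Ω ∧ Algebra.IsAlgebraic M₁ Ω :=
    ⟨AlgebraicClosure M₁, inferInstance, inferInstance, inferInstance, inferInstance,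
      inferInstance, inferInstance⟩
  obtain ⟨Ω₂, _, _, _, _, _, _⟩ : ∃ (Ω : Type _) (_ : Field Ω) (_ : Algebra M₂ Ω)
      (_ : Algebra E Ω), IsScalarTower E M₂ Ω ∧ IsAlgClosed Ω ∧ Algebra.IsAlgebraic M₂ Ω :=
    ⟨AlgebraicClosure M₂, inferInstance, inferInstance, inferInstance, inferInstance,
      inferInstance, inferInstance⟩
  have : Algebra.IsAlgebraic E Ω₁ := Algebra.IsAlgebraic.trans E M₁ Ω₁
  have : IsGalois M₁ Ω₁ := { to_isSeparable := inferInstance, to_normal := ⟨fun x => IsAlgClosed.splits _⟩ }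
  have : IsGalois M₂ Ω₂ := { to_isSeparable := inferInstance, to_normal := ⟨fun x => IsAlgClosed.splits _⟩ }
  have : IsGalois E Ω₁ := { to_isSeparable := inferInstance, to_normal := ⟨fun x => IsAlgClosed.splits _⟩ }
  obtain ⟨V₁, hV₁⟩ := exists_liesOverVal v₁ Ω₁
  obtain ⟨V₂, hV₂⟩ := exists_liesOverVal v₂ Ω₂
  let ι₀ : Ω₁ →ₐ[E] Ω₂ := IsAlgClosed.lift
  have hover : LiesOverVal (v₁.comap (algebraMap E M₁))
      (V₂.valuation.comap (ι₀ : Ω₁ →+* Ω₂)) := fun x => by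
    rw [← hlies x, ← hV₂, ← IsScalarTower.algebraMap_apply, Valuation.comap_apply]
    exact iff_of_eq (congrArg (V₂.valuation · ≤ 1) (ι₀.commutes x))
  obtain ⟨σ, hσ⟩ := exists_algEquiv_of_liesOverVal (hV₁.comp (E := E)) hover
  let ι : Ω₁ →ₐ[E] Ω₂ := ι₀.comp (σ.symm : Ω₁ →ₐ[E] Ω₁)
  have hι : ∀ x, V₂.valuation (ι x) ≤ 1 ↔ V₁.valuation x ≤ 1 := fun x => by
    have := hσ (σ.symm x)
    rw [AlgEquiv.apply_symm_apply] at this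
    exact this
  let D : Subgroup (Ω₁ ≃ₐ[E] Ω₁) :=
    { carrier := {τ | ∀ x, V₁.valuation (τ x) = V₁.valuation x}
      mul_mem' := fun {a b} ha hb x => (ha (b x)).trans (hb x)
      one_mem' := fun x => rfl
      inv_mem' := fun {a} ha x => by
        have := ha (a⁻¹ x)
        rw [← AlgEquiv.mul_apply, mul_inv_cancel, AlgEquiv.one_apply] at this
        exact this.symm }
  have hmem : ∀ α : M₁, ι (algebraMap M₁ Ω₁ α) ∈ Set.range (algebraMap M₂ Ω₂) := by
    intro α
    rw [InfiniteGalois.mem_range_algebraMap_iff_fixed]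
    intro τ₂
    let _ : Algebra Ω₁ Ω₂ := ι.toRingHom.toAlgebra
    have : IsScalarTower E Ω₁ Ω₂ := IsScalarTower.of_algebraMap_eq fun x => (ι.commutes x).symm
    let τ₀ : Ω₂ ≃ₐ[E] Ω₂ := τ₂.restrictScalars E
    have hτ : ∀ x, ι (τ₀.restrictNormal Ω₁ x) = τ₂ (ι x) := τ₀.restrictNormal_commutes Ω₁
    have hD : τ₀.restrictNormal Ω₁ ∈ D := by
      refine val_algEquiv_eq fun x => ?_
      rw [← hι, hτ, hH₂.val_algEquiv_eq hV₂, hι]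
    rw [← hτ, hv₁.fixed_of_immediate hp hH₁ hV₁ himm D (fun _ => Iff.rfl) α hD]
  let f : M₁ →ₐ[E] Ω₂ := ι.comp (IsScalarTower.toAlgHom E M₁ Ω₁)
  let g : M₂ →ₐ[E] Ω₂ := IsScalarTower.toAlgHom E M₂ Ω₂
  exact ⟨(AlgEquiv.ofInjective g (algebraMap M₂ Ω₂).injective).symm.toAlgHom.comp
    (f.codRestrict g.range hmem)⟩

end PadicPV

namespace PadicPV

open Polynomial IntermediateField

/-- An algebraic extension which is `p`-adically henselian with `ℤ`-like value group embeds into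
every `p`-adically henselian extension inducing the same power predicates. -/
theorem PowCompat.nonempty_algHom {K M₁ M₂ Γ₁ Γ₂ : Type*} [Field K] [Field M₁] [Field M₂]
    [Algebra K M₁] [Algebra K M₂] [CharZero K] [Algebra.IsAlgebraic K M₁]
    [LinearOrderedCommGroupWithZero Γ₁] [LinearOrderedCommGroupWithZero Γ₂]
    {v₁ : Valuation M₁ Γ₁} {v₂ : Valuation M₂ Γ₂} {p : ℕ} (hc : PowCompat K M₁ M₂) (hp : p.Prime)
    (hv₁ : IsPadicVal p v₁) (hH₁ : IsHenselianVal v₁) (hR : RatPow M₁) (hv₂ : IsPadicVal p v₂)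
    (hH₂ : IsHenselianVal v₂) : Nonempty (M₁ →ₐ[K] M₂) := by
  have : CharZero M₁ := charZero_of_injective_algebraMap (algebraMap K M₁).injective
  have : CharZero M₂ := charZero_of_injective_algebraMap (algebraMap K M₂).injective
  obtain ⟨E, _, _, hE, hmax⟩ := hc.exists_maximal_intermediateField
  have : CharZero E := charZero_of_injective_algebraMap (algebraMap K E).injective
  have : Algebra.IsAlgebraic E M₁ := Algebra.IsAlgebraic.tower_top (K := K) E
  have himm := hv₁.exists_val_eq_of_no_radical (E := E) hp hH₁ fun y ℓ hℓ hy ⟨c, hyc⟩ hα => by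
    obtain ⟨f, hf⟩ := hE.exists_extension hR hp hv₁ hH₁ hv₂ hH₂ hα hy hℓ hyc
    exact ⟨⟨y, hmax y f hf⟩, rfl⟩
  obtain ⟨f⟩ := nonempty_algHom_of_immediate hp hv₁ hH₁ hH₂
    (hE.liesOverVal hp hv₁ hH₁ hv₂ hH₂) himm
  exact ⟨f.restrictScalars K⟩

end PadicPV

namespace PadicPV

open Polynomial IntermediateField

section Near

variable {F Γ : Type*} [Field F] [LinearOrderedCommGroupWithZero Γ] {w : Valuation F Γ} {q : F}

theorem val_mul_sub_one_le {u t : F} (hq : w q < 1) (hu : w (u - 1) ≤ w q)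
    (ht : w (t - 1) ≤ w q) : w (u * t - 1) ≤ w q := by
  have h1 : w u = 1 := val_eq_one_of_sub_lt (map_one w) (hu.trans_lt hq)
  have : u * t - 1 = u * (t - 1) + (u - 1) := by ring
  rw [this]
  refine w.map_add_le ?_ hu
  rw [map_mul, h1, one_mul]
  exact ht

theorem val_div_sub_one_le {u t : F} (hq : w q < 1) (hu : w (u - 1) ≤ w q)
    (ht : w (t - 1) ≤ w q) : w (u / t - 1) ≤ w q := by
  have h1 : w t = 1 := val_eq_one_of_sub_lt (map_one w) (ht.trans_lt hq)
  have ht0 : t ≠ 0 := (Valuation.ne_zero_iff w).1 (by rw [h1]; exact one_ne_zero)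
  have : u / t - 1 = ((u - 1) - (t - 1)) / t := by field_simp; ring
  rw [this, map_div₀, h1, div_one]
  exact Valuation.map_sub_le (v := w) hu ht

end Near

theorem IsPadicVal.comap {E M Γ : Type*} [Field E] [Field M] [Algebra E M]
    [LinearOrderedCommGroupWithZero Γ] {v : Valuation M Γ} {p : ℕ} (hv : IsPadicVal p v) :
    IsPadicVal p (v.comap (algebraMap E M)) where
  lt_one := by
    rw [Valuation.comap_apply, map_natCast]
    exact hv.lt_one
  residue x hx := by
    obtain ⟨n, hn⟩ := hv.residue (algebraMap E M x) hx
    refine ⟨n, ?_⟩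
    rw [Valuation.comap_apply, Valuation.comap_apply, map_sub, map_intCast, map_natCast]
    exact hn

theorem IsHenselianVal.exists_trace_approx {F Ω Γ Δ : Type*} [Field F] [Field Ω] [Algebra F Ω]
    [CharZero F] [IsAlgClosed Ω] [LinearOrderedCommGroupWithZero Γ]
    [LinearOrderedCommGroupWithZero Δ]
    {v : Valuation F Γ} {w : Valuation Ω Δ} (hH : IsHenselianVal v) (h : LiesOverVal v w) {α : Ω}
    (hα : IsAlgebraic F α) :
    ∃ (c : F) (n : ℕ), n ≠ 0 ∧ ∀ c' : F,
      w (n * (algebraMap F Ω c - algebraMap F Ω c')) ≤ w (α - algebraMap F Ω c') := by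
  have : IsAlgClosure F (algebraicClosure F Ω) := algebraicClosure.isAlgClosure F Ω
  have : IsAlgClosed (algebraicClosure F Ω) := IsAlgClosure.isAlgClosed F
  have : IsGalois F (algebraicClosure F Ω) :=
    { to_isSeparable := inferInstance, to_normal := ⟨fun x => IsAlgClosed.splits _⟩ }
  have : CharZero (algebraicClosure F Ω) :=
    charZero_of_injective_algebraMap (algebraMap F _).injective
  have hw : LiesOverVal v (w.comap (algebraMap (algebraicClosure F Ω) Ω)) := h
  obtain ⟨c₀, n, hn, hfix, happ⟩ := exists_fixed_approx
    (⊤ : Subgroup (algebraicClosure F Ω ≃ₐ[F] algebraicClosure F Ω))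
    (fun σ _ x => hH.val_algEquiv_eq hw σ x) ⟨α, mem_algebraicClosure_iff.2 hα⟩
  obtain ⟨c, rfl⟩ : c₀ ∈ Set.range (algebraMap F (algebraicClosure F Ω)) := by
    rw [InfiniteGalois.mem_range_algebraMap_iff_fixed]
    exact fun τ => hfix τ trivial
  refine ⟨c, n, by omega, fun c' => ?_⟩
  exact happ (algebraMap F _ c') fun σ _ => σ.commutes c'

section Approx

variable {F Ω Δ : Type*} [Field F] [Field Ω] [Algebra F Ω]
  [LinearOrderedCommGroupWithZero Δ] {w : Valuation Ω Δ} {p : ℕ}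

/-- If `x` has no best approximation in `F`, then `F` contains points which cannot be told apart
from `x` by finitely many given algebraic elements. -/
theorem exists_near_of_no_best_approx (hp1 : w p < 1)
    (hT : ∀ n : ℕ, n ≠ 0 → ∃ T : ℕ, w p ^ T ≤ w n) {x : Ω}
    (hx : ∀ a : F, ∃ a' : F, w (x - algebraMap F Ω a') ≤ w (p * (x - algebraMap F Ω a)))
    (hxF : ∀ a : F, x - algebraMap F Ω a ≠ 0) (S : Finset Ω)
    (htr : ∀ α ∈ S, ∃ (c : F) (n : ℕ), n ≠ 0 ∧ ∀ c' : F,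
      w (n * (algebraMap F Ω c - algebraMap F Ω c')) ≤ w (α - algebraMap F Ω c'))
    {q : ℕ} (hq : q ≠ 0) :
    ∃ a : F, ∀ α ∈ S, algebraMap F Ω a ≠ α ∧ w ((x - α) / (algebraMap F Ω a - α) - 1) ≤ w q := by
  classical
  rcases S.eq_empty_or_nonempty with rfl | hS
  · exact ⟨0, by simp⟩
  have htr' : ∀ α, ∃ (c : F) (n : ℕ), n ≠ 0 ∧ (α ∈ S → ∀ c' : F,
      w (n * (algebraMap F Ω c - algebraMap F Ω c')) ≤ w (α - algebraMap F Ω c')) := by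
    intro α
    by_cases hα : α ∈ S
    · obtain ⟨c, n, hn, h⟩ := htr α hα
      exact ⟨c, n, hn, fun _ => h⟩
    · exact ⟨0, 1, one_ne_zero, fun h => absurd h hα⟩
  choose c n hn hc using htr'
  obtain ⟨β, hβ, hmin⟩ := S.exists_min_image (fun α => w (x - algebraMap F Ω (c α))) hS
  have hiter : ∀ T : ℕ, ∃ a : F, w (x - algebraMap F Ω a)
      ≤ w p ^ T * w (x - algebraMap F Ω (c β)) := by
    intro T
    induction T with
    | zero => exact ⟨c β, by simp⟩
    | succ T ih =>
      obtain ⟨a, ha⟩ := ih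
      obtain ⟨a', ha'⟩ := hx a
      refine ⟨a', ha'.trans ?_⟩
      rw [map_mul, pow_succ', mul_assoc]
      exact mul_le_mul_right ha _
  obtain ⟨T, hTB⟩ := hT (q * ∏ α ∈ S, n α)
    (mul_ne_zero hq (Finset.prod_ne_zero_iff.2 fun α _ => hn α))
  obtain ⟨a, ha⟩ := hiter (T + 1)
  have hx0 : ∀ a, w (x - algebraMap F Ω a) ≠ 0 := fun a => (Valuation.ne_zero_iff w).2 (hxF a)
  refine ⟨a, fun α hα => ?_⟩
  have h1 : w (x - algebraMap F Ω a) < w (x - algebraMap F Ω (c α)) := by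
    refine (ha.trans_lt ?_).trans_le (hmin α hα)
    exact mul_lt_of_lt_one_left (zero_lt_iff.2 (hx0 _)) (pow_lt_one₀ zero_le hp1 (by omega))
  have h2 : w (algebraMap F Ω (c α) - algebraMap F Ω a) = w (x - algebraMap F Ω (c α)) := by
    have : algebraMap F Ω (c α) - algebraMap F Ω a
        = (x - algebraMap F Ω a) - (x - algebraMap F Ω (c α)) := by ring
    rw [this]
    exact Valuation.map_sub_eq_of_lt_right w h1
  have h3 : w (n α) * w (x - algebraMap F Ω (c α)) ≤ w (algebraMap F Ω a - α) := by
    rw [← h2, ← map_mul, Valuation.map_sub_swap w _ α]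
    exact hc α hα a
  have h4 : w (x - algebraMap F Ω a) ≤ w q * (w (n α) * w (x - algebraMap F Ω (c α))) := by
    refine ha.trans ?_
    rw [← mul_assoc]
    refine mul_le_mul' ?_ (hmin α hα)
    rw [pow_succ]
    refine (mul_le_of_le_one_right' hp1.le).trans (hTB.trans ?_)
    obtain ⟨k, hk⟩ := Finset.dvd_prod_of_mem n hα
    rw [hk, Nat.cast_mul, Nat.cast_mul, map_mul, map_mul]
    exact mul_le_mul_right (mul_le_of_le_one_right' (val_natCast_le_one w k)) _
  have h5 : w (x - algebraMap F Ω a) ≤ w q * w (algebraMap F Ω a - α) :=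
    h4.trans (mul_le_mul_right h3 _)
  have h6 : algebraMap F Ω a - α ≠ 0 := by
    intro h0
    rw [h0, map_zero, mul_zero] at h5
    exact hx0 a (le_antisymm h5 zero_le)
  refine ⟨sub_ne_zero.1 h6, ?_⟩
  rw [show (x - α) / (algebraMap F Ω a - α) - 1
    = (x - algebraMap F Ω a) / (algebraMap F Ω a - α) by field_simp; ring, map_div₀]
  exact div_le_of_le_mul₀ zero_le zero_le h5

end Approx

end PadicPV

namespace PadicPV

open Polynomial IntermediateField

theorem exists_pow_le_of_pow_eq_zpow {Γ : Type*} [LinearOrderedCommGroupWithZero Γ] {g π : Γ}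
    (hπ0 : π ≠ 0) (hπ : π < 1) {r : ℕ} (hr : r ≠ 0) {s : ℤ} (h : g ^ r = π ^ s) :
    ∃ T : ℕ, π ^ T ≤ g := by
  refine ⟨s.natAbs, ?_⟩
  by_contra! hlt
  have h1 : g ≤ 1 := hlt.le.trans (pow_le_one₀ zero_le hπ.le)
  have h2 : g ^ r ≤ g := pow_le_of_le_one zero_le h1 hr
  have h3 : π ^ s < π ^ (s.natAbs : ℤ) := by
    rw [← h, zpow_natCast]
    exact h2.trans_lt hlt
  rw [zpow_lt_zpow_iff_right_of_lt_one₀ (zero_lt_iff.2 hπ0) hπ] at h3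
  omega

theorem exists_pow_bounds_of_pow_eq_zpow {Γ : Type*} [LinearOrderedCommGroupWithZero Γ] {g π : Γ}
    (hπ0 : π ≠ 0) (hπ : π < 1) {r : ℕ} (hr : r ≠ 0) {s : ℤ} (h : g ^ r = π ^ s) :
    ∃ T : ℕ, π ^ T ≤ g ∧ π ^ T * g ≤ 1 := by
  have hg : g ≠ 0 := by
    rintro rfl
    rw [zero_pow hr] at h
    exact (zpow_ne_zero s hπ0) h.symm
  obtain ⟨T₁, h₁⟩ := exists_pow_le_of_pow_eq_zpow hπ0 hπ hr h
  obtain ⟨T₂, h₂⟩ := exists_pow_le_of_pow_eq_zpow (g := g⁻¹) (s := -s) hπ0 hπ hr (by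
    rw [inv_pow, h, zpow_neg])
  refine ⟨T₁ + T₂, ?_, ?_⟩
  · rw [pow_add]
    exact (mul_le_of_le_one_right' (pow_le_one₀ zero_le hπ.le)).trans h₁
  · rw [pow_add]
    calc π ^ T₁ * π ^ T₂ * g ≤ 1 * g⁻¹ * g :=
          mul_le_mul_left (mul_le_mul' (pow_le_one₀ zero_le hπ.le) h₂) _
      _ = 1 := by rw [one_mul, inv_mul_cancel₀ hg]

section Base

variable {F M Γ : Type*} [Field F] [Field M] [Algebra F M] [CharZero M]
  [LinearOrderedCommGroupWithZero Γ] {v : Valuation M Γ} {p : ℕ}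

theorem IsPadicVal.val_pow_ne_of_best_approx (hp : p.Prime) (hv : IsPadicVal p v)
    (hR : RatPow F) {x : M} (hx0 : x ≠ 0) (hbest : ∀ a : F, v x ≤ v (x - algebraMap F M a))
    {r : ℕ} (hr : r ≠ 0) (d : F) : v (x ^ r) ≠ v (algebraMap F M d) := by
  have hvx : v x ≠ 0 := (Valuation.ne_zero_iff v).2 hx0
  have h1 : ∀ b : F, v x ≠ v (algebraMap F M b) := by
    intro b hb
    have hb0 : v (algebraMap F M b) ≠ 0 := hb ▸ hvx
    have hb0' : algebraMap F M b ≠ 0 := (Valuation.ne_zero_iff v).1 hb0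
    obtain ⟨m, hm⟩ := hv.residue (x / algebraMap F M b)
      (by rw [map_div₀, hb, div_self hb0])
    have h2 := hbest (b * m)
    have e : x - algebraMap F M (b * m) = algebraMap F M b * (x / algebraMap F M b - m) := by
      rw [map_mul, map_intCast]
      field_simp
    rw [e, map_mul, hb] at h2
    exact (mul_lt_of_lt_one_right (zero_lt_iff.2 hb0) (hm.trans_lt hv.lt_one)).not_ge h2
  intro hd
  have hd0 : d ≠ 0 := by
    rintro rfl
    rw [map_zero, map_zero, map_pow] at hd
    exact pow_ne_zero _ hvx hd
  obtain ⟨Q, b, hQb⟩ := hR r (by omega) d hd0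
  have hb0 : b ≠ 0 := by
    rintro rfl
    rw [zero_pow hr, mul_zero] at hQb
    exact hd0 hQb
  have hQ : Q ≠ 0 := by
    rintro rfl
    rw [Rat.cast_zero, zero_mul] at hQb
    exact hd0 hQb
  have hb0' : v (algebraMap F M b) ≠ 0 := (Valuation.ne_zero_iff v).2 (by simpa using hb0)
  obtain ⟨s, hs⟩ := hv.val_ratCast hp hQ
  obtain ⟨s', hs'⟩ := hv.val_eq_zpow_of_pow hp (w := x / algebraMap F M b) (r := r) (s := s)
    (by omega) (by
      rw [map_div₀, div_pow, ← map_pow, hd, hQb, map_mul, map_ratCast, map_mul, hs, map_pow,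
        map_pow, mul_div_cancel_right₀ _ (pow_ne_zero _ hb0')])
  refine h1 ((p : F) ^ s' * b) ?_
  rw [map_div₀, div_eq_iff hb0'] at hs'
  rw [hs', map_mul, map_mul, map_zpow₀, map_zpow₀, map_natCast (algebraMap F M)]

variable {Ω Δ : Type*} [Field Ω] [Algebra M Ω] [Algebra F Ω] [IsScalarTower F M Ω]
  [LinearOrderedCommGroupWithZero Δ] {w : Valuation Ω Δ}

omit [CharZero M] [Algebra F M] [Field M] [Algebra M Ω] [IsScalarTower F M Ω] in
theorem exists_val_pow_eq_of_isAlgebraic {α : Ω} (hα : IsAlgebraic F α) (hα0 : α ≠ 0) :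
    ∃ r, r ≠ 0 ∧ ∃ d : F, w (α ^ r) = w (algebraMap F Ω d) := by
  obtain ⟨r, hr, d, hd⟩ := exists_val_pow_eq (E := F)
    (v := w.comap (algebraMap (algebraicClosure F Ω) Ω))
    (x := ⟨α, mem_algebraicClosure_iff.2 hα⟩) (fun h => hα0 (congrArg Subtype.val h))
  exact ⟨r, hr.ne', d, hd⟩

theorem IsPadicVal.val_lt_or_lt (hp : p.Prime) (hv : IsPadicVal p v) (h : LiesOverVal v w) {x : M}
    (hx : ∀ r : ℕ, r ≠ 0 → ∀ d : F, v (x ^ r) ≠ v (algebraMap F M d))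
    {α : Ω} (hα : IsAlgebraic F α) (hα0 : α ≠ 0) :
    (∀ T : ℕ, w (algebraMap M Ω x) < w p ^ T * w α) ∨
      ∀ T : ℕ, w α < w p ^ T * w (algebraMap M Ω x) := by
  obtain ⟨r, hr, d, hd⟩ := exists_val_pow_eq_of_isAlgebraic (w := w) hα hα0
  have hx0 : x ≠ 0 := by
    rintro rfl
    exact hx 1 one_ne_zero 0 (by simp)
  have hvx : v (x ^ r) ≠ 0 := (Valuation.ne_zero_iff v).2 (pow_ne_zero _ hx0)
  have hd0 : algebraMap F Ω d ≠ 0 := by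
    rw [← Valuation.ne_zero_iff w, ← hd]
    exact (Valuation.ne_zero_iff w).2 (pow_ne_zero _ hα0)
  have hdM : algebraMap F M d ≠ 0 := by
    intro h0
    rw [IsScalarTower.algebraMap_apply F M Ω, h0, map_zero] at hd0
    exact hd0 rfl
  have hvd : v (algebraMap F M d) ≠ 0 := (Valuation.ne_zero_iff v).2 hdM
  have hsmall : ∀ y : M, (∀ s : ℕ, v y ≠ v p ^ s) → v y ≤ 1 → ∀ T : ℕ, v y < v (p ^ T : M) := by
    intro y hy hy1 T
    by_contra! hle
    rw [map_pow] at hle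
    obtain ⟨s, hs⟩ := hv.val_eq_pow hp T hy1 hle
    exact hy s hs
  have hlt : ∀ {a b : M}, v a < v b → w (algebraMap M Ω a) < w (algebraMap M Ω b) := by
    intro a b hab
    rw [← not_le, h.le_iff, not_le]
    exact hab
  rcases le_total (v (x ^ r)) (v (algebraMap F M d)) with hle | hle
  · left
    intro T
    have := hsmall (x ^ r / algebraMap F M d) (fun s hs => hx r hr (p ^ s * d) (by
      rw [map_div₀, div_eq_iff hvd] at hs
      rw [hs, map_mul, map_pow, map_natCast (algebraMap F M), map_mul, map_pow]))
      (by rw [map_div₀]; exact div_le_one_of_le₀ hle zero_le) (T * r)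
    rw [map_div₀, div_lt_iff₀ (zero_lt_iff.2 hvd), ← map_mul] at this
    have := hlt this
    rw [map_mul (algebraMap M Ω), map_pow (algebraMap M Ω), map_pow (algebraMap M Ω),
      map_natCast (algebraMap M Ω), ← IsScalarTower.algebraMap_apply, map_mul, ← hd,
      map_pow, map_pow, map_pow, pow_mul, ← mul_pow] at this
    exact lt_of_pow_lt_pow_left₀ _ zero_le this
  · right
    intro T
    have := hsmall (algebraMap F M d / x ^ r) (fun s hs => hx r hr (d / p ^ s) (by
      rw [map_div₀, div_eq_iff hvx] at hs
      rw [map_div₀, map_div₀, map_pow (algebraMap F M), map_natCast (algebraMap F M), hs,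
        map_pow v (p : M),
        mul_div_cancel_left₀ _ (pow_ne_zero _ (val_p_ne_zero hp))]))
      (by rw [map_div₀]; exact div_le_one_of_le₀ hle zero_le) (T * r)
    rw [map_div₀, div_lt_iff₀ (zero_lt_iff.2 hvx), ← map_mul] at this
    have := hlt this
    rw [map_mul (algebraMap M Ω), map_pow (algebraMap M Ω), map_pow (algebraMap M Ω),
      map_natCast (algebraMap M Ω), ← IsScalarTower.algebraMap_apply, map_mul, ← hd,
      map_pow, map_pow, map_pow, pow_mul, ← mul_pow] at this
    exact lt_of_pow_lt_pow_left₀ _ zero_le this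

omit [IsScalarTower F M Ω] in
theorem IsPadicVal.exists_commensurable (hp : p.Prime) (hv : IsPadicVal p v) (h : LiesOverVal v w)
    (hRF : RatPow F) (hRM : RatPow M) {x : M} (hx0 : x ≠ 0)
    {α : Ω} (hα : IsAlgebraic F α) (hα0 : α ≠ 0) {N : ℕ} (hN : N ≠ 0) :
    ∃ (a : F) (z : M), z ≠ 0 ∧ x = algebraMap F M a * z ^ N ∧ ∃ T : ℕ,
      w p ^ T * w (algebraMap F Ω a) ≤ w α ∧ w p ^ T * w α ≤ w (algebraMap F Ω a) := by
  have : CharZero Ω := charZero_of_injective_algebraMap (algebraMap M Ω).injective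
  obtain ⟨r, hr, d, hd⟩ := exists_val_pow_eq_of_isAlgebraic (w := w) hα hα0
  have hd0 : d ≠ 0 := by
    rintro rfl
    rw [map_zero, map_zero, Valuation.zero_iff] at hd
    exact pow_ne_zero _ hα0 hd
  have hrN : r * N ≠ 0 := mul_ne_zero hr hN
  obtain ⟨Q, b, hQb⟩ := hRF (r * N) (by omega) d hd0
  have hb0 : b ≠ 0 := by
    rintro rfl
    rw [zero_pow hrN, mul_zero] at hQb
    exact hd0 hQb
  have hQ : Q ≠ 0 := by
    rintro rfl
    rw [Rat.cast_zero, zero_mul] at hQb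
    exact hd0 hQb
  obtain ⟨m, z, hmz⟩ := hRM N (by omega) x hx0
  have hz0 : z ≠ 0 := by
    rintro rfl
    rw [zero_pow hN, mul_zero] at hmz
    exact hx0 hmz
  have hm0 : m ≠ 0 := by
    rintro rfl
    rw [Rat.cast_zero, zero_mul] at hmz
    exact hx0 hmz
  have hbM : algebraMap F M b ≠ 0 := by simpa using hb0
  have hbΩ : algebraMap F Ω b ≠ 0 := by simpa using hb0
  have hmΩ : (m : Ω) ≠ 0 := by exact_mod_cast hm0
  have hp1 : w p < 1 := by
    rw [← map_natCast (algebraMap M Ω), h.lt_one_iff]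
    exact hv.lt_one
  have hp0 : w (p : Ω) ≠ 0 := val_p_ne_zero hp
  obtain ⟨s, hs⟩ := hv.val_ratCast hp (q := Q / m ^ r) (div_ne_zero hQ (pow_ne_zero _ hm0))
  have hs' : w ((Q / m ^ r : ℚ) : Ω) = w p ^ s := by
    have h1 : ∀ {a b : M}, v a = v b → w (algebraMap M Ω a) = w (algebraMap M Ω b) :=
      fun hab => le_antisymm (h.le_iff.2 hab.le) (h.le_iff.2 hab.ge)
    rw [← map_zpow₀] at hs
    have := h1 hs
    rwa [map_ratCast, map_zpow₀, map_natCast, map_zpow₀] at this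
  have ha0 : (m : Ω) * algebraMap F Ω b ^ N ≠ 0 := mul_ne_zero hmΩ (pow_ne_zero _ hbΩ)
  obtain ⟨T, hT1, hT2⟩ := exists_pow_bounds_of_pow_eq_zpow hp0 hp1 hr
    (g := w (α / (m * algebraMap F Ω b ^ N))) (s := s) (by
      rw [← hs', map_div₀, div_pow, ← map_pow, ← map_pow, hd, ← map_div₀, hQb, mul_pow, ← pow_mul,
        mul_comm N r, map_mul, map_pow, map_ratCast]
      congr 1
      push_cast
      field_simp)
  have hcast : algebraMap F Ω ((m : F) * b ^ N) = m * algebraMap F Ω b ^ N := by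
    have : CharZero F := (algebraMap F M).charZero
    rw [map_mul, map_pow, map_ratCast]
  have hwa0 : 0 < w (m * algebraMap F Ω b ^ N) := zero_lt_iff.2 ((Valuation.ne_zero_iff w).2 ha0)
  refine ⟨m * b ^ N, z / algebraMap F M b, div_ne_zero hz0 hbM, ?_, T, ?_, ?_⟩
  · have : CharZero F := (algebraMap F M).charZero
    rw [map_mul, map_pow, map_ratCast, hmz, div_pow]
    field_simp
  · rwa [map_div₀, le_div_iff₀ hwa0, ← hcast] at hT1
  · rwa [map_div₀, mul_div_assoc', div_le_one₀ hwa0, ← hcast] at hT2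

end Base

end PadicPV

namespace PadicPV

open Polynomial IntermediateField

section Single

variable {Ω Δ : Type*} [Field Ω] [LinearOrderedCommGroupWithZero Δ] {w : Valuation Ω Δ}

theorem val_sub_div_self_sub_one_le {ξ β q : Ω} (hξ : ξ ≠ 0) (h : w β ≤ w q * w ξ) :
    w ((ξ - β) / ξ - 1) ≤ w q := by
  have : (ξ - β) / ξ - 1 = -(β / ξ) := by field_simp; ring
  rw [this, Valuation.map_neg, map_div₀]
  exact div_le_of_le_mul₀ zero_le zero_le h

theorem val_sub_div_neg_sub_one_le {ξ β q : Ω} (hβ : β ≠ 0) (h : w ξ ≤ w q * w β) :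
    w ((ξ - β) / (-β) - 1) ≤ w q := by
  have : (ξ - β) / (-β) - 1 = -(ξ / β) := by field_simp; ring
  rw [this, Valuation.map_neg, map_div₀]
  exact div_le_of_le_mul₀ zero_le zero_le h

end Single

section Base

variable {F M Γ : Type*} [Field F] [Field M] [Algebra F M] [CharZero M]
  [LinearOrderedCommGroupWithZero Γ] {v : Valuation M Γ} {p : ℕ}

variable {Ω Δ : Type*} [Field Ω] [Algebra M Ω] [Algebra F Ω] [IsScalarTower F M Ω]
  [LinearOrderedCommGroupWithZero Δ] {w : Valuation Ω Δ}

omit [IsScalarTower F M Ω] in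
theorem IsPadicVal.exists_commensurable_small (hp : p.Prime) (hv : IsPadicVal p v)
    (h : LiesOverVal v w) (hRF : RatPow F) (hRM : RatPow M) {x : M} (hx0 : x ≠ 0)
    {α : Ω} (hα : IsAlgebraic F α) (hα0 : α ≠ 0) {N : ℕ} (hN : N ≠ 0) (s : ℕ) :
    ∃ (a : F) (z : M), z ≠ 0 ∧ x = algebraMap F M a * z ^ N ∧
      w (algebraMap F Ω a) ≤ w p ^ s * w α := by
  have : CharZero Ω := charZero_of_injective_algebraMap (algebraMap M Ω).injective
  have : CharZero F := (algebraMap F M).charZero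
  obtain ⟨a, z, hz, hx, T, h1, -⟩ := hv.exists_commensurable hp h hRF hRM hx0 hα hα0 hN
  have hpM : (p : M) ≠ 0 := by exact_mod_cast hp.ne_zero
  have hp1 : w p < 1 := by
    rw [← map_natCast (algebraMap M Ω), h.lt_one_iff]
    exact hv.lt_one
  refine ⟨a * p ^ ((T + s) * N), z / p ^ (T + s), div_ne_zero hz (pow_ne_zero _ hpM), ?_, ?_⟩
  · rw [hx, map_mul, map_pow, map_natCast, div_pow, ← pow_mul]
    field_simp
  · rw [map_mul, map_pow, map_natCast, map_mul, map_pow]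
    calc w (algebraMap F Ω a) * w p ^ ((T + s) * N)
        ≤ w (algebraMap F Ω a) * w p ^ (T + s) :=
          mul_le_mul_right (pow_le_pow_right_of_le_one' hp1.le
            (Nat.le_mul_of_pos_right _ (by omega))) _
      _ = w p ^ s * (w p ^ T * w (algebraMap F Ω a)) := by rw [pow_add, mul_comm, mul_comm (w p ^ T), mul_assoc]
      _ ≤ w p ^ s * w α := mul_le_mul_right h1 _

omit [IsScalarTower F M Ω] in
theorem IsPadicVal.exists_commensurable_big (hp : p.Prime) (hv : IsPadicVal p v)
    (h : LiesOverVal v w) (hRF : RatPow F) (hRM : RatPow M) {x : M} (hx0 : x ≠ 0)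
    {α : Ω} (hα : IsAlgebraic F α) (hα0 : α ≠ 0) {N : ℕ} (hN : N ≠ 0) (s : ℕ) :
    ∃ (a : F) (z : M), z ≠ 0 ∧ x = algebraMap F M a * z ^ N ∧
      w α ≤ w p ^ s * w (algebraMap F Ω a) ∧ ∃ T : ℕ, w p ^ T * w (algebraMap F Ω a) ≤ w α := by
  have : CharZero Ω := charZero_of_injective_algebraMap (algebraMap M Ω).injective
  have : CharZero F := (algebraMap F M).charZero
  obtain ⟨a, z, hz, hx, T, h1, h2⟩ := hv.exists_commensurable hp h hRF hRM hx0 hα hα0 hN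
  have hpM : (p : M) ≠ 0 := by exact_mod_cast hp.ne_zero
  have hpF : (p : F) ≠ 0 := by exact_mod_cast hp.ne_zero
  have hp1 : w p < 1 := by
    rw [← map_natCast (algebraMap M Ω), h.lt_one_iff]
    exact hv.lt_one
  have hp0 : w (p : Ω) ≠ 0 := val_p_ne_zero hp
  have hp0' : 0 < w (p : Ω) := zero_lt_iff.2 hp0
  have ha : w p ^ ((T + s) * N) * w (algebraMap F Ω (a / p ^ ((T + s) * N)))
      = w (algebraMap F Ω a) := by
    rw [map_div₀, map_pow (algebraMap F Ω), map_natCast (algebraMap F Ω), map_div₀, map_pow w (p : Ω),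
      mul_div_cancel₀ _ (pow_ne_zero _ hp0)]
  refine ⟨a / p ^ ((T + s) * N), z * p ^ (T + s), mul_ne_zero hz (pow_ne_zero _ hpM), ?_, ?_,
    T + (T + s) * N, ?_⟩
  · rw [hx, map_div₀, map_pow, map_natCast, mul_pow, ← pow_mul]
    field_simp
  · have h3 : w p ^ T * w α ≤ w p ^ T * (w p ^ s * w (algebraMap F Ω (a / p ^ ((T + s) * N)))) := by
      rw [← ha] at h2
      refine h2.trans ?_
      rw [← mul_assoc, ← pow_add]
      exact mul_le_mul_left (pow_le_pow_right_of_le_one' hp1.le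
        (Nat.le_mul_of_pos_right _ (by omega))) _
    exact (mul_le_mul_iff_right₀ (pow_pos hp0' T)).1 h3
  · rw [pow_add, mul_assoc, ha]
    exact h1

theorem IsPadicVal.exists_near_of_val_ne (hp : p.Prime) (hv : IsPadicVal p v)
    (h : LiesOverVal v w) (hRF : RatPow F) (hRM : RatPow M) {x : M}
    (hx : ∀ r : ℕ, r ≠ 0 → ∀ d : F, v (x ^ r) ≠ v (algebraMap F M d)) (S : Finset Ω)
    (hS : ∀ α ∈ S, IsAlgebraic F α) {N : ℕ} (hN : N ≠ 0) {q : ℕ} (hq : q ≠ 0) :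
    ∃ (a : F) (z : M), z ≠ 0 ∧ ∀ α ∈ S, algebraMap F Ω a ≠ α ∧ ∃ e : ℕ,
      w ((algebraMap M Ω x - α) / ((algebraMap F Ω a - α) * algebraMap M Ω z ^ (N * e)) - 1)
        ≤ w q := by
  classical
  have : CharZero Ω := charZero_of_injective_algebraMap (algebraMap M Ω).injective
  have hx0 : x ≠ 0 := by
    rintro rfl
    exact hx 1 one_ne_zero 0 (by simp)
  have hp1 : w p < 1 := by
    rw [← map_natCast (algebraMap M Ω), h.lt_one_iff]
    exact hv.lt_one
  have hp0 : w (p : Ω) ≠ 0 := val_p_ne_zero hp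
  have hp0' : 0 < w (p : Ω) := zero_lt_iff.2 hp0
  have hwM : ∀ {a b : M}, v a = v b → w (algebraMap M Ω a) = w (algebraMap M Ω b) :=
    fun hab => le_antisymm (h.le_iff.2 hab.le) (h.le_iff.2 hab.ge)
  obtain ⟨s₀, hs₀⟩ := hv.val_natCast hp hq
  have hs₀' : w (q : Ω) = w p ^ s₀ := by
    rw [← map_pow] at hs₀
    have := hwM hs₀
    rwa [map_natCast, map_pow (algebraMap M Ω), map_natCast (algebraMap M Ω), map_pow] at this
  have hqs : w (p : Ω) ^ (s₀ + 1) ≤ w q := by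
    rw [hs₀']
    exact pow_le_pow_right_of_le_one' hp1.le (by omega)
  have hs1 : w (p : Ω) ^ (s₀ + 1) < 1 := pow_lt_one₀ zero_le hp1 (by omega)
  set s := s₀ + 1
  have hξ0 : algebraMap M Ω x ≠ 0 := by simpa using hx0
  set ξ := algebraMap M Ω x with hξ
  have hdich : ∀ α ∈ insert 1 S, α ≠ 0 → (∀ T : ℕ, w ξ < w p ^ T * w α) ∨
      ∀ T : ℕ, w α < w p ^ T * w ξ := by
    intro α hα hα0
    refine hv.val_lt_or_lt hp h hx ?_ hα0
    rcases Finset.mem_insert.1 hα with rfl | hα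
    · exact isAlgebraic_one
    · exact hS α hα
  have hS' : ∀ α ∈ insert 1 S, IsAlgebraic F α := by
    intro α hα
    rcases Finset.mem_insert.1 hα with rfl | hα
    · exact isAlgebraic_one
    · exact hS α hα
  have key : ∃ (a : F) (z : M), z ≠ 0 ∧ x = algebraMap F M a * z ^ N ∧ ∀ α ∈ S,
      α = 0 ∨ (w α ≤ w p ^ s * w (algebraMap F Ω a) ∧ w α ≤ w p ^ s * w ξ) ∨
      (w (algebraMap F Ω a) ≤ w p ^ s * w α ∧ w ξ ≤ w p ^ s * w α) := by
    by_cases hL : ((insert 1 S).filter fun α => α ≠ 0 ∧ w α < w ξ).Nonempty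
    · obtain ⟨α₁, hα₁, hmax⟩ := Finset.exists_max_image _ w hL
      obtain ⟨hα₁S, hα₁0, hα₁ξ⟩ := Finset.mem_filter.1 hα₁
      obtain ⟨a, z, hz, hxa, ha, T, hT⟩ :=
        hv.exists_commensurable_big hp h hRF hRM hx0 (hS' _ hα₁S) hα₁0 hN s
      refine ⟨a, z, hz, hxa, fun α hα => ?_⟩
      by_cases hα0 : α = 0
      · exact Or.inl hα0
      right
      have hαS := Finset.mem_insert_of_mem (a := α) (b := 1) hα
      rcases hdich α hαS hα0 with h1 | h1
      · right
        refine ⟨?_, (h1 s).le⟩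
        have h2 := (hT.trans_lt hα₁ξ).trans (h1 (T + s))
        rw [pow_add, mul_assoc] at h2
        exact ((mul_lt_mul_iff_right₀ (pow_pos hp0' T)).1 h2).le
      · left
        have h2 := h1 0
        rw [pow_zero, one_mul] at h2
        exact ⟨(hmax α (Finset.mem_filter.2 ⟨hαS, hα0, h2⟩)).trans ha, (h1 s).le⟩
    · have hU : ((insert 1 S).filter fun α => α ≠ 0).Nonempty :=
        ⟨1, Finset.mem_filter.2 ⟨Finset.mem_insert_self _ _, one_ne_zero⟩⟩
      obtain ⟨α₂, hα₂, hmin⟩ := Finset.exists_min_image _ w hU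
      obtain ⟨hα₂S, hα₂0⟩ := Finset.mem_filter.1 hα₂
      obtain ⟨a, z, hz, hxa, ha⟩ :=
        hv.exists_commensurable_small hp h hRF hRM hx0 (hS' _ hα₂S) hα₂0 hN s
      refine ⟨a, z, hz, hxa, fun α hα => ?_⟩
      by_cases hα0 : α = 0
      · exact Or.inl hα0
      right
      right
      have hαS := Finset.mem_insert_of_mem (a := α) (b := 1) hα
      rcases hdich α hαS hα0 with h1 | h1
      · exact ⟨ha.trans (mul_le_mul_right (hmin α (Finset.mem_filter.2 ⟨hαS, hα0⟩)) _), (h1 s).le⟩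
      · have h2 := h1 0
        rw [pow_zero, one_mul] at h2
        exact absurd ⟨α, Finset.mem_filter.2 ⟨hαS, hα0, h2⟩⟩ hL
  obtain ⟨a, z, hz, hxa, hS₁⟩ := key
  have hξa : ξ = algebraMap F Ω a * algebraMap M Ω z ^ N := by
    rw [hξ, hxa, map_mul, map_pow, ← IsScalarTower.algebraMap_apply]
  have hz0 : algebraMap M Ω z ≠ 0 := by simpa using hz
  have ha0 : algebraMap F Ω a ≠ 0 := by
    intro h0
    rw [h0, zero_mul] at hξa
    exact hξ0 hξa
  have hlt : ∀ {β γ : Ω}, γ ≠ 0 → w β ≤ w p ^ s * w γ → γ ≠ β := by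
    rintro β γ hγ hle rfl
    exact (mul_lt_of_lt_one_left (zero_lt_iff.2 ((Valuation.ne_zero_iff w).2 hγ)) hs1).not_ge hle
  have hq1 : w ((p : Ω) ^ s) < 1 := by rwa [map_pow]
  have hqs' : w ((p : Ω) ^ s) ≤ w q := by rwa [map_pow]
  rw [← map_pow] at hlt hS₁
  refine ⟨a, z, hz, fun α hα => ?_⟩
  rcases hS₁ α hα with rfl | ⟨h1, h2⟩ | ⟨h1, h2⟩
  · refine ⟨ha0, 1, ?_⟩
    rw [mul_one, sub_zero, sub_zero, ← hξa, div_self hξ0, sub_self, map_zero]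
    exact zero_le
  · have hne := hlt ha0 h1
    refine ⟨hne, 1, le_trans ?_ hqs'⟩
    have h3 := val_div_sub_one_le hq1 (val_sub_div_self_sub_one_le hξ0 h2)
      (val_sub_div_self_sub_one_le ha0 h1)
    have e : (ξ - α) / ξ / ((algebraMap F Ω a - α) / algebraMap F Ω a)
        = (ξ - α) / ((algebraMap F Ω a - α) * algebraMap M Ω z ^ (N * 1)) := by
      have := sub_ne_zero.2 hne
      rw [hξa, mul_one]
      field_simp
    rwa [e] at h3
  · have hα0 : α ≠ 0 := by
      rintro rfl
      rw [map_zero, mul_zero, le_zero_iff, Valuation.zero_iff] at h1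
      exact ha0 h1
    have hne := (hlt hα0 h1).symm
    refine ⟨hne, 0, le_trans ?_ hqs'⟩
    have h3 := val_div_sub_one_le hq1 (val_sub_div_neg_sub_one_le hα0 h2)
      (val_sub_div_neg_sub_one_le hα0 h1)
    have e : (ξ - α) / (-α) / ((algebraMap F Ω a - α) / (-α))
        = (ξ - α) / ((algebraMap F Ω a - α) * algebraMap M Ω z ^ (N * 0)) := by
      have := sub_ne_zero.2 hne
      rw [mul_zero, pow_zero, mul_one]
      field_simp
    rwa [e] at h3

/-- Over a Henselian subfield `F`, every `x` outside `F` can be replaced by a point of `F` without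
changing, up to `N`-th powers, its differences with finitely many algebraic elements. -/
theorem IsPadicVal.exists_near [IsAlgClosed Ω] (hp : p.Prime) (hv : IsPadicVal p v)
    (h : LiesOverVal v w) (hH : IsHenselianVal (v.comap (algebraMap F M))) (hRF : RatPow F)
    (hRM : RatPow M) {x : M} (hxF : x ∉ Set.range (algebraMap F M)) (S : Finset Ω)
    (hS : ∀ α ∈ S, IsAlgebraic F α) {N : ℕ} (hN : N ≠ 0) {q : ℕ} (hq : q ≠ 0) :
    ∃ (a : F) (z : M), z ≠ 0 ∧ ∀ α ∈ S, algebraMap F Ω a ≠ α ∧ ∃ e : ℕ,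
      w ((algebraMap M Ω x - α) / ((algebraMap F Ω a - α) * algebraMap M Ω z ^ (N * e)) - 1)
        ≤ w q := by
  classical
  have : CharZero F := (algebraMap F M).charZero
  have hxa : ∀ a : F, x - algebraMap F M a ≠ 0 := fun a ha => hxF ⟨a, (sub_eq_zero.1 ha).symm⟩
  have hmap : ∀ a : F, algebraMap M Ω x - algebraMap F Ω a = algebraMap M Ω (x - algebraMap F M a) :=
    fun a => by rw [map_sub, ← IsScalarTower.algebraMap_apply]
  by_cases hbest : ∃ a₀ : F, ∀ a : F, v (x - algebraMap F M a₀) ≤ v (x - algebraMap F M a)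
  · obtain ⟨a₀, ha₀⟩ := hbest
    have hbest' : ∀ a : F, v (x - algebraMap F M a₀)
        ≤ v (x - algebraMap F M a₀ - algebraMap F M a) := by
      intro a
      have := ha₀ (a₀ + a)
      rwa [map_add, ← sub_sub] at this
    obtain ⟨a, z, hz, H⟩ := hv.exists_near_of_val_ne hp h hRF hRM
      (fun r hr d => hv.val_pow_ne_of_best_approx hp hRF (hxa a₀) hbest' hr d)
      (S.image fun α => α - algebraMap F Ω a₀) (by
        intro β hβ
        obtain ⟨α, hα, rfl⟩ := Finset.mem_image.1 hβ
        exact (hS α hα).sub (isAlgebraic_algebraMap a₀)) hN hq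
    refine ⟨a + a₀, z, hz, fun α hα => ?_⟩
    obtain ⟨h1, e, h2⟩ := H _ (Finset.mem_image_of_mem _ hα)
    refine ⟨fun h0 => h1 (by rw [← h0, map_add, add_sub_cancel_right]), e, ?_⟩
    rw [← hmap, sub_sub_sub_cancel_right] at h2
    have e2 : algebraMap F Ω a - (α - algebraMap F Ω a₀) = algebraMap F Ω (a + a₀) - α := by
      rw [map_add]; ring
    rwa [e2] at h2
  · push Not at hbest
    have hF : LiesOverVal (v.comap (algebraMap F M)) w := h.comp
    have hvw : ∀ {a b : M}, v a ≤ v b → w (algebraMap M Ω a) ≤ w (algebraMap M Ω b) :=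
      fun hab => h.le_iff.2 hab
    have hp1 : w p < 1 := by
      rw [← map_natCast (algebraMap M Ω), h.lt_one_iff]
      exact hv.lt_one
    obtain ⟨a, H⟩ := exists_near_of_no_best_approx (F := F) (p := p) hp1 (fun n hn => by
        obtain ⟨T, hT⟩ := hv.val_natCast hp hn
        refine ⟨T, ?_⟩
        rw [← map_pow] at hT
        have := hvw hT.ge
        rwa [map_natCast, map_pow (algebraMap M Ω), map_natCast (algebraMap M Ω), map_pow] at this)
      (x := algebraMap M Ω x) (fun a => by
        obtain ⟨a', ha'⟩ := hbest a
        refine ⟨a', ?_⟩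
        rw [hmap, hmap, ← map_natCast (algebraMap M Ω), ← map_mul (algebraMap M Ω)]
        refine hvw ?_
        have h0 : 0 < v (x - algebraMap F M a) := zero_lt_iff.2 ((Valuation.ne_zero_iff v).2 (hxa a))
        have h1 := hv.le_of_lt_one hp (x := (x - algebraMap F M a') / (x - algebraMap F M a)) (by
          rw [map_div₀]
          exact (div_lt_one₀ h0).2 ha')
        rw [map_div₀, div_le_iff₀ h0] at h1
        rwa [map_mul])
      (fun a => by
        rw [hmap]
        exact fun h0 => hxa a ((map_eq_zero _).1 h0)) S (fun α hα => hH.exists_trace_approx hF (hS α hα)) hq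
    refine ⟨a, 1, one_ne_zero, fun α hα => ⟨(H α hα).1, 0, ?_⟩⟩
    rw [mul_zero, pow_zero, mul_one]
    exact (H α hα).2

end Base

end PadicPV

namespace PadicPV

open Polynomial IntermediateField

section Specialize

theorem exists_val_aeval_div_sub_one_le {F Ω Δ : Type*} [Field F] [Field Ω] [Algebra F Ω]
    [IsAlgClosed Ω] [LinearOrderedCommGroupWithZero Δ] {w : Valuation Ω Δ} {q : Ω} (hq : w q < 1)
    {ξ ζ : Ω} {a : F} {N : ℕ} {g : F[X]} (hg : g ≠ 0)
    (H : ∀ α ∈ g.aroots Ω, algebraMap F Ω a ≠ α ∧ ∃ e : ℕ,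
      w ((ξ - α) / ((algebraMap F Ω a - α) * ζ ^ (N * e)) - 1) ≤ w q) :
    g.eval a ≠ 0 ∧ ∃ E : ℕ,
      w (aeval ξ g / (algebraMap F Ω (g.eval a) * ζ ^ (N * E)) - 1) ≤ w q := by
  have hs : (g.map (algebraMap F Ω)).Splits := IsAlgClosed.splits _
  have hl : algebraMap F Ω g.leadingCoeff ≠ 0 := by simpa using hg
  have hga : algebraMap F Ω (g.eval a) = algebraMap F Ω g.leadingCoeff *
      ((g.aroots Ω).map fun α => algebraMap F Ω a - α).prod := by
    rw [← hs.aeval_eq_prod_aroots, aeval_algebraMap_apply, coe_aeval_eq_eval]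
  have key : ∀ s : Multiset Ω, (∀ α ∈ s, algebraMap F Ω a ≠ α ∧ ∃ e : ℕ,
      w ((ξ - α) / ((algebraMap F Ω a - α) * ζ ^ (N * e)) - 1) ≤ w q) →
      (s.map fun α => algebraMap F Ω a - α).prod ≠ 0 ∧ ∃ E : ℕ,
        w ((s.map fun α => ξ - α).prod / ((s.map fun α => algebraMap F Ω a - α).prod
          * ζ ^ (N * E)) - 1) ≤ w q := by
    intro s
    induction s using Multiset.induction_on with
    | empty => exact fun _ => ⟨by simp, 0, by simp⟩
    | cons α s ih =>
      intro hs
      obtain ⟨h1, E, h2⟩ := ih fun β hβ => hs β (Multiset.mem_cons_of_mem hβ)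
      obtain ⟨h3, e, h4⟩ := hs α (Multiset.mem_cons_self _ _)
      rw [Multiset.map_cons, Multiset.prod_cons, Multiset.map_cons, Multiset.prod_cons]
      refine ⟨mul_ne_zero (sub_ne_zero.2 h3) h1, e + E, ?_⟩
      have := val_mul_sub_one_le hq h4 h2
      rwa [div_mul_div_comm, mul_mul_mul_comm, ← pow_add, ← mul_add] at this
  obtain ⟨h1, E, h2⟩ := key _ H
  refine ⟨fun h0 => mul_ne_zero hl h1 (by rw [← hga, h0, map_zero]), E, ?_⟩
  rwa [hs.aeval_eq_prod_aroots, hga, mul_assoc, mul_div_mul_left _ _ hl]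

variable {F M Γ : Type*} [Field F] [Field M] [Algebra F M] [CharZero M]
  [LinearOrderedCommGroupWithZero Γ] {v : Valuation M Γ} {p : ℕ}

theorem IsPadicVal.exists_eval_eq_mul_pow (hp : p.Prime) (hv : IsPadicVal p v)
    (hM : IsHenselianVal v) (hH : IsHenselianVal (v.comap (algebraMap F M))) (hRF : RatPow F)
    (hRM : RatPow M) {x : M} (hxF : x ∉ Set.range (algebraMap F M)) (G : Finset F[X])
    (hG : ∀ g ∈ G, g ≠ 0) {N : ℕ} (hN : N ≠ 0) :
    ∃ a : F, ∀ g ∈ G, g.eval a ≠ 0 ∧ ∃ u : M, u ≠ 0 ∧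
      aeval x g = algebraMap F M (g.eval a) * u ^ N := by
  classical
  obtain ⟨V, h⟩ := exists_liesOverVal v (AlgebraicClosure M)
  obtain ⟨a, z, hz, H⟩ := hv.exists_near hp h hH hRF hRM hxF
    (G.biUnion fun g => (g.aroots (AlgebraicClosure M)).toFinset) (by
      intro α hα
      obtain ⟨g, hg, hα⟩ := Finset.mem_biUnion.1 hα
      rw [Multiset.mem_toFinset, mem_aroots] at hα
      exact ⟨g, hα.1, hα.2⟩) hN (q := N ^ 2 * p) (mul_ne_zero (pow_ne_zero _ hN) hp.ne_zero)
  have hq : V.valuation ((N ^ 2 * p : ℕ) : AlgebraicClosure M) < 1 := by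
    rw [← map_natCast (algebraMap M (AlgebraicClosure M)), h.lt_one_iff, Nat.cast_mul]
    exact val_mul_lt_one (val_natCast_le_one v _) hv.lt_one
  refine ⟨a, fun g hg => ?_⟩
  obtain ⟨h1, E, h2⟩ := exists_val_aeval_div_sub_one_le hq (hG g hg) (fun α hα =>
    H α (Finset.mem_biUnion.2 ⟨g, hg, Multiset.mem_toFinset.2 hα⟩))
  refine ⟨h1, ?_⟩
  have h3 : v (aeval x g / (algebraMap F M (g.eval a) * z ^ (N * E)) - 1)
      ≤ v ((N ^ 2 * p : ℕ) : M) := by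
    rw [← h.le_iff, map_sub, map_div₀, map_mul, map_pow, map_one, map_natCast,
      ← IsScalarTower.algebraMap_apply, ← aeval_algebraMap_apply]
    exact h2
  have hga : algebraMap F M (g.eval a) ≠ 0 := by simpa using h1
  obtain ⟨y, hy⟩ := hv.exists_pow_eq hp hM (by omega) h3
  have hy' : v (y ^ N) = 1 := by
    rw [hy]
    refine val_eq_one_of_sub_lt (map_one v) (h3.trans_lt ?_)
    rw [Nat.cast_mul]
    exact val_mul_lt_one (val_natCast_le_one v _) hv.lt_one
  have hy0 : y ≠ 0 := by
    rintro rfl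
    rw [zero_pow hN, map_zero] at hy'
    exact zero_ne_one hy'
  refine ⟨y * z ^ E, mul_ne_zero hy0 (pow_ne_zero _ hz), ?_⟩
  rw [mul_pow, hy, ← pow_mul, mul_comm E N]
  field_simp

end Specialize

end PadicPV

namespace PadicPV

open Polynomial IntermediateField Filter

section Germ

variable {I F Γ : Type*} [Field F] [LinearOrderedCommGroupWithZero Γ]

/-- The ultrapower of a valuation ring. -/
def germValuationSubring (U : Ultrafilter I) (v : Valuation F Γ) :
    ValuationSubring ((U : Filter I).Germ F) where
  carrier := {x | x.LiftPred fun a => v a ≤ 1}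
  mul_mem' {x y} := by
    induction x, y using Germ.inductionOn₂ with
    | h f g =>
      intro hf hg
      have hf' : ∀ᶠ i in (U : Filter I), v (f i) ≤ 1 := hf
      have hg' : ∀ᶠ i in (U : Filter I), v (g i) ≤ 1 := hg
      filter_upwards [hf', hg'] with i h1 h2
      exact (map_mul v _ _).trans_le (mul_le_one' h1 h2)
  one_mem' := Germ.liftPred_const (map_one v).le
  add_mem' {x y} := by
    induction x, y using Germ.inductionOn₂ with
    | h f g =>
      intro hf hg
      have hf' : ∀ᶠ i in (U : Filter I), v (f i) ≤ 1 := hf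
      have hg' : ∀ᶠ i in (U : Filter I), v (g i) ≤ 1 := hg
      filter_upwards [hf', hg'] with i h1 h2
      exact v.map_add_le h1 h2
  zero_mem' := Germ.liftPred_const (by rw [map_zero]; exact zero_le)
  neg_mem' {x} := by
    induction x using Germ.inductionOn with
    | h f =>
      intro hf
      have hf' : ∀ᶠ i in (U : Filter I), v (f i) ≤ 1 := hf
      filter_upwards [hf'] with i h1
      exact (v.map_neg _).trans_le h1
  mem_or_inv_mem' x := by
    induction x using Germ.inductionOn with
    | h f =>
      rcases U.em (fun i => v (f i) ≤ 1) with h | h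
      · exact Or.inl h
      · right
        filter_upwards [h] with i h1
        exact (map_inv₀ v _).trans_le (inv_le_one_of_one_le₀ (not_le.1 h1).le)

variable {U : Ultrafilter I} {v : Valuation F Γ}

theorem germ_valuation_le_one_iff {f : I → F} :
    (germValuationSubring U v).valuation (f : (U : Filter I).Germ F) ≤ 1 ↔
      ∀ᶠ i in (U : Filter I), v (f i) ≤ 1 := by
  rw [ValuationSubring.valuation_le_one_iff]
  rfl

theorem germ_valuation_le_iff {f g : I → F} :
    (germValuationSubring U v).valuation (f : (U : Filter I).Germ F)
      ≤ (germValuationSubring U v).valuation (g : (U : Filter I).Germ F) ↔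
      ∀ᶠ i in (U : Filter I), v (f i) ≤ v (g i) := by
  by_cases hg : (g : (U : Filter I).Germ F) = 0
  · have hg' : ∀ᶠ i in (U : Filter I), g i = 0 := Germ.coe_eq.1 hg
    rw [hg, map_zero, le_zero_iff, Valuation.zero_iff]
    constructor
    · intro hf
      have hf' : ∀ᶠ i in (U : Filter I), f i = 0 := Germ.coe_eq.1 hf
      filter_upwards [hf'] with i h1
      rw [h1, map_zero]
      exact zero_le
    · intro hf
      refine Germ.coe_eq.2 ?_
      filter_upwards [hf, hg'] with i h1 h2
      rw [h2, map_zero, le_zero_iff, Valuation.zero_iff] at h1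
      exact h1
  · have hg' : ∀ᶠ i in (U : Filter I), g i ≠ 0 := by
      refine U.eventually_not.2 fun h => hg (Germ.coe_eq.2 h)
    have h1 : 0 < (germValuationSubring U v).valuation (g : (U : Filter I).Germ F) :=
      zero_lt_iff.2 ((Valuation.ne_zero_iff _).2 hg)
    rw [← div_le_one₀ h1, ← map_div₀, ← Germ.coe_div, germ_valuation_le_one_iff]
    refine eventually_congr ?_
    filter_upwards [hg'] with i h2
    rw [Pi.div_apply, map_div₀, div_le_one₀ (zero_lt_iff.2 ((Valuation.ne_zero_iff _).2 h2))]

theorem germ_valuation_lt_iff {f g : I → F} :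
    (germValuationSubring U v).valuation (f : (U : Filter I).Germ F)
      < (germValuationSubring U v).valuation (g : (U : Filter I).Germ F) ↔
      ∀ᶠ i in (U : Filter I), v (f i) < v (g i) := by
  rw [← not_le, germ_valuation_le_iff, ← U.eventually_not]
  simp only [not_le]

theorem IsPadicVal.germ {p : ℕ} (hp : p.Prime) (hv : IsPadicVal p v) :
    IsPadicVal p (germValuationSubring U v).valuation where
  lt_one := by
    rw [← map_one (germValuationSubring U v).valuation]
    exact germ_valuation_lt_iff (f := fun _ => (p : F)) (g := fun _ => 1).2
      (Eventually.of_forall fun i => by rw [map_one]; exact hv.lt_one)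
  residue x := by
    induction x using Germ.inductionOn with
    | h f =>
      intro hf
      rw [germ_valuation_le_one_iff] at hf
      have : ∀ᶠ i in (U : Filter I), ∃ r ∈ Finset.range p, v (f i - (r : ℕ)) ≤ v p := by
        filter_upwards [hf] with i hi
        obtain ⟨n, hn⟩ := hv.residue _ hi
        have hp0 : (p : ℤ) ≠ 0 := by exact_mod_cast hp.ne_zero
        have h0 := Int.emod_nonneg n hp0
        have h1 := Int.emod_lt_of_pos n (by omega : (0 : ℤ) < p)
        refine ⟨(n % p).toNat, Finset.mem_range.2 (by omega), ?_⟩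
        have e : f i - ((n % p).toNat : ℕ) = (f i - n) + p * ((n / p : ℤ) : F) := by
          have h2 : ((n % p).toNat : ℤ) = n - p * (n / p) := by
            rw [Int.toNat_of_nonneg h0, Int.emod_def]
          have h3 : (((n % p).toNat : ℤ) : F) = ((n - p * (n / p) : ℤ) : F) := by rw [h2]
          push_cast at h3
          rw [h3]
          ring
        rw [e]
        refine v.map_add_le hn ?_
        rw [map_mul]
        exact mul_le_of_le_one_right' (val_intCast_le_one v _)
      obtain ⟨r, -, hr⟩ := (Ultrafilter.eventually_exists_mem_iff
        (Finset.finite_toSet _)).1 this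
      refine ⟨r, ?_⟩
      exact germ_valuation_le_iff (f := fun i => f i - ((r : ℤ) : F)) (g := fun _ => (p : F)).2
        (by simpa using hr)

theorem IsHenselianVal.germ (hH : IsHenselianVal v) :
    IsHenselianVal (germValuationSubring U v).valuation := by
  intro P hP hintg
  set Φ : (I → F) →+* (U : Filter I).Germ F := Germ.coeRingHom (U : Filter I) with hΦ
  have hsurj : Function.Surjective Φ := fun x => by
    induction x using Germ.inductionOn with
    | h f => exact ⟨f, rfl⟩
  obtain ⟨P, rfl, hdeg, hPm⟩ := lifts_and_natDegree_eq_and_monic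
    ((mem_lifts P).2 (map_surjective Φ hsurj P)) hP
  intro a
  induction a using Germ.inductionOn with
  | h a =>
    intro ha h1 h2
    have hev : ∀ (Q : (I → F)[X]) (i : I), (Q.eval a) i = (Q.map (Pi.evalRingHom _ i)).eval (a i) := by
      intro Q i
      exact (eval_map_apply (Pi.evalRingHom (fun _ : I => F) i) a).symm
    have hev' : ∀ Q : (I → F)[X], (Q.map Φ).eval (a : (U : Filter I).Germ F)
        = ((Q.eval a : I → F) : (U : Filter I).Germ F) := by
      intro Q
      exact eval_map_apply Φ a
    rw [hev', ← map_one (germValuationSubring U v).valuation] at h1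
    rw [derivative_map, hev', ← map_one (germValuationSubring U v).valuation] at h2
    have h1' := (germ_valuation_lt_iff (g := fun _ => (1 : F))).1 h1
    have h2' := (germ_valuation_le_iff (f := fun _ => (1 : F))).1 h2.ge
    have h3' := (germ_valuation_le_iff (g := fun _ => (1 : F))).1 h2.le
    have hc : ∀ᶠ i in (U : Filter I), ∀ j ∈ Finset.range (P.natDegree + 1),
        v (P.coeff j i) ≤ 1 := by
      rw [Finset.eventually_all]
      intro j _
      have := hintg j
      rw [coeff_map] at this
      exact germ_valuation_le_one_iff.1 this
    have : ∀ᶠ i in (U : Filter I), ∃ b : F, (P.map (Pi.evalRingHom _ i)).eval b = 0 ∧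
        v (b - a i) < 1 := by
      filter_upwards [h1', h2', h3', hc, germ_valuation_le_one_iff.1 ha] with i h1 h2 h3 hc ha
      rw [map_one] at h1 h2 h3
      refine hH _ (hPm.map _) (fun j => ?_) _ ha (by rwa [← hev]) ?_
      · rw [coeff_map]
        by_cases hj : j < P.natDegree + 1
        · exact hc j (Finset.mem_range.2 hj)
        · rw [coeff_eq_zero_of_natDegree_lt (by omega), map_zero, map_zero]
          exact zero_le
      · rw [derivative_map, ← hev]
        exact le_antisymm h3 h2
    obtain ⟨b, hb⟩ := this.choice
    refine ⟨(b : (U : Filter I).Germ F), ?_, ?_⟩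
    · refine (eval_map_apply Φ b).trans (Germ.coe_eq.2 ?_)
      filter_upwards [hb] with i hi
      refine Eq.trans ?_ hi.1
      exact (eval_map_apply (Pi.evalRingHom (fun _ : I => F) i) b).symm
    · rw [← map_one (germValuationSubring U v).valuation]
      refine (germ_valuation_lt_iff (f := b - a) (g := fun _ => (1 : F))).2 ?_
      filter_upwards [hb] with i hi
      rw [map_one]
      exact hi.2

end Germ

end PadicPV

namespace PadicPV

open Polynomial IntermediateField Filter

section Closed

variable {F M Γ : Type*} [Field F] [Field M] [Algebra F M] [LinearOrderedCommGroupWithZero Γ]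
  {v : Valuation M Γ}

theorem isHenselianVal_comap_of_closed
    (hcl : ∀ y : M, IsAlgebraic F y → y ∈ Set.range (algebraMap F M)) (hH : IsHenselianVal v) :
    IsHenselianVal (v.comap (algebraMap F M)) := by
  intro f hf hc a ha h1 h2
  obtain ⟨b, hb, hba⟩ := hH (f.map (algebraMap F M)) (hf.map _) (fun i => by
    rw [coeff_map]; exact hc i) (algebraMap F M a) ha (by rwa [eval_map_apply]) (by
      rwa [derivative_map, eval_map_apply])
  obtain ⟨b, rfl⟩ := hcl b ⟨f, hf.ne_zero, by rwa [eval_map_algebraMap] at hb⟩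
  rw [eval_map_apply, map_eq_zero] at hb
  refine ⟨b, hb, ?_⟩
  rw [Valuation.comap_apply, map_sub]
  exact hba

theorem RatPow.of_closed [CharZero M]
    (hcl : ∀ y : M, IsAlgebraic F y → y ∈ Set.range (algebraMap F M)) (hR : RatPow M) :
    RatPow F := by
  have : CharZero F := (algebraMap F M).charZero
  intro N hN x hx
  obtain ⟨q, z, hz⟩ := hR N hN (algebraMap F M x) (by simpa using hx)
  have hq : (q : M) ≠ 0 := by
    intro h0
    rw [h0, zero_mul, map_eq_zero] at hz
    exact hx hz
  obtain ⟨z, rfl⟩ := hcl z (by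
    refine IsAlgebraic.of_pow (n := N) (by omega) ?_
    have : z ^ N = algebraMap F M (x / q) := by
      rw [map_div₀, hz, map_ratCast, mul_div_cancel_left₀ _ hq]
    rw [this]
    exact isAlgebraic_algebraMap _)
  refine ⟨q, z, (algebraMap F M).injective ?_⟩
  rw [hz, map_mul, map_ratCast, map_pow]

theorem algebraicClosure_closed (E : Type*) [Field E] [Algebra E M] (y : M)
    (hy : IsAlgebraic (algebraicClosure E M) y) :
    y ∈ Set.range (algebraMap (algebraicClosure E M) M) :=
  ⟨⟨y, mem_algebraicClosure_iff.2 (hy.restrictScalars E)⟩, rfl⟩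

theorem PowCompat.algebraicClosure {E M' : Type*} [Field E] [Field M'] [Algebra E M]
    [Algebra E M'] (hc : PowCompat E M M') : PowCompat E (algebraicClosure E M) M' := by
  intro N hN a
  rw [← hc N hN a]
  constructor
  · rintro ⟨z, hz⟩
    exact ⟨z, congrArg Subtype.val hz⟩
  · rintro ⟨z, hz⟩
    refine ⟨⟨z, mem_algebraicClosure_iff.2 (IsAlgebraic.of_pow (n := N) (by omega) ?_)⟩,
      Subtype.ext hz⟩
    rw [hz]
    exact isAlgebraic_algebraMap _

theorem PowCompat.symm {E M' : Type*} [Field E] [Field M'] [Algebra E M]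
    [Algebra E M'] (hc : PowCompat E M M') : PowCompat E M' M := fun N hN a => (hc N hN a).symm

end Closed

theorem exists_algHom_of_transcendental {F M R : Type*} [Field F] [Field M] [Field R] [Algebra F M]
    [Algebra F R] {x : M} {y : R} (hx : Transcendental F x) (hy : Transcendental F y) :
    ∃ φ : F⟮x⟯ →ₐ[F] R, φ (AdjoinSimple.gen F x) = y := by
  refine ⟨(F⟮y⟯.val.comp (RatFunc.algEquivOfTranscendental y hy).toAlgHom).comp
    (RatFunc.algEquivOfTranscendental x hx).symm.toAlgHom, ?_⟩
  simp

section Ultra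

variable {F M Γ : Type*} [Field F] [Field M] [Algebra F M] [CharZero M]
  [LinearOrderedCommGroupWithZero Γ] {v : Valuation M Γ} {p : ℕ}

theorem IsPadicVal.exists_ultrafilter (hp : p.Prime) (hv : IsPadicVal p v)
    (hM : IsHenselianVal v) (hH : IsHenselianVal (v.comap (algebraMap F M))) (hRF : RatPow F)
    (hRM : RatPow M) {x : M} (hxF : x ∉ Set.range (algebraMap F M)) :
    ∃ U : Ultrafilter F, ∀ g : F[X], g ≠ 0 → ∀ N : ℕ, N ≠ 0 → ∀ᶠ a in (U : Filter F),
      g.eval a ≠ 0 ∧ ∃ u : M, u ≠ 0 ∧ aeval x g = algebraMap F M (g.eval a) * u ^ N := by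
  classical
  let s : {g : F[X] // g ≠ 0} × {N : ℕ // N ≠ 0} → Set F := fun i =>
    {a | i.1.1.eval a ≠ 0 ∧ ∃ u : M, u ≠ 0 ∧
      aeval x i.1.1 = algebraMap F M (i.1.1.eval a) * u ^ i.2.1}
  obtain ⟨U, hU⟩ := Ultrafilter.exists_ultrafilter_of_finite_inter_nonempty (Set.range s) (by
    intro T hT
    have : Nonempty ({g : F[X] // g ≠ 0} × {N : ℕ // N ≠ 0}) :=
      ⟨(⟨1, one_ne_zero⟩, ⟨1, one_ne_zero⟩)⟩
    have hT' : ∀ t, t ∈ T → ∃ i, s i = t := fun t ht => hT ht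
    choose! i hi using hT'
    obtain ⟨a, ha⟩ := hv.exists_eval_eq_mul_pow hp hM hH hRF hRM hxF
      (T.image fun t => (i t).1.1) (by
        intro g hg
        obtain ⟨t, -, rfl⟩ := Finset.mem_image.1 hg
        exact (i t).1.2) (N := ∏ t ∈ T, (i t).2.1)
      (Finset.prod_ne_zero_iff.2 fun t _ => (i t).2.2)
    refine ⟨a, fun t ht => ?_⟩
    obtain ⟨h1, u, hu, h2⟩ := ha _ (Finset.mem_image_of_mem _ ht)
    rw [← hi t ht]
    obtain ⟨e, he⟩ := Finset.dvd_prod_of_mem (fun t => (i t).2.1) ht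
    refine ⟨h1, u ^ e, pow_ne_zero _ hu, ?_⟩
    rw [h2, he, mul_comm (i t).2.1 e, pow_mul])
  exact ⟨U, fun g hg N hN => hU ⟨(⟨g, hg⟩, ⟨N, hN⟩), rfl⟩⟩

end Ultra

end PadicPV

namespace PadicPV

open Polynomial IntermediateField Filter

theorem exists_specialization_of_germ {F R I : Type*} [Field F] [Field R] [Algebra F R]
    {U : Ultrafilter I} (ψ : R →+* (U : Filter I).Germ F)
    (hψ : ∀ c : F, ψ (algebraMap F R c) = ((fun _ => c : I → F) : (U : Filter I).Germ F))
    {m : ℕ} (u : Fin m → R) :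
    ∃ a : Fin m → F, ∀ g : MvPolynomial (Fin m) F,
      MvPolynomial.aeval u g = 0 → MvPolynomial.eval a g = 0 := by
  have hsurj : ∀ y : (U : Filter I).Germ F, ∃ f : I → F, (f : (U : Filter I).Germ F) = y :=
    fun y => by
      induction y using Germ.inductionOn with
      | h f => exact ⟨f, rfl⟩
  choose f hf using fun i => hsurj (ψ (u i))
  obtain ⟨s, hs⟩ := (IsNoetherian.noetherian
    (RingHom.ker (MvPolynomial.aeval (R := F) u)) : Submodule.FG _)
  have key : ∀ g : MvPolynomial (Fin m) F, MvPolynomial.aeval u g = 0 →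
      ∀ᶠ i in (U : Filter I), MvPolynomial.eval (fun j => f j i) g = 0 := by
    intro g hg
    have h1 : ((MvPolynomial.eval₂ (Pi.constRingHom I F) f g : I → F) : (U : Filter I).Germ F) = 0 := by
      have h2 := MvPolynomial.hom_eval₂ g (Pi.constRingHom I F)
        (Germ.coeRingHom (U : Filter I)) f
      refine h2.trans ?_
      have h3 := congrArg ψ hg
      rw [MvPolynomial.aeval_def, MvPolynomial.hom_eval₂, map_zero] at h3
      rw [← h3]
      congr 1
      · ext c
        exact (hψ c).symm
      · funext j
        exact hf j
    filter_upwards [Germ.coe_eq.1 h1] with i hi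
    have h2 := MvPolynomial.hom_eval₂ g (Pi.constRingHom I F) (Pi.evalRingHom _ i) f
    exact h2.symm.trans hi
  have hev : ∀ᶠ i in (U : Filter I), ∀ g ∈ s, MvPolynomial.eval (fun j => f j i) g = 0 := by
    rw [Finset.eventually_all]
    intro g hg
    refine key g ?_
    have : g ∈ RingHom.ker (MvPolynomial.aeval (R := F) u) := hs ▸ Submodule.subset_span hg
    exact this
  obtain ⟨i, hi⟩ := hev.exists
  refine ⟨fun j => f j i, fun g hg => ?_⟩
  have hg' : g ∈ Submodule.span (MvPolynomial (Fin m) F) (s : Set (MvPolynomial (Fin m) F)) := by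
    rw [hs]
    exact hg
  have hle : Submodule.span (MvPolynomial (Fin m) F) (s : Set (MvPolynomial (Fin m) F)) ≤
      RingHom.ker (MvPolynomial.eval fun j => f j i) := Submodule.span_le.2 hi
  exact hle hg'

theorem exists_pow_eq_div_iff {M : Type*} [Field M] {g h : M} (hh : h ≠ 0) {N : ℕ} (hN : 1 ≤ N) :
    (∃ t : M, t ^ N = g / h) ↔ ∃ t : M, t ^ N = g * h ^ (N - 1) := by
  rw [← exists_pow_eq_mul_pow_iff hh N (a := g / h)]
  have : g / h * h ^ N = g * h ^ (N - 1) := by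
    obtain ⟨n, rfl⟩ := Nat.exists_eq_add_of_le' hN
    rw [Nat.add_sub_cancel, pow_succ]
    field_simp
  rw [this]

section Step

variable {F M Γ : Type*} [Field F] [Field M] [Algebra F M] [CharZero M]
  [LinearOrderedCommGroupWithZero Γ] {v : Valuation M Γ} {p : ℕ}

theorem IsPadicVal.exists_specialization_closure_adjoin (hp : p.Prime) (hv : IsPadicVal p v)
    (hM : IsHenselianVal v) (hRM : RatPow M)
    (hcl : ∀ y : M, IsAlgebraic F y → y ∈ Set.range (algebraMap F M)) {x : M}
    (hxF : x ∉ Set.range (algebraMap F M)) {m : ℕ} (u : Fin m → algebraicClosure F⟮x⟯ M) :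
    ∃ a : Fin m → F, ∀ g : MvPolynomial (Fin m) F,
      MvPolynomial.aeval u g = 0 → MvPolynomial.eval a g = 0 := by
  have hH := isHenselianVal_comap_of_closed hcl hM
  have hRF := RatPow.of_closed hcl hRM
  obtain ⟨U, hU⟩ := hv.exists_ultrafilter hp hM hH hRF hRM hxF
  let _ : Algebra F ((U : Filter F).Germ F) :=
    ((Germ.coeRingHom (U : Filter F)).comp (Pi.constRingHom F F)).toAlgebra
  have : CharZero F := (algebraMap F M).charZero
  have hconst : ∀ c : F, algebraMap F ((U : Filter F).Germ F) c
    = ((fun _ => c : F → F) : (U : Filter F).Germ F) := fun c => rfl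
  set y : (U : Filter F).Germ F := ((id : F → F) : (U : Filter F).Germ F) with hy
  have hev : ∀ g : F[X], aeval y g = ((fun a => g.eval a : F → F) : (U : Filter F).Germ F) := by
    intro g
    have h1 := hom_eval₂ g (Pi.constRingHom F F) (Germ.coeRingHom (U : Filter F)) id
    refine h1.symm.trans ?_
    refine Germ.coe_eq.2 (Eventually.of_forall fun a => ?_)
    exact hom_eval₂ g (Pi.constRingHom F F) (Pi.evalRingHom _ a) id
  have hxt : Transcendental F x := fun h => hxF (hcl x h)
  have hyt : Transcendental F y := by
    rw [transcendental_iff]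
    intro g hg
    by_contra hg0
    rw [hev] at hg
    obtain ⟨a, h1, h2⟩ := ((hU g hg0 1 one_ne_zero).and (Germ.coe_eq.1 hg)).exists
    exact h1.1 h2
  obtain ⟨φ, hφ⟩ := exists_algHom_of_transcendental hxt hyt
  let _ : Algebra F⟮x⟯ ((U : Filter F).Germ F) := φ.toRingHom.toAlgebra
  have hφg : ∀ g : F[X], φ (aeval (AdjoinSimple.gen F x) g) = aeval y g := by
    intro g
    rw [← hφ, aeval_algHom_apply]
  have hpoly : ∀ c : F[X], c ≠ 0 → ∀ N, 1 ≤ N →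
      ((∃ z : M, z ^ N = aeval x c) ↔ ∃ z : (U : Filter F).Germ F, z ^ N = aeval y c) := by
    intro c hc N hN
    have hc' := hU c hc N (by omega)
    have hiff : ∀ᶠ a in (U : Filter F),
        ((∃ z : M, z ^ N = aeval x c) ↔ ∃ z : F, z ^ N = c.eval a) := by
      filter_upwards [hc'] with a ha
      obtain ⟨-, w, hw, e⟩ := ha
      rw [e, exists_pow_eq_mul_pow_iff hw]
      constructor
      · rintro ⟨z, hz⟩
        obtain ⟨z, rfl⟩ := hcl z (by
          refine IsAlgebraic.of_pow (n := N) (by omega) ?_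
          rw [hz]
          exact isAlgebraic_algebraMap _)
        rw [← map_pow] at hz
        exact ⟨z, (algebraMap F M).injective hz⟩
      · rintro ⟨z, hz⟩
        exact ⟨algebraMap F M z, by rw [← map_pow, hz]⟩
    rw [hev]
    constructor
    · intro hz
      have : ∀ᶠ a in (U : Filter F), ∃ z : F, z ^ N = c.eval a := by
        filter_upwards [hiff] with a ha
        exact ha.1 hz
      obtain ⟨z, hz⟩ := this.choice
      exact ⟨(z : (U : Filter F).Germ F), Germ.coe_eq.2 hz⟩
    · rintro ⟨z, hz⟩
      induction z using Germ.inductionOn with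
      | h z =>
        obtain ⟨a, h1, h2⟩ := (hiff.and (Germ.coe_eq.1 hz)).exists
        exact h1.2 ⟨z a, h2⟩
  have hc : PowCompat F⟮x⟯ M ((U : Filter F).Germ F) := by
    intro N hN a
    obtain ⟨g, h, e⟩ := (mem_adjoin_simple_iff F _).1 a.2
    have ha : a = aeval (AdjoinSimple.gen F x) g / aeval (AdjoinSimple.gen F x) h := by
      apply Subtype.ext
      rw [e]
      simp
    have h1 : algebraMap F⟮x⟯ M a = aeval x g / aeval x h := e
    have h2 : algebraMap F⟮x⟯ ((U : Filter F).Germ F) a = aeval y g / aeval y h := by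
      rw [← hφg, ← hφg, ← map_div₀, ← ha]
      rfl
    rw [h1, h2]
    by_cases hg0 : g = 0
    · rw [hg0]
      simp only [map_zero, zero_div]
      exact ⟨fun _ => ⟨0, zero_pow (by omega)⟩, fun _ => ⟨0, zero_pow (by omega)⟩⟩
    by_cases hh0 : h = 0
    · rw [hh0]
      simp only [map_zero, div_zero]
      exact ⟨fun _ => ⟨0, zero_pow (by omega)⟩, fun _ => ⟨0, zero_pow (by omega)⟩⟩
    rw [exists_pow_eq_div_iff (fun h0 => hh0 (transcendental_iff.1 hxt _ h0)) hN,
      exists_pow_eq_div_iff (fun h0 => hh0 (transcendental_iff.1 hyt _ h0)) hN]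
    simp only [← map_pow, ← map_mul]
    exact hpoly _ (mul_ne_zero hg0 (pow_ne_zero _ hh0)) N hN
  have : CharZero F⟮x⟯ := charZero_of_injective_algebraMap (algebraMap F F⟮x⟯).injective
  have : CharZero (algebraicClosure F⟮x⟯ M) :=
    charZero_of_injective_algebraMap (algebraMap F⟮x⟯ _).injective
  have hcl₁ := algebraicClosure_closed (M := M) F⟮x⟯
  obtain ⟨ψ⟩ := hc.algebraicClosure.nonempty_algHom hp hv.comap
    (isHenselianVal_comap_of_closed hcl₁ hM) (RatPow.of_closed hcl₁ hRM)
    (IsPadicVal.germ (U := U) hp (hv.comap (E := F))) (IsHenselianVal.germ hH)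
  refine exists_specialization_of_germ ψ.toRingHom (fun c => ?_) u
  rw [← hconst, IsScalarTower.algebraMap_apply F F⟮x⟯ (algebraicClosure F⟮x⟯ M)]
  refine (ψ.commutes _).trans ?_
  exact φ.commutes c

end Step

end PadicPV

namespace PadicPV

open Polynomial IntermediateField Filter

universe w

theorem exists_specialization_cons {F M : Type*} [Field F] [Field M] [Algebra F M] {m : ℕ}
    (h : ∀ u : Fin m → M, ∃ a : Fin m → F, ∀ g : MvPolynomial (Fin m) F,
      MvPolynomial.aeval u g = 0 → MvPolynomial.eval a g = 0)
    (u : Fin (m + 1) → M) (hu : u 0 ∈ Set.range (algebraMap F M)) :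
    ∃ a : Fin (m + 1) → F, ∀ g : MvPolynomial (Fin (m + 1)) F,
      MvPolynomial.aeval u g = 0 → MvPolynomial.eval a g = 0 := by
  obtain ⟨c, hc⟩ := hu
  obtain ⟨a, ha⟩ := h (fun i => u i.succ)
  refine ⟨Fin.cons c a, fun g hg => ?_⟩
  let σ : MvPolynomial (Fin (m + 1)) F →ₐ[F] MvPolynomial (Fin m) F :=
    MvPolynomial.aeval (Fin.cons (MvPolynomial.C c) MvPolynomial.X)
  have h1 : (MvPolynomial.aeval (R := F) fun i : Fin m => u i.succ).comp σ
      = MvPolynomial.aeval u := by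
    ext i
    refine Fin.cases ?_ (fun j => ?_) i <;> simp [σ, hc]
  have h2 : (MvPolynomial.aeval (R := F) a).comp σ
      = MvPolynomial.aeval (Fin.cons c a : Fin (m + 1) → F) := by
    ext i
    refine Fin.cases ?_ (fun j => ?_) i <;> simp [σ]
  have h3 := ha (σ g) ((DFunLike.congr_fun h1 g).trans hg)
  rw [← MvPolynomial.coe_aeval_eq_eval] at h3 ⊢
  exact (DFunLike.congr_fun h2 g).symm.trans h3

theorem IsPadicVal.exists_specialization {M : Type w} {Γ : Type*} [Field M] [CharZero M]
    [LinearOrderedCommGroupWithZero Γ] {v : Valuation M Γ} {p : ℕ} (hp : p.Prime)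
    (hv : IsPadicVal p v) (hM : IsHenselianVal v) (hRM : RatPow M) {m : ℕ} :
    ∀ {F : Type w} [Field F] [Algebra F M],
      (∀ y : M, IsAlgebraic F y → y ∈ Set.range (algebraMap F M)) → ∀ u : Fin m → M,
      ∃ a : Fin m → F, ∀ g : MvPolynomial (Fin m) F,
        MvPolynomial.aeval u g = 0 → MvPolynomial.eval a g = 0 := by
  induction m with
  | zero =>
    intro F _ _ _ u
    refine ⟨Fin.elim0, fun g hg => ?_⟩
    have hu : u = fun i => algebraMap F M ((Fin.elim0 : Fin 0 → F) i) := Subsingleton.elim _ _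
    rw [hu] at hg
    have := MvPolynomial.aeval_algebraMap_apply (B := M) (Fin.elim0 : Fin 0 → F) g
    refine (algebraMap F M).injective ?_
    rw [map_zero, ← hg]
    exact this.symm
  | succ m ih =>
    intro F _ _ hcl u
    by_cases hu : u 0 ∈ Set.range (algebraMap F M)
    · exact exists_specialization_cons (ih hcl) u hu
    · obtain ⟨b, hb⟩ := exists_specialization_cons
        (ih (F := algebraicClosure F⟮u 0⟯ M) (algebraicClosure_closed (M := M) F⟮u 0⟯)) u
        ⟨⟨u 0, mem_algebraicClosure_iff.2
          (isAlgebraic_algebraMap (AdjoinSimple.gen F (u 0)))⟩, rfl⟩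
      obtain ⟨a, ha⟩ := hv.exists_specialization_closure_adjoin hp hM hRM hcl hu b
      have : IsScalarTower F (algebraicClosure F⟮u 0⟯ M) M := .of_algebraMap_eq fun _ => rfl
      refine ⟨a, fun g hg => ha g ?_⟩
      have h1 := hb (MvPolynomial.map (algebraMap F _) g) (by
        rw [MvPolynomial.aeval_map_algebraMap]
        exact hg)
      rwa [MvPolynomial.eval_map, ← MvPolynomial.aeval_def] at h1

end PadicPV

namespace PadicPV

section CoeffDeriv

variable {σ R : Type*} [CommRing R] (d : Derivation ℤ R R)

/-- The derivation of a multivariate polynomial ring acting on the coefficients. -/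
noncomputable def coeffDeriv : Derivation ℤ (MvPolynomial σ R) (MvPolynomial σ R) :=
  have hc (f : MvPolynomial σ R) (m : σ →₀ ℕ) :
      (∑ s ∈ f.support, MvPolynomial.monomial s (d (f.coeff s))).coeff m = d (f.coeff m) := by
    classical
    rw [MvPolynomial.coeff_sum]
    simp only [MvPolynomial.coeff_monomial]
    rw [Finset.sum_ite_eq' f.support m]
    split_ifs with h
    · rfl
    · rw [MvPolynomial.notMem_support_iff.1 h, map_zero]
  let D : MvPolynomial σ R →+ MvPolynomial σ R :=
    { toFun := fun f => ∑ s ∈ f.support, MvPolynomial.monomial s (d (f.coeff s))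
      map_zero' := by simp
      map_add' := fun f g => by
        ext m
        rw [hc, MvPolynomial.coeff_add, MvPolynomial.coeff_add, map_add, hc, hc] }
  have hD (f : MvPolynomial σ R) (m : σ →₀ ℕ) : (D f).coeff m = d (f.coeff m) := hc f m
  Derivation.mk' D.toIntLinearMap fun f g => by
    change D (f * g) = f * D g + g * D f
    induction g using MvPolynomial.induction_on with
    | C a =>
      ext m
      have h : D (MvPolynomial.C a : MvPolynomial σ R) = MvPolynomial.C (d a) := by
        classical
        ext m
        rw [hD, MvPolynomial.coeff_C, MvPolynomial.coeff_C]
        split_ifs <;> simp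
      rw [h, hD, MvPolynomial.coeff_add, mul_comm f, mul_comm f, MvPolynomial.coeff_C_mul,
        MvPolynomial.coeff_C_mul, MvPolynomial.coeff_C_mul, hD]
      simp [add_comm, mul_comm]
    | add p q hp hq =>
      rw [mul_add, map_add, map_add, hp, hq]
      ring
    | mul_X p i hp =>
      have h (q : MvPolynomial σ R) : D (q * MvPolynomial.X i) = D q * MvPolynomial.X i := by
        classical
        ext m
        rw [hD, MvPolynomial.coeff_mul_X', MvPolynomial.coeff_mul_X']
        split_ifs
        · rw [hD]
        · exact map_zero d
      rw [← mul_assoc, h, h, hp]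
      ring

theorem coeff_coeffDeriv (f : MvPolynomial σ R) (m : σ →₀ ℕ) :
    (coeffDeriv d f).coeff m = d (f.coeff m) := by
  classical
  change (∑ s ∈ f.support, MvPolynomial.monomial s (d (f.coeff s))).coeff m = _
  rw [MvPolynomial.coeff_sum]
  simp only [MvPolynomial.coeff_monomial]
  rw [Finset.sum_ite_eq' f.support m]
  split_ifs with h
  · rfl
  · rw [MvPolynomial.notMem_support_iff.1 h, map_zero]

@[simp]
theorem coeffDeriv_C (a : R) :
    coeffDeriv d (MvPolynomial.C a : MvPolynomial σ R) = MvPolynomial.C (d a) := by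
  classical
  ext m
  rw [coeff_coeffDeriv, MvPolynomial.coeff_C, MvPolynomial.coeff_C]
  split_ifs <;> simp

@[simp]
theorem coeffDeriv_X (i : σ) : coeffDeriv d (MvPolynomial.X i : MvPolynomial σ R) = 0 := by
  classical
  ext m
  rw [coeff_coeffDeriv, MvPolynomial.coeff_X, MvPolynomial.coeff_zero]
  split_ifs <;> simp

/-- If a ring homomorphism `φ` out of a polynomial ring commutes with derivations on constants
and variables, it commutes with them everywhere. -/
theorem map_derivation_of_generators {S : Type*} [CommRing S]
    (D : Derivation ℤ (MvPolynomial σ R) (MvPolynomial σ R)) (E : Derivation ℤ S S)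
    (φ : MvPolynomial σ R →+* S)
    (hC : ∀ a, E (φ (MvPolynomial.C a)) = φ (D (MvPolynomial.C a)))
    (hX : ∀ i, E (φ (MvPolynomial.X i)) = φ (D (MvPolynomial.X i))) (f : MvPolynomial σ R) :
    E (φ f) = φ (D f) := by
  induction f using MvPolynomial.induction_on with
  | C a => exact hC a
  | add p q hp hq => simp only [map_add, hp, hq]
  | mul_X p i hp =>
    simp only [map_mul, Derivation.leibniz, smul_eq_mul, map_add, hp, hX]

end CoeffDeriv

/-- A linear subspace of a polynomial ring over a differential field which is stable under the
coefficientwise derivation is spanned by its elements with constant coefficients. -/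
theorem mem_span_of_coeffDeriv_mem {σ k L : Type*} [Field k] [Field L] [Algebra k L]
    (d : Derivation ℤ L L) (hd : ∀ x, d x = 0 → x ∈ Set.range (algebraMap k L))
    (J : Submodule L (MvPolynomial σ L)) (hJ : ∀ f ∈ J, coeffDeriv d f ∈ J)
    (f : MvPolynomial σ L) (hf : f ∈ J) :
    f ∈ Submodule.span L {g | g ∈ J ∧ ∃ h : MvPolynomial σ k,
      MvPolynomial.map (algebraMap k L) h = g} := by
  classical
  induction hN : f.support.card using Nat.strong_induction_on generalizing f with
  | _ N ih =>
  by_cases hf0 : f = 0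
  · rw [hf0]
    exact zero_mem _
  have hex : ∃ c, ∃ g ∈ J, g ≠ 0 ∧ g.support ⊆ f.support ∧ g.support.card = c :=
    ⟨_, f, hf, hf0, subset_rfl, rfl⟩
  obtain ⟨g, hgJ, hg0, hgf, hgc⟩ := Nat.find_spec hex
  obtain ⟨s, hs⟩ := MvPolynomial.exists_coeff_ne_zero hg0
  set h : MvPolynomial σ L := (g.coeff s)⁻¹ • g with hh
  have hhs : h.coeff s = 1 := by
    rw [hh, MvPolynomial.coeff_smul, smul_eq_mul, inv_mul_cancel₀ hs]
  have hhJ : h ∈ J := J.smul_mem _ hgJ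
  have hhg : h.support ⊆ g.support := MvPolynomial.support_smul
  have hdh : coeffDeriv d h = 0 := by
    by_contra h0
    have hsub : (coeffDeriv d h).support ⊆ g.support.erase s := by
      intro m hm
      rw [MvPolynomial.mem_support_iff, coeff_coeffDeriv] at hm
      refine Finset.mem_erase.2 ⟨?_, hhg ?_⟩
      · rintro rfl
        rw [hhs] at hm
        exact hm d.map_one_eq_zero
      · rw [MvPolynomial.mem_support_iff]
        intro h1
        rw [h1, map_zero] at hm
        exact hm rfl
    refine Nat.find_min hex (m := (coeffDeriv d h).support.card) ?_
      ⟨_, hJ _ hhJ, h0, hsub.trans ((Finset.erase_subset _ _).trans hgf), rfl⟩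
    rw [← hgc]
    exact (Finset.card_le_card hsub).trans_lt
      (Finset.card_erase_lt_of_mem (MvPolynomial.mem_support_iff.2 hs))
  have hhk : ∃ q : MvPolynomial σ k, MvPolynomial.map (algebraMap k L) q = h := by
    have : h ∈ Set.range (MvPolynomial.map (σ := σ) (algebraMap k L)) := by
      rw [MvPolynomial.mem_range_map_iff_coeffs_subset]
      intro c hc
      obtain ⟨m, -, rfl⟩ := MvPolynomial.mem_coeffs_iff.1 hc
      refine hd _ ?_
      rw [← coeff_coeffDeriv, hdh, MvPolynomial.coeff_zero]
    exact this
  have hrest : f - f.coeff s • h ∈ Submodule.span L {g | g ∈ J ∧ ∃ h : MvPolynomial σ k,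
      MvPolynomial.map (algebraMap k L) h = g} := by
    refine ih _ ?_ _ (J.sub_mem hf (J.smul_mem _ hhJ)) rfl
    rw [← hN]
    refine (Finset.card_le_card (t := f.support.erase s) ?_).trans_lt
      (Finset.card_erase_lt_of_mem (hgf (MvPolynomial.mem_support_iff.2 hs)))
    intro m hm
    rw [MvPolynomial.mem_support_iff, MvPolynomial.coeff_sub, MvPolynomial.coeff_smul] at hm
    refine Finset.mem_erase.2 ⟨?_, ?_⟩
    · rintro rfl
      rw [hhs] at hm
      simp at hm
    · by_contra hmf
      have h1 : f.coeff m = 0 := MvPolynomial.notMem_support_iff.1 hmf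
      have h2 : h.coeff m = 0 := MvPolynomial.notMem_support_iff.1 fun h3 => hmf (hgf (hhg h3))
      rw [h1, h2] at hm
      simp at hm
  rw [← sub_add_cancel f (f.coeff s • h)]
  exact Submodule.add_mem _ hrest
    (Submodule.smul_mem _ _ (Submodule.subset_span ⟨hhJ, hhk⟩))

end PadicPV

namespace PadicPV

theorem exists_specialization_of_finite {F M ι : Type*} [Field F] [Field M] [Algebra F M]
    [Finite ι] (h : ∀ m, ∀ u : Fin m → M, ∃ a : Fin m → F, ∀ g : MvPolynomial (Fin m) F,
      MvPolynomial.aeval u g = 0 → MvPolynomial.eval a g = 0) (u : ι → M) :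
    ∃ a : ι → F, ∀ g : MvPolynomial ι F,
      MvPolynomial.aeval u g = 0 → MvPolynomial.eval a g = 0 := by
  obtain ⟨m, ⟨e⟩⟩ := Finite.exists_equiv_fin ι
  obtain ⟨a, ha⟩ := h m (u ∘ e.symm)
  refine ⟨a ∘ e, fun g hg => ?_⟩
  have h1 := ha (MvPolynomial.rename e g) (by
    rw [MvPolynomial.aeval_rename, Function.comp_assoc, Equiv.symm_comp_self]
    exact hg)
  rwa [MvPolynomial.eval_rename] at h1

theorem exists_matrix_specialization {F M : Type*} [Field F] [Field M] [Algebra F M]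
    (h : ∀ m, ∀ u : Fin m → M, ∃ a : Fin m → F, ∀ g : MvPolynomial (Fin m) F,
      MvPolynomial.aeval u g = 0 → MvPolynomial.eval a g = 0) {n : ℕ}
    (B : Matrix (Fin n) (Fin n) M) (hB : IsUnit B.det) :
    ∃ C : Matrix (Fin n) (Fin n) F, IsUnit C.det ∧ ∀ g : MvPolynomial (Fin n × Fin n) F,
      MvPolynomial.aeval (fun q : Fin n × Fin n => B q.1 q.2) g = 0 →
        MvPolynomial.eval (fun q : Fin n × Fin n => C q.1 q.2) g = 0 := by
  let u : Option (Fin n × Fin n) → M := fun o => o.elim B.det⁻¹ fun q => B q.1 q.2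
  obtain ⟨a, ha⟩ := exists_specialization_of_finite h u
  refine ⟨Matrix.of fun i j => a (some (i, j)), ?_, fun g hg => ?_⟩
  · let D : Matrix (Fin n) (Fin n) (MvPolynomial (Option (Fin n × Fin n)) F) :=
      Matrix.of fun i j => MvPolynomial.X (some (i, j))
    have h1 := ha (D.det * MvPolynomial.X none - 1) (by
      have : (MvPolynomial.aeval (R := F) u) D.det = B.det := by
        rw [AlgHom.map_det]
        congr 1
        ext i j
        simp [D, u]
      rw [map_sub, map_mul, this, MvPolynomial.aeval_X, map_one]
      simp only [u, Option.elim_none]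
      rw [mul_inv_cancel₀ hB.ne_zero, sub_self])
    have h2 : MvPolynomial.eval a D.det
        = (Matrix.of fun i j => a (some (i, j)) : Matrix (Fin n) (Fin n) F).det := by
      rw [RingHom.map_det]
      congr 1
      ext i j
      simp [D]
    rw [map_sub, map_mul, h2, MvPolynomial.eval_X, map_one] at h1
    exact IsUnit.of_mul_eq_one _ (sub_eq_zero.1 h1)
  · have h1 := ha (MvPolynomial.rename some g) (by
      rw [MvPolynomial.aeval_rename]
      exact hg)
    rw [MvPolynomial.eval_rename] at h1
    exact h1

section Torsor

variable {k K L Ω : Type*} [Field k] [Field K] [Field L] [Field Ω]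
  [Algebra K L] [Algebra k L] [Algebra L Ω] [Algebra K Ω] [Algebra k Ω]
  [IsScalarTower K L Ω] [IsScalarTower k L Ω] {n : ℕ}

/-- The substitution `X ↦ F * Y` on polynomials in the entries of a square matrix. -/
noncomputable def matrixSubst (F : Matrix (Fin n) (Fin n) L) :
    MvPolynomial (Fin n × Fin n) K →ₐ[K] MvPolynomial (Fin n × Fin n) L :=
  MvPolynomial.aeval fun q =>
    ∑ l, MvPolynomial.C (F q.1 l) * MvPolynomial.X (l, q.2)

theorem aeval_matrixSubst (F : Matrix (Fin n) (Fin n) L) (B : Matrix (Fin n) (Fin n) Ω)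
    (f : MvPolynomial (Fin n × Fin n) K) :
    MvPolynomial.aeval (fun q : Fin n × Fin n => B q.1 q.2) (matrixSubst F f)
      = MvPolynomial.aeval (fun q : Fin n × Fin n => (F.map (algebraMap L Ω) * B) q.1 q.2) f := by
  have : ((MvPolynomial.aeval (R := L) fun q : Fin n × Fin n => B q.1 q.2).restrictScalars K).comp
      (matrixSubst F)
      = MvPolynomial.aeval fun q : Fin n × Fin n => (F.map (algebraMap L Ω) * B) q.1 q.2 := by
    ext q
    simp [matrixSubst, Matrix.mul_apply]
  exact DFunLike.congr_fun this f

/-- The derivation on polynomials in the entries of a square matrix `X` with `X' = A X`. -/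
noncomputable def linearDeriv (d : Derivation ℤ K K) (A : Matrix (Fin n) (Fin n) K) :
    Derivation ℤ (MvPolynomial (Fin n × Fin n) K) (MvPolynomial (Fin n × Fin n) K) :=
  coeffDeriv d + (MvPolynomial.mkDerivation K fun q : Fin n × Fin n =>
    ∑ l, MvPolynomial.C (A q.1 l) * MvPolynomial.X (l, q.2)).restrictScalars ℤ

theorem linearDeriv_C (d : Derivation ℤ K K) (A : Matrix (Fin n) (Fin n) K) (a : K) :
    linearDeriv d A (MvPolynomial.C a) = MvPolynomial.C (d a) := by
  simp [linearDeriv]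

theorem linearDeriv_X (d : Derivation ℤ K K) (A : Matrix (Fin n) (Fin n) K) (q : Fin n × Fin n) :
    linearDeriv d A (MvPolynomial.X q)
      = ∑ l, MvPolynomial.C (A q.1 l) * MvPolynomial.X (l, q.2) := by
  simp [linearDeriv]

variable {dK : Derivation ℤ K K} {d : Derivation ℤ L L} {A : Matrix (Fin n) (Fin n) K}
  {F : Matrix (Fin n) (Fin n) L}

theorem deriv_aeval_eq (hd : ∀ a, d (algebraMap K L a) = algebraMap K L (dK a))
    (hF : ∀ i j, d (F i j) = (A.map (algebraMap K L) * F) i j)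
    (f : MvPolynomial (Fin n × Fin n) K) :
    d (MvPolynomial.aeval (fun q : Fin n × Fin n => F q.1 q.2) f)
      = MvPolynomial.aeval (fun q : Fin n × Fin n => F q.1 q.2) (linearDeriv dK A f) := by
  refine map_derivation_of_generators (linearDeriv dK A) d
    (MvPolynomial.aeval (R := K) fun q : Fin n × Fin n => F q.1 q.2).toRingHom
    (fun a => ?_) (fun q => ?_) f
  · simp [linearDeriv_C, hd]
  · simp [linearDeriv_X, hF, Matrix.mul_apply]

theorem coeffDeriv_matrixSubst (hd : ∀ a, d (algebraMap K L a) = algebraMap K L (dK a))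
    (hF : ∀ i j, d (F i j) = (A.map (algebraMap K L) * F) i j)
    (f : MvPolynomial (Fin n × Fin n) K) :
    coeffDeriv d (matrixSubst F f) = matrixSubst F (linearDeriv dK A f) := by
  refine map_derivation_of_generators (linearDeriv dK A) (coeffDeriv d)
    (matrixSubst (K := K) F).toRingHom (fun a => ?_) (fun q => ?_) f
  · change coeffDeriv d (matrixSubst F (MvPolynomial.C a))
      = matrixSubst F (linearDeriv dK A (MvPolynomial.C a))
    simp [linearDeriv_C, matrixSubst, MvPolynomial.algebraMap_apply, hd]
  · change coeffDeriv d (matrixSubst F (MvPolynomial.X q))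
      = matrixSubst F (linearDeriv dK A (MvPolynomial.X q))
    simp only [linearDeriv_X, matrixSubst,
      MvPolynomial.aeval_X, map_sum, map_mul, Derivation.leibniz, coeffDeriv_C, coeffDeriv_X,
      mul_zero, zero_add, smul_eq_mul, hF, Matrix.mul_apply, Matrix.map_apply,
      MvPolynomial.aeval_C, MvPolynomial.algebraMap_apply, Finset.mul_sum]
    rw [Finset.sum_comm]
    refine Finset.sum_congr rfl fun i _ => Finset.sum_congr rfl fun j _ => ?_
    ring

theorem exists_constant_matrix {L₂ : Type*} [Field L₂] [Algebra K L₂] {d₂ : Derivation ℤ L₂ L₂}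
    {F₂ : Matrix (Fin n) (Fin n) L₂}
    (hspec : ∀ m, ∀ u : Fin m → Ω, ∃ a : Fin m → k, ∀ g : MvPolynomial (Fin m) k,
      MvPolynomial.aeval u g = 0 → MvPolynomial.eval a g = 0)
    (hconst : ∀ x, d x = 0 → x ∈ Set.range (algebraMap k L))
    (hd : ∀ a, d (algebraMap K L a) = algebraMap K L (dK a))
    (hF : ∀ i j, d (F i j) = (A.map (algebraMap K L) * F) i j) (hFdet : IsUnit F.det)
    (hd₂ : ∀ a, d₂ (algebraMap K L₂ a) = algebraMap K L₂ (dK a))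
    (hF₂ : ∀ i j, d₂ (F₂ i j) = (A.map (algebraMap K L₂) * F₂) i j)
    (B : Matrix (Fin n) (Fin n) Ω) (hBdet : IsUnit B.det)
    (hB : ∀ f : MvPolynomial (Fin n × Fin n) K,
      MvPolynomial.aeval (fun q : Fin n × Fin n => F₂ q.1 q.2) f = 0 →
        MvPolynomial.aeval (fun q : Fin n × Fin n => B q.1 q.2) f = 0) :
    ∃ C : Matrix (Fin n) (Fin n) k, IsUnit C.det ∧ ∀ f : MvPolynomial (Fin n × Fin n) K,
      MvPolynomial.aeval (fun q : Fin n × Fin n => F₂ q.1 q.2) f = 0 →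
        MvPolynomial.aeval (fun q : Fin n × Fin n => (F * C.map (algebraMap k L)) q.1 q.2) f
          = 0 := by
  set B' : Matrix (Fin n) (Fin n) Ω := F⁻¹.map (algebraMap L Ω) * B with hB'
  have hFB : F.map (algebraMap L Ω) * B' = B := by
    rw [hB', ← Matrix.mul_assoc, ← Matrix.map_mul, Matrix.mul_nonsing_inv F hFdet,
      Matrix.map_one _ (map_zero _) (map_one _), Matrix.one_mul]
  have hB'det : IsUnit B'.det := by
    rw [← hFB, Matrix.det_mul] at hBdet
    exact isUnit_of_mul_isUnit_right hBdet
  obtain ⟨C, hC, hspecC⟩ := exists_matrix_specialization hspec B' hB'det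
  refine ⟨C, hC, ?_⟩
  let S : Set (MvPolynomial (Fin n × Fin n) L) := matrixSubst F ''
    {f : MvPolynomial (Fin n × Fin n) K |
      MvPolynomial.aeval (fun q : Fin n × Fin n => F₂ q.1 q.2) f = 0}
  let J : Ideal (MvPolynomial (Fin n × Fin n) L) := Ideal.span S
  have hJ : ∀ f ∈ J, coeffDeriv d f ∈ J := by
    intro f hf
    induction hf using Submodule.span_induction with
    | mem x hx =>
      obtain ⟨f, hf, rfl⟩ := hx
      rw [coeffDeriv_matrixSubst hd hF]
      refine Ideal.subset_span ⟨_, ?_, rfl⟩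
      have hf' : MvPolynomial.aeval (fun q : Fin n × Fin n => F₂ q.1 q.2) f = 0 := hf
      have := deriv_aeval_eq hd₂ hF₂ f
      rw [hf', map_zero] at this
      exact this.symm
    | zero => rw [map_zero]; exact J.zero_mem
    | add x y _ _ hx hy => rw [map_add]; exact J.add_mem hx hy
    | smul a x hx ih =>
      rw [smul_eq_mul, Derivation.leibniz]
      exact J.add_mem (J.mul_mem_left _ ih) (J.mul_mem_right _ hx)
  have hJB : J ≤ RingHom.ker
      (MvPolynomial.aeval (R := L) fun q : Fin n × Fin n => B' q.1 q.2) := by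
    refine Ideal.span_le.2 ?_
    rintro _ ⟨f, hf, rfl⟩
    change MvPolynomial.aeval (fun q : Fin n × Fin n => B' q.1 q.2) (matrixSubst F f) = 0
    rw [aeval_matrixSubst, hFB]
    exact hB f hf
  have hJC : J.restrictScalars L ≤ LinearMap.ker (MvPolynomial.aeval (R := L)
      fun q : Fin n × Fin n => (C.map (algebraMap k L)) q.1 q.2).toLinearMap := by
    intro f hf
    refine (Submodule.span_le.2 ?_) (mem_span_of_coeffDeriv_mem d hconst
      (J.restrictScalars L) hJ f hf)
    rintro _ ⟨hg, h, rfl⟩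
    have h1 : MvPolynomial.aeval (fun q : Fin n × Fin n => B' q.1 q.2)
        (MvPolynomial.map (algebraMap k L) h) = 0 := hJB hg
    rw [MvPolynomial.aeval_map_algebraMap] at h1
    change MvPolynomial.aeval (fun q : Fin n × Fin n => (C.map (algebraMap k L)) q.1 q.2)
        (MvPolynomial.map (algebraMap k L) h) = 0
    rw [MvPolynomial.aeval_map_algebraMap]
    have h2 := MvPolynomial.aeval_algebraMap_apply (B := L)
      (fun q : Fin n × Fin n => C q.1 q.2) h
    refine h2.trans ?_
    refine (congrArg (algebraMap k L) ?_).trans (map_zero _)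
    exact hspecC h h1
  intro f hf
  have h1 : MvPolynomial.aeval (fun q : Fin n × Fin n => (C.map (algebraMap k L)) q.1 q.2)
      (matrixSubst F f) = 0 := hJC (Ideal.subset_span ⟨f, hf, rfl⟩)
  rw [aeval_matrixSubst] at h1
  simpa using h1

end Torsor

end PadicPV

namespace PadicPV

theorem comap_eq_of_le_comap {R : Type*} [CommRing R] [IsNoetherianRing R] {τ : R →+* R}
    (hτ : Function.Surjective τ) {I : Ideal R} (h : I ≤ I.comap τ) : I.comap τ = I := by
  have hs : ∀ m : ℕ, I.comap (τ ^ (m + 1)) = (I.comap τ).comap (τ ^ m) := fun m => by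
    rw [pow_succ']
    rfl
  have hmono : Monotone fun m : ℕ => I.comap (τ ^ m) := monotone_nat_of_le_succ fun m => by
    rw [hs]
    exact Ideal.comap_mono h
  obtain ⟨m, hm⟩ := WellFoundedGT.monotone_chain_condition ⟨_, hmono⟩
  have h1 : I.comap (τ ^ m) = I.comap (τ ^ (m + 1)) := hm (m + 1) m.le_succ
  rw [hs] at h1
  have hsurj : Function.Surjective (τ ^ m) := by
    rw [RingHom.coe_pow]
    exact hτ.iterate m
  exact (Ideal.comap_injective_of_surjective _ hsurj h1).symm

theorem exists_algEquiv_of_aeval_eq_zero_iff {K L₁ L₂ σ : Type*} [Field K] [Field L₁] [Field L₂]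
    [Algebra K L₁] [Algebra K L₂] {x₁ : σ → L₁} {x₂ : σ → L₂}
    (h : ∀ f : MvPolynomial σ K, MvPolynomial.aeval x₁ f = 0 ↔ MvPolynomial.aeval x₂ f = 0)
    (h₁ : IntermediateField.adjoin K (Set.range x₁) = ⊤)
    (h₂ : IntermediateField.adjoin K (Set.range x₂) = ⊤) :
    ∃ φ : L₁ ≃ₐ[K] L₂, ∀ i, φ (x₁ i) = x₂ i := by
  let I : Ideal (MvPolynomial σ K) := RingHom.ker (MvPolynomial.aeval (R := K) x₁)
  let q₁ : (MvPolynomial σ K ⧸ I) →ₐ[K] L₁ := Ideal.Quotient.liftₐ I (MvPolynomial.aeval x₁)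
    fun f hf => hf
  let q₂ : (MvPolynomial σ K ⧸ I) →ₐ[K] L₂ := Ideal.Quotient.liftₐ I (MvPolynomial.aeval x₂)
    fun f hf => (h f).1 hf
  have hq₁ : Function.Injective q₁ := by
    rw [injective_iff_map_eq_zero]
    intro a ha
    obtain ⟨f, rfl⟩ := Ideal.Quotient.mk_surjective a
    exact Ideal.Quotient.eq_zero_iff_mem.2 ha
  have hq₂ : Function.Injective q₂ := by
    rw [injective_iff_map_eq_zero]
    intro a ha
    obtain ⟨f, rfl⟩ := Ideal.Quotient.mk_surjective a
    exact Ideal.Quotient.eq_zero_iff_mem.2 ((h f).2 ha)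
  let _ : Algebra (MvPolynomial σ K ⧸ I) L₁ := q₁.toRingHom.toAlgebra
  let _ : Algebra (MvPolynomial σ K ⧸ I) L₂ := q₂.toRingHom.toAlgebra
  have : IsScalarTower K (MvPolynomial σ K ⧸ I) L₁ :=
    .of_algebraMap_eq fun c => (q₁.commutes c).symm
  have : IsScalarTower K (MvPolynomial σ K ⧸ I) L₂ :=
    .of_algebraMap_eq fun c => (q₂.commutes c).symm
  have : FaithfulSMul (MvPolynomial σ K ⧸ I) L₁ :=
    (faithfulSMul_iff_algebraMap_injective _ _).2 hq₁
  have : FaithfulSMul (MvPolynomial σ K ⧸ I) L₂ :=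
    (faithfulSMul_iff_algebraMap_injective _ _).2 hq₂
  have : IsFractionRing (MvPolynomial σ K ⧸ I) L₁ := .of_field _ _ fun z => by
    obtain ⟨r, s, e⟩ := (IntermediateField.mem_adjoin_range_iff K x₁ z).1
      (h₁ ▸ IntermediateField.mem_top)
    exact ⟨Ideal.Quotient.mk I r, Ideal.Quotient.mk I s, e⟩
  have : IsFractionRing (MvPolynomial σ K ⧸ I) L₂ := .of_field _ _ fun z => by
    obtain ⟨r, s, e⟩ := (IntermediateField.mem_adjoin_range_iff K x₂ z).1
      (h₂ ▸ IntermediateField.mem_top)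
    exact ⟨Ideal.Quotient.mk I r, Ideal.Quotient.mk I s, e⟩
  let φ : L₁ ≃ₐ[MvPolynomial σ K ⧸ I] L₂ :=
    IsLocalization.algEquiv (nonZeroDivisors (MvPolynomial σ K ⧸ I)) L₁ L₂
  refine ⟨φ.restrictScalars K, fun i => ?_⟩
  have h3 := φ.commutes (Ideal.Quotient.mk I (MvPolynomial.X i))
  have h4 : algebraMap (MvPolynomial σ K ⧸ I) L₁ (Ideal.Quotient.mk I (MvPolynomial.X i)) = x₁ i :=
    MvPolynomial.aeval_X _ _
  have h5 : algebraMap (MvPolynomial σ K ⧸ I) L₂ (Ideal.Quotient.mk I (MvPolynomial.X i)) = x₂ i :=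
    MvPolynomial.aeval_X _ _
  rw [h4, h5] at h3
  exact h3

theorem map_deriv_of_generators {K L₁ L₂ : Type*} [Field K] [Field L₁] [Field L₂]
    [Algebra K L₁] [Algebra K L₂] {dK : Derivation ℤ K K} {d₁ : Derivation ℤ L₁ L₁}
    {d₂ : Derivation ℤ L₂ L₂} (hd₁ : ∀ a, d₁ (algebraMap K L₁ a) = algebraMap K L₁ (dK a))
    (hd₂ : ∀ a, d₂ (algebraMap K L₂ a) = algebraMap K L₂ (dK a)) (φ : L₁ →ₐ[K] L₂) {s : Set L₁}
    (hs : IntermediateField.adjoin K s = ⊤) (h : ∀ x ∈ s, φ (d₁ x) = d₂ (φ x)) (x : L₁) :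
    φ (d₁ x) = d₂ (φ x) := by
  have hx : x ∈ IntermediateField.adjoin K s := hs ▸ IntermediateField.mem_top
  induction hx using IntermediateField.adjoin_induction with
  | mem x hx => exact h x hx
  | algebraMap a => rw [hd₁, φ.commutes, φ.commutes, hd₂]
  | add x y _ _ hx hy => simp only [map_add, hx, hy]
  | inv x _ hx => rw [Derivation.leibniz_inv, map_inv₀, Derivation.leibniz_inv]; simp [hx]
  | mul x y _ _ hx hy => simp [hx, hy]

section Subst

variable {k K L : Type*} [Field k] [Field K] [Field L] [Algebra k K] [Algebra K L] {n : ℕ}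

/-- The substitution `X ↦ X * C` on polynomials in the entries of a square matrix. -/
noncomputable def rightSubst (C : Matrix (Fin n) (Fin n) K) :
    MvPolynomial (Fin n × Fin n) K →ₐ[K] MvPolynomial (Fin n × Fin n) K :=
  MvPolynomial.aeval fun q => ∑ l, MvPolynomial.X (q.1, l) * MvPolynomial.C (C l q.2)

theorem aeval_rightSubst (C : Matrix (Fin n) (Fin n) K) (F : Matrix (Fin n) (Fin n) L)
    (f : MvPolynomial (Fin n × Fin n) K) :
    MvPolynomial.aeval (fun q : Fin n × Fin n => F q.1 q.2) (rightSubst C f)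
      = MvPolynomial.aeval (fun q : Fin n × Fin n => (F * C.map (algebraMap K L)) q.1 q.2) f := by
  have : (MvPolynomial.aeval (R := K) fun q : Fin n × Fin n => F q.1 q.2).comp (rightSubst C)
      = MvPolynomial.aeval fun q : Fin n × Fin n => (F * C.map (algebraMap K L)) q.1 q.2 := by
    ext q
    simp [rightSubst, Matrix.mul_apply]
  exact DFunLike.congr_fun this f

theorem rightSubst_surjective {C : Matrix (Fin n) (Fin n) K} (hC : IsUnit C.det) :
    Function.Surjective (rightSubst C) := by
  have h : (rightSubst C).comp (rightSubst C⁻¹) = AlgHom.id K _ := by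
    ext1 q
    let X : Matrix (Fin n) (Fin n) (MvPolynomial (Fin n × Fin n) K) :=
      Matrix.of fun i j => MvPolynomial.X (i, j)
    have h1 : ∀ i j, rightSubst C (MvPolynomial.X (i, j))
        = (X * C.map (MvPolynomial.C (σ := Fin n × Fin n)) : Matrix _ _ _) i j :=
      fun i j => by simp [X, rightSubst, Matrix.mul_apply]
    have h2 : (rightSubst C).comp (rightSubst C⁻¹) (MvPolynomial.X q)
        = (X * C.map (MvPolynomial.C (σ := Fin n × Fin n))
            * C⁻¹.map (MvPolynomial.C (σ := Fin n × Fin n)) : Matrix _ _ _) q.1 q.2 := by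
      rw [Matrix.mul_apply]
      simp_rw [← h1]
      simp only [AlgHom.comp_apply]
      have h3 : rightSubst C⁻¹ (MvPolynomial.X q)
          = ∑ l, MvPolynomial.X (q.1, l) * MvPolynomial.C (C⁻¹ l q.2) :=
        MvPolynomial.aeval_X _ _
      rw [h3, map_sum]
      refine Finset.sum_congr rfl fun l _ => ?_
      rw [map_mul, MvPolynomial.algHom_C, Matrix.map_apply]
      rfl
    rw [h2, Matrix.mul_assoc, ← Matrix.map_mul, Matrix.mul_nonsing_inv C hC,
      Matrix.map_one _ (map_zero _) (map_one _), Matrix.mul_one]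
    rfl
  intro f
  exact ⟨rightSubst C⁻¹ f, DFunLike.congr_fun h f⟩

end Subst

theorem exists_differential_algEquiv {k K L₁ L₂ : Type*} [Field k] [Field K] [Field L₁] [Field L₂]
    [Algebra k K] [Algebra K L₁] [Algebra K L₂] [Algebra k L₁] [Algebra k L₂]
    [IsScalarTower k K L₁] [IsScalarTower k K L₂] {dK : Derivation ℤ K K}
    {d₁ : Derivation ℤ L₁ L₁} {d₂ : Derivation ℤ L₂ L₂}
    (hk : ∀ c, dK (algebraMap k K c) = 0)
    (hd₁ : ∀ a, d₁ (algebraMap K L₁ a) = algebraMap K L₁ (dK a))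
    (hd₂ : ∀ a, d₂ (algebraMap K L₂ a) = algebraMap K L₂ (dK a))
    {n : ℕ} {A : Matrix (Fin n) (Fin n) K}
    {F₁ : Matrix (Fin n) (Fin n) L₁} {F₂ : Matrix (Fin n) (Fin n) L₂}
    (hF₁ : ∀ i j, d₁ (F₁ i j) = (A.map (algebraMap K L₁) * F₁) i j)
    (hF₂ : ∀ i j, d₂ (F₂ i j) = (A.map (algebraMap K L₂) * F₂) i j)
    (hgen₁ : IntermediateField.adjoin K (Set.range fun q : Fin n × Fin n => F₁ q.1 q.2) = ⊤)
    (hgen₂ : IntermediateField.adjoin K (Set.range fun q : Fin n × Fin n => F₂ q.1 q.2) = ⊤)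
    {C C' : Matrix (Fin n) (Fin n) k} (hC : IsUnit C.det) (hC' : IsUnit C'.det)
    (h : ∀ f : MvPolynomial (Fin n × Fin n) K,
      MvPolynomial.aeval (fun q : Fin n × Fin n => F₂ q.1 q.2) f = 0 →
        MvPolynomial.aeval (fun q : Fin n × Fin n => (F₁ * C.map (algebraMap k L₁)) q.1 q.2) f = 0)
    (h' : ∀ f : MvPolynomial (Fin n × Fin n) K,
      MvPolynomial.aeval (fun q : Fin n × Fin n => F₁ q.1 q.2) f = 0 →
        MvPolynomial.aeval (fun q : Fin n × Fin n => (F₂ * C'.map (algebraMap k L₂)) q.1 q.2) f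
          = 0) :
    ∃ φ : L₁ ≃ₐ[K] L₂, ∀ x, φ (d₁ x) = d₂ (φ x) := by
  have hmap₁ : ∀ D : Matrix (Fin n) (Fin n) k,
      D.map (algebraMap k L₁) = (D.map (algebraMap k K)).map (algebraMap K L₁) := fun D => by
    ext i j
    exact IsScalarTower.algebraMap_apply k K L₁ _
  have hmap₂ : ∀ D : Matrix (Fin n) (Fin n) k,
      D.map (algebraMap k L₂) = (D.map (algebraMap k K)).map (algebraMap K L₂) := fun D => by
    ext i j
    exact IsScalarTower.algebraMap_apply k K L₂ _
  have hunit : ∀ D : Matrix (Fin n) (Fin n) k, IsUnit D.det →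
      IsUnit (D.map (algebraMap k K)).det := fun D hD => by
    have := (algebraMap k K).map_det D
    rw [RingHom.mapMatrix_apply] at this
    rw [← this]
    exact hD.map _
  let I₁ : Ideal (MvPolynomial (Fin n × Fin n) K) :=
    RingHom.ker (MvPolynomial.aeval (R := K) fun q : Fin n × Fin n => F₁ q.1 q.2)
  let I₂ : Ideal (MvPolynomial (Fin n × Fin n) K) :=
    RingHom.ker (MvPolynomial.aeval (R := K) fun q : Fin n × Fin n => F₂ q.1 q.2)
  let σ := (rightSubst (C.map (algebraMap k K))).toRingHom
  let σ' := (rightSubst (C'.map (algebraMap k K))).toRingHom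
  have hσ : I₂ ≤ I₁.comap σ := fun f hf => by
    have := h f hf
    rw [hmap₁, ← aeval_rightSubst] at this
    exact this
  have hσ' : I₁ ≤ I₂.comap σ' := fun f hf => by
    have := h' f hf
    rw [hmap₂, ← aeval_rightSubst] at this
    exact this
  have hle : I₁.comap σ ≤ I₂.comap (σ'.comp σ) := fun f hf => hσ' hf
  have heq : I₂.comap (σ'.comp σ) = I₂ :=
    comap_eq_of_le_comap (τ := σ'.comp σ) (Function.Surjective.comp (g := σ') (f := σ)
      (rightSubst_surjective (hunit _ hC')) (rightSubst_surjective (hunit _ hC))) (hσ.trans hle)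
  have hiff : ∀ f : MvPolynomial (Fin n × Fin n) K,
      MvPolynomial.aeval (fun q : Fin n × Fin n => (F₁ * C.map (algebraMap k L₁)) q.1 q.2) f = 0 ↔
      MvPolynomial.aeval (fun q : Fin n × Fin n => F₂ q.1 q.2) f = 0 := by
    refine fun f => ⟨fun hf => ?_, h f⟩
    rw [hmap₁, ← aeval_rightSubst] at hf
    have h1 : f ∈ I₂.comap (σ'.comp σ) := hle hf
    rw [heq] at h1
    exact h1
  have hgen : IntermediateField.adjoin K
      (Set.range fun q : Fin n × Fin n => (F₁ * C.map (algebraMap k L₁)) q.1 q.2) = ⊤ := by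
    rw [eq_top_iff, ← hgen₁, IntermediateField.adjoin_le_iff]
    rintro _ ⟨q, rfl⟩
    have h1 : F₁ = (F₁ * C.map (algebraMap k L₁)) * (C⁻¹.map (algebraMap k K)).map
        (algebraMap K L₁) := by
      rw [← hmap₁, Matrix.mul_assoc, ← Matrix.map_mul, Matrix.mul_nonsing_inv C hC,
        Matrix.map_one _ (map_zero _) (map_one _), Matrix.mul_one]
    have h2 : F₁ q.1 q.2 = ∑ l, (F₁ * C.map (algebraMap k L₁)) q.1 l *
        algebraMap K L₁ (algebraMap k K (C⁻¹ l q.2)) := by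
      conv_lhs => rw [h1]
      rw [Matrix.mul_apply]
      rfl
    change F₁ q.1 q.2 ∈ _
    rw [h2]
    refine sum_mem fun l _ => mul_mem ?_ (IntermediateField.algebraMap_mem _ _)
    exact IntermediateField.subset_adjoin _ _ ⟨(q.1, l), rfl⟩
  have hG : ∀ i j, d₁ ((F₁ * C.map (algebraMap k L₁)) i j)
      = (A.map (algebraMap K L₁) * (F₁ * C.map (algebraMap k L₁))) i j := by
    intro i j
    rw [← Matrix.mul_assoc, Matrix.mul_apply, Matrix.mul_apply, map_sum]
    refine Finset.sum_congr rfl fun l _ => ?_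
    rw [Derivation.leibniz, hF₁, Matrix.map_apply, IsScalarTower.algebraMap_apply k K L₁, hd₁, hk,
      map_zero, smul_zero, zero_add, smul_eq_mul, mul_comm]
  obtain ⟨φ, hφ⟩ := exists_algEquiv_of_aeval_eq_zero_iff hiff hgen hgen₂
  refine ⟨φ, map_deriv_of_generators hd₁ hd₂ φ.toAlgHom hgen ?_⟩
  rintro _ ⟨q, rfl⟩
  change φ (d₁ ((F₁ * C.map (algebraMap k L₁)) q.1 q.2))
    = d₂ (φ ((F₁ * C.map (algebraMap k L₁)) q.1 q.2))
  rw [hφ q, hF₂, hG, Matrix.mul_apply, Matrix.mul_apply, map_sum]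
  refine Finset.sum_congr rfl fun l _ => ?_
  rw [map_mul]
  congr 1
  · exact φ.commutes _
  · exact hφ (l, q.2)

end PadicPV

namespace PadicPV

theorem mem_range_of_isPAdicallyClosed {p : ℕ} (hp : p.Prime) {k M : Type} [Field k] [Field M]
    [Algebra k M] (hk : IsPAdicallyClosed p k) {Γ : Type*} [LinearOrderedCommGroupWithZero Γ]
    {v : Valuation M Γ} (hv : IsPadicVal p v) (y : M) (hy : IsAlgebraic k y) :
    y ∈ Set.range (algebraMap k M) := by
  obtain ⟨x, hx⟩ := surjective_of_isPadicVal hp hk (hv.comap (E := algebraicClosure k M))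
    ⟨y, mem_algebraicClosure_iff.2 hy⟩
  refine ⟨x, ?_⟩
  have := congrArg (algebraMap (algebraicClosure k M) M) hx
  rwa [← IsScalarTower.algebraMap_apply] at this

/-- A matrix over an extension of `K` inside one `p`-adically closed field specializes over `K`
to any other `p`-adically closed field with the same powers of elements of `K`. -/
theorem PowCompat.exists_matrix {p : ℕ} (hp : p.Prime) {K L M M' : Type} [Field K] [Field L]
    [Field M] [Field M'] [CharZero K] [Algebra K L] [Algebra K M] [Algebra K M'] [Algebra L M]
    [IsScalarTower K L M] (hc : PowCompat K M M') (hM : IsPAdicallyClosed p M)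
    (hM' : IsPAdicallyClosed p M') {Γ Γ' : Type*} [LinearOrderedCommGroupWithZero Γ]
    [LinearOrderedCommGroupWithZero Γ'] {v : Valuation M Γ} {v' : Valuation M' Γ'}
    (hv : IsPadicVal p v) (hv' : IsPadicVal p v') {n : ℕ} (F : Matrix (Fin n) (Fin n) L)
    (hF : IsUnit F.det) :
    ∃ B : Matrix (Fin n) (Fin n) M', IsUnit B.det ∧ ∀ f : MvPolynomial (Fin n × Fin n) K,
      MvPolynomial.aeval (fun q : Fin n × Fin n => F q.1 q.2) f = 0 →
        MvPolynomial.aeval (fun q : Fin n × Fin n => B q.1 q.2) f = 0 := by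
  have : CharZero M := charZero_of_injective_algebraMap (algebraMap K M).injective
  have : CharZero M' := charZero_of_injective_algebraMap (algebraMap K M').injective
  have hH := isHenselianVal_of_isPAdicallyClosed hp hM hv
  have hR := ratPow_of_isPAdicallyClosed hp hM hv
  have hH' := isHenselianVal_of_isPAdicallyClosed hp hM' hv'
  have hcl := algebraicClosure_closed (M := M) K
  have : CharZero (_root_.algebraicClosure K M) :=
    charZero_of_injective_algebraMap (algebraMap K _).injective
  obtain ⟨ψ⟩ := hc.algebraicClosure.nonempty_algHom hp hv.comap
    (isHenselianVal_comap_of_closed hcl hH) (RatPow.of_closed hcl hR) hv' hH'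
  obtain ⟨C, hC, hspec⟩ := exists_matrix_specialization
    (fun m => hv.exists_specialization hp hH hR (m := m) hcl) (F.map (algebraMap L M)) (by
      have := (algebraMap L M).map_det F
      rw [RingHom.mapMatrix_apply] at this
      rw [← this]
      exact hF.map _)
  refine ⟨C.map ψ, ?_, fun f hf => ?_⟩
  · have := ψ.toRingHom.map_det C
    rw [RingHom.mapMatrix_apply] at this
    change IsUnit (C.map ψ.toRingHom).det
    rw [← this]
    exact hC.map _
  · have h1 := hspec (MvPolynomial.map (algebraMap K _) f) (by
      rw [MvPolynomial.aeval_map_algebraMap]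
      have := MvPolynomial.aeval_algebraMap_apply (B := M) (fun q : Fin n × Fin n => F q.1 q.2) f
      rw [hf, map_zero] at this
      exact this)
    rw [MvPolynomial.eval_map, ← MvPolynomial.aeval_def] at h1
    have h2 := congrArg ψ h1
    rw [map_zero] at h2
    exact (MvPolynomial.comp_aeval_apply _ ψ f).symm.trans h2

end PadicPV

/-- A derivation on a field as an additive derivation in the sense of Mathlib. -/
def FieldDeriv.toDerivation {F : Type} [Field F] (D : FieldDeriv F) : Derivation ℤ F F :=
  Derivation.mk' (AddMonoidHom.mk' D.d D.map_add).toIntLinearMap fun a b => by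
    change D.d (a * b) = a * D.d b + b * D.d a
    rw [D.leibniz, mul_comm b]

namespace PadicPV

theorem exists_constant_matrix_of_isPAdicallyClosed {p : ℕ} (hp : p.Prime)
    {k K L L₂ M M₂ : Type} [Field k] [Field K] [CharZero K] [Field L] [Field L₂] [Field M]
    [Field M₂] [Algebra k L] [Algebra K L] [Algebra K L₂]
    [Algebra L M] [Algebra K M] [IsScalarTower K L M]
    [Algebra L₂ M₂] [Algebra K M₂] [IsScalarTower K L₂ M₂]
    (hk : IsPAdicallyClosed p k) (hM : IsPAdicallyClosed p M) (hM₂ : IsPAdicallyClosed p M₂)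
    {Γ Γ₂ : Type*} [LinearOrderedCommGroupWithZero Γ]
    [LinearOrderedCommGroupWithZero Γ₂] {v : Valuation M Γ} {v₂ : Valuation M₂ Γ₂}
    (hv : IsPadicVal p v) (hv₂ : IsPadicVal p v₂) (hc : PowCompat K M₂ M)
    {dK : Derivation ℤ K K} {d : Derivation ℤ L L} {d₂ : Derivation ℤ L₂ L₂} {n : ℕ}
    {A : Matrix (Fin n) (Fin n) K} {F : Matrix (Fin n) (Fin n) L} {F₂ : Matrix (Fin n) (Fin n) L₂}
    (hconst : ∀ x, d x = 0 → x ∈ Set.range (algebraMap k L))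
    (hd : ∀ a, d (algebraMap K L a) = algebraMap K L (dK a))
    (hF : ∀ i j, d (F i j) = (A.map (algebraMap K L) * F) i j) (hFdet : IsUnit F.det)
    (hd₂ : ∀ a, d₂ (algebraMap K L₂ a) = algebraMap K L₂ (dK a))
    (hF₂ : ∀ i j, d₂ (F₂ i j) = (A.map (algebraMap K L₂) * F₂) i j) (hF₂det : IsUnit F₂.det) :
    ∃ C : Matrix (Fin n) (Fin n) k, IsUnit C.det ∧ ∀ f : MvPolynomial (Fin n × Fin n) K,
      MvPolynomial.aeval (fun q : Fin n × Fin n => F₂ q.1 q.2) f = 0 →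
        MvPolynomial.aeval (fun q : Fin n × Fin n => (F * C.map (algebraMap k L)) q.1 q.2) f
          = 0 := by
  obtain ⟨B, hBdet, hB⟩ := hc.exists_matrix hp hM₂ hM hv₂ hv F₂ hF₂det
  let _ : Algebra k M := ((algebraMap L M).comp (algebraMap k L)).toAlgebra
  have : IsScalarTower k L M := .of_algebraMap_eq fun _ => rfl
  have : CharZero M := charZero_of_injective_algebraMap (algebraMap K M).injective
  exact exists_constant_matrix (fun m => hv.exists_specialization hp
      (isHenselianVal_of_isPAdicallyClosed hp hM hv) (ratPow_of_isPAdicallyClosed hp hM hv)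
      (m := m) (mem_range_of_isPAdicallyClosed hp hk hv))
    hconst hd hF hFdet hd₂ hF₂ B hBdet hB

end PadicPV

/-- Unicity of p-adic Picard--Vessiot fields: let `L₁`, `L₂` be p-adic
Picard--Vessiot fields for `y' = A y` over the p-adic differential field `K` (whose field
of constants `k` is p-adically closed, `k ≠ K`).  Suppose `L₁`, `L₂` have p-adic closures
`L₁⁺`, `L₂⁺` (p-adically closed algebraic extensions whose p-adic valuations extend ones
witnessing that `L₁`, `L₂` are p-adic) such that the valuations of `L₁⁺` and `L₂⁺` induce
the same valuation on `K` and `K ∩ (L₁⁺)ⁿ = K ∩ (L₂⁺)ⁿ` for every `n ≥ 2`.  Then `L₁` and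
`L₂` are isomorphic as differential field extensions of `K`. -/
theorem padic_picard_vessiot_unique
    (p : ℕ) (hp : p.Prime)
    (K : Type) [Field K] [CharZero K] (dK : FieldDeriv K)
    (hKpadic : IsPAdicField p K)
    (k : Type) [Field k] [Algebra k K]
    (hconst : ∀ a : K, dK.d a = 0 ↔ a ∈ Set.range (algebraMap k K))
    (hkpc : IsPAdicallyClosed p k)
    (hkK : ∃ a : K, dK.d a ≠ 0)
    (n : ℕ) (A : Matrix (Fin n) (Fin n) K)
    (L₁ L₂ : Type) [Field L₁] [Field L₂] [Algebra K L₁] [Algebra K L₂]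
    (d₁ : FieldDeriv L₁) (d₂ : FieldDeriv L₂)
    (hPV₁ : IsPicardVessiot dK d₁ A) (hpadic₁ : IsPAdicField p L₁)
    (hPV₂ : IsPicardVessiot dK d₂ A) (hpadic₂ : IsPAdicField p L₂)
    -- the p-adic closures `L₁⁺` and `L₂⁺`
    (L₁p L₂p : Type) [Field L₁p] [Field L₂p]
    [Algebra L₁ L₁p] [Algebra L₂ L₂p] [Algebra K L₁p] [Algebra K L₂p]
    [IsScalarTower K L₁ L₁p] [IsScalarTower K L₂ L₂p]
    (halg₁ : Algebra.IsAlgebraic L₁ L₁p) (halg₂ : Algebra.IsAlgebraic L₂ L₂p)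
    (hclosed₁ : IsPAdicallyClosed p L₁p) (hclosed₂ : IsPAdicallyClosed p L₂p)
    (O₁ : ValuationSubring L₁p) (O₂ : ValuationSubring L₂p)
    (hw₁ : PAdicWitness p O₁) (hw₂ : PAdicWitness p O₂)
    (hres₁ : PAdicWitness p (O₁.comap (algebraMap L₁ L₁p)))
    (hres₂ : PAdicWitness p (O₂.comap (algebraMap L₂ L₂p)))
    -- the valuations of `L₁⁺` and `L₂⁺` induce the same valuation on `K`
    (hsameval : ∀ a : K, algebraMap K L₁p a ∈ O₁ ↔ algebraMap K L₂p a ∈ O₂)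
    -- `K ∩ (L₁⁺)ᵐ = K ∩ (L₂⁺)ᵐ` for all `m ≥ 2`
    (hpow : ∀ m : ℕ, 2 ≤ m → ∀ a : K,
      (∃ f : L₁p, f ^ m = algebraMap K L₁p a) ↔ (∃ f : L₂p, f ^ m = algebraMap K L₂p a)) :
    ∃ φ : L₁ ≃ₐ[K] L₂, ∀ x : L₁, φ (d₁.d x) = d₂.d (φ x) := by
  obtain ⟨hd₁, F₁, hdet₁, hF₁, hgen₁, hc₁⟩ := hPV₁
  obtain ⟨hd₂, F₂, hdet₂, hF₂, hgen₂, hc₂⟩ := hPV₂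
  have hv₁ := PadicPV.isPadicVal_of_pAdicWitness hw₁
  have hv₂ := PadicPV.isPadicVal_of_pAdicWitness hw₂
  have hc : PadicPV.PowCompat K L₁p L₂p := by
    intro N hN a
    rcases hN.eq_or_lt with rfl | hN
    · simp only [pow_one, exists_eq]
    · exact hpow N hN a
  let _ : Algebra k L₁ := ((algebraMap K L₁).comp (algebraMap k K)).toAlgebra
  let _ : Algebra k L₂ := ((algebraMap K L₂).comp (algebraMap k K)).toAlgebra
  have : IsScalarTower k K L₁ := .of_algebraMap_eq fun _ => rfl
  have : IsScalarTower k K L₂ := .of_algebraMap_eq fun _ => rfl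
  have hk₁ : ∀ x, d₁.toDerivation x = 0 → x ∈ Set.range (algebraMap k L₁) := fun x hx => by
    obtain ⟨a, ha, rfl⟩ := hc₁ x hx
    obtain ⟨c, rfl⟩ := (hconst a).1 ha
    exact ⟨c, rfl⟩
  have hk₂ : ∀ x, d₂.toDerivation x = 0 → x ∈ Set.range (algebraMap k L₂) := fun x hx => by
    obtain ⟨a, ha, rfl⟩ := hc₂ x hx
    obtain ⟨c, rfl⟩ := (hconst a).1 ha
    exact ⟨c, rfl⟩
  obtain ⟨C, hC, h⟩ := PadicPV.exists_constant_matrix_of_isPAdicallyClosed hp hkpc hclosed₁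
    hclosed₂ hv₁ hv₂ hc.symm (dK := dK.toDerivation) hk₁ hd₁ hF₁ hdet₁
    (d₂ := d₂.toDerivation) hd₂ hF₂ hdet₂
  obtain ⟨C', hC', h'⟩ := PadicPV.exists_constant_matrix_of_isPAdicallyClosed hp hkpc hclosed₂
    hclosed₁ hv₂ hv₁ hc (dK := dK.toDerivation) hk₂ hd₂ hF₂ hdet₂
    (d₂ := d₁.toDerivation) hd₁ hF₁ hdet₁
  exact PadicPV.exists_differential_algEquiv (dK := dK.toDerivation) (d₁ := d₁.toDerivation)
    (d₂ := d₂.toDerivation) (fun c => (hconst _).2 ⟨c, rfl⟩) hd₁ hd₂ hF₁ hF₂ hgen₁ hgen₂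
    hC hC' h h'
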